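/- Let d ≥ 4 be an integer and let R ⊂ (0,∞) be a lacunary set of admissible radii. For every real p with 1 < p ≤ 2 there exists C (independent of q) such that for every integer q ≥ 1 and all finitely supported f : ℤ^d → ℂ, ‖sup_{r∈R}|H^q_r f|‖_{ℓ^p(ℤ^d)} ≤ C·q^{1−d/p′}·‖f‖_{ℓ^p(ℤ^d)}, where p′ = p/(p−1). -/

import Mathlib

open scoped ENNReal NNReal BigOperators
open MeasureTheory

noncomputable section

/-- `e(t) = exp(2πit)`. -/
def eC (t : ℝ) : ℂ := Complex.exp (2 * Real.pi * Complex.I * t)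

/-- `|x|²` for `x ∈ ℤ^d`. -/
def normSqZ {d : ℕ} (x : Fin d → ℤ) : ℤ := ∑ i, (x i) ^ 2

/-- The natural number `r²` of an admissible radius `r`. -/
def radSq (r : ℝ) : ℕ := ⌊r ^ 2⌋₊

/-- `r` is an admissible radius: `r > 0` and `r² ∈ ℕ`. -/
def IsAdmissible (r : ℝ) : Prop := 0 < r ∧ ∃ n : ℕ, r ^ 2 = (n : ℝ)

/-- A set of positive reals is lacunary. -/
def Lacunary (R : Set ℝ) : Prop := ∃ c : ℝ, 1 < c ∧ ∀ r ∈ R, ∀ s ∈ R, r < s → c * r ≤ s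

/-- `N_d(r)`: the number of lattice points on the sphere of radius `r` in `ℤ^d`. -/
def sphereCount (d : ℕ) (r : ℝ) : ℕ := Nat.card {x : Fin d → ℤ // normSqZ x = (radSq r : ℤ)}

/-- The discrete spherical average `A_r f`. -/
def sphAvg (d : ℕ) (r : ℝ) (f : (Fin d → ℤ) → ℂ) (x : Fin d → ℤ) : ℂ :=
  (sphereCount d r : ℂ)⁻¹ *
    ∑' y : Fin d → ℤ, if normSqZ y = (radSq r : ℤ) then f (x - y) else 0

/-- The `ℓ^p(ℤ^d)` norm, valued in `ℝ≥0∞`. -/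
def lpNorm (d : ℕ) (p : ℝ) (f : (Fin d → ℤ) → ℂ) : ℝ≥0∞ :=
  (∑' x : Fin d → ℤ, (‖f x‖₊ : ℝ≥0∞) ^ p) ^ (1 / p)

/-- `(G, B)` is an admissible good/bad prime dichotomy for the set of radii `R`,
with parameter `s`. -/
def GoodBadDichotomy (R : Set ℝ) (G B : Set ℕ) (s : ℝ) : Prop :=
  (∀ p : ℕ, p.Prime → p ∈ G ∪ B) ∧
  (∀ p ∈ G, Nat.Prime p) ∧
  (∀ p ∈ B, Nat.Prime p) ∧
  (∀ p ∈ G, ∀ r ∈ R, IsUnit ((radSq r : ZMod p))) ∧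
  (∀ ε : ℝ, 0 < ε → ∃ C : ℝ, 0 < C ∧ ∀ p ∈ G,
    (({z : ZMod p | ∃ r ∈ R, z = (radSq r : ZMod p)}.ncard : ℝ)) ≤ C * (p : ℝ) ^ ε) ∧
  Summable (fun q : B => (q : ℝ) ^ (-s))

/-- `∏_{i ≤ T} p_i`, the product of the first `⌊T⌋` primes. -/
def primorialUpTo (T : ℝ) : ℕ := ∏ i ∈ Finset.range ⌊T⌋₊, Nat.nth Nat.Prime i

/-- `∏_{j₀ ≤ i ≤ T} p_i` where `p_i` is the `i`-th prime (`1`-indexed). -/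
def prodPrimesFrom (j₀ : ℕ) (T : ℝ) : ℕ :=
  ∏ i ∈ Finset.Icc j₀ ⌊T⌋₊, Nat.nth Nat.Prime (i - 1)

/-- `n_j = 1 + ∏_{i ≤ 2^{j^η}} p_i`. -/
def nseq (η : ℝ) (j : ℕ) : ℕ := 1 + primorialUpTo ((2 : ℝ) ^ ((j : ℝ) ^ η))

/-- The normalized Kloosterman sum `K(q, N; n)`. -/
def kloosterman (d q : ℕ) (N : ℤ) (n : Fin d → ℤ) : ℂ :=
  ((q : ℂ)⁻¹) ^ d *
    ∑ u : Fin q,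
      if Nat.Coprime (u : ℕ) q then
        eC (-(((u : ℕ) : ℝ) * (N : ℝ)) / q) *
          ∑ b : Fin d → Fin q,
            eC ((((u : ℕ) : ℝ) * ∑ i, (((b i : ℕ) : ℝ)) ^ 2
                + ∑ i, ((b i : ℕ) : ℝ) * ((n i : ℝ))) / q)
      else 0

/-- The Ramanujan sum `c_q(N)`. -/
def ramanujanSum (q : ℕ) (N : ℤ) : ℂ :=
  ∑ u : Fin q, if Nat.Coprime (u : ℕ) q then eC ((((u : ℕ) : ℝ) * (N : ℝ)) / q) else 0

/-- The measure `dσ_r = (2 r^{d-1})⁻¹ ℋ^{d-1} ⌞ {|x| = r}` on `ℝ^d`. -/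
def sphMeasure (d : ℕ) (r : ℝ) : Measure (EuclideanSpace ℝ (Fin d)) :=
  (ENNReal.ofReal (2 * r ^ (d - 1)))⁻¹ •
    (μH[((d : ℝ) - 1)] : Measure (EuclideanSpace ℝ (Fin d))).restrict (Metric.sphere 0 r)

/-- The Fourier transform `𝓕dσ_r(ξ) = ∫ e(x·ξ) dσ_r(x)`. -/
def fourierSphMeasure (d : ℕ) (r : ℝ) (ξ : Fin d → ℝ) : ℂ :=
  ∫ x : EuclideanSpace ℝ (Fin d), eC (∑ i, x i * ξ i) ∂(sphMeasure d r)

/-- `Ψ` is a smooth bump: supported in `[-1/4,1/4]^d` and `1` on `[-1/8,1/8]^d`. -/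
def IsBump (d : ℕ) (Ψ : (Fin d → ℝ) → ℝ) : Prop :=
  ContDiff ℝ (⊤ : ℕ∞) Ψ ∧
  (∀ x, x ∉ Set.Icc (fun _ => -(1/4 : ℝ)) (fun _ => (1/4 : ℝ)) → Ψ x = 0) ∧
  (∀ x ∈ Set.Icc (fun _ => -(1/8 : ℝ)) (fun _ => (1/8 : ℝ)), Ψ x = 1)

/-- `Ψ'` is a smooth cutoff with `1_{[-1/4,1/4]^d} ≤ Ψ' ≤ 1_{[-1/2,1/2]^d}`. -/
def IsCutoff (d : ℕ) (Ψ' : (Fin d → ℝ) → ℝ) : Prop :=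
  ContDiff ℝ (⊤ : ℕ∞) Ψ' ∧
  (∀ x, Set.indicator (Set.Icc (fun _ => -(1/4 : ℝ)) (fun _ => (1/4 : ℝ)))
      (fun _ => (1 : ℝ)) x ≤ Ψ' x) ∧
  (∀ x, Ψ' x ≤ Set.indicator (Set.Icc (fun _ => -(1/2 : ℝ)) (fun _ => (1/2 : ℝ)))
      (fun _ => (1 : ℝ)) x)

/-- The Fourier transform of `f : ℤ^d → ℂ`, `f̂(ξ) = ∑_n f(n) e(n·ξ)`. -/
def ftZ {d : ℕ} (f : (Fin d → ℤ) → ℂ) (ξ : Fin d → ℝ) : ℂ :=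
  ∑' n : Fin d → ℤ, f n * eC (∑ i, (n i : ℝ) * ξ i)

/-- The Fourier multiplier operator on `ℤ^d` with 1-periodic multiplier `m`. -/
def mulOp (d : ℕ) (m : (Fin d → ℝ) → ℂ) (f : (Fin d → ℤ) → ℂ) (x : Fin d → ℤ) : ℂ :=
  ∫ ξ in Set.Icc (0 : Fin d → ℝ) 1, m ξ * ftZ f ξ * eC (-∑ i, (x i : ℝ) * ξ i)

/-- The multiplier of `H^q_r`. -/
def mHqr (d q : ℕ) (r : ℝ) (Ψ : (Fin d → ℝ) → ℝ) (ξ : Fin d → ℝ) : ℂ :=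
  ∑' n : Fin d → ℤ,
    kloosterman d q ((radSq r : ℤ)) n * ((Ψ (fun i => (q : ℝ) * ξ i - (n i : ℝ)) : ℝ) : ℂ) *
      fourierSphMeasure d r (fun i => ξ i - (n i : ℝ) / q)

/-- The multiplier of `U^{1,q}_r` for `q = q₁q₂`. -/
def mU1 (d q₁ q₂ : ℕ) (r : ℝ) (Ψ' : (Fin d → ℝ) → ℝ) (ξ : Fin d → ℝ) : ℂ :=
  ∑' n : Fin d → ℤ,
    kloosterman d q₁ ((radSq r : ℤ)) n *
      ((Ψ' (fun i => ((q₁ * q₂ : ℕ) : ℝ) * ξ i - (n i : ℝ)) : ℝ) : ℂ)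

/-- The `ℓ^p(ℤ^d) → ℓ^p(ℤ^d)` operator norm (as a supremum over finitely supported
functions in the unit ball). -/
def opNormLp (d : ℕ) (p : ℝ) (T : ((Fin d → ℤ) → ℂ) → ((Fin d → ℤ) → ℂ)) : ℝ≥0∞ :=
  ⨆ f : {f : (Fin d → ℤ) → ℂ // (Function.support f).Finite ∧ lpNorm d p f ≤ 1},
    lpNorm d p (T f.1)

/-- `𝓕Ψ_q(ζ) = ∫_{ℝ^d} Ψ(qy) e(y·ζ) dy`. -/
def ftPsiQ (d q : ℕ) (Ψ : (Fin d → ℝ) → ℝ) (ζ : Fin d → ℝ) : ℂ :=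
  ∫ y : Fin d → ℝ, ((Ψ (fun i => (q : ℝ) * y i) : ℝ) : ℂ) * eC (∑ i, y i * ζ i)

/-- The kernel `K^q_r(x) = c_q(r² - |x|²) · ((𝓕Ψ_q) * dσ_r)(x)`. -/
def kernelK (d q : ℕ) (r : ℝ) (Ψ : (Fin d → ℝ) → ℝ) (x : Fin d → ℤ) : ℂ :=
  ramanujanSum q ((radSq r : ℤ) - normSqZ x) *
    ∫ y : EuclideanSpace ℝ (Fin d), ftPsiQ d q Ψ (fun i => ((x i : ℝ)) - y i) ∂(sphMeasure d r)

/-- Discrete convolution on `ℤ^d`. -/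
def dconv {d : ℕ} (f g : (Fin d → ℤ) → ℂ) (x : Fin d → ℤ) : ℂ :=
  ∑' y : Fin d → ℤ, f y * g (x - y)

/-- `Ã_r f = f * σ_r` with `σ_r = r^{2-d} 1_{sphere}`. -/
def tildeAvg (d : ℕ) (r : ℝ) (f : (Fin d → ℤ) → ℂ) (x : Fin d → ℤ) : ℂ :=
  (r : ℂ) ^ ((2 : ℤ) - (d : ℤ)) *
    ∑' y : Fin d → ℤ, if normSqZ y = (radSq r : ℤ) then f (x - y) else 0

/-- The error operator `E_r f = Ã_r f - ∑_{1 ≤ q ≤ r} C^q_r f`. -/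
def errOp (d : ℕ) (r : ℝ) (Ψ : (Fin d → ℝ) → ℝ) (f : (Fin d → ℤ) → ℂ) (x : Fin d → ℤ) : ℂ :=
  tildeAvg d r f x - ∑ q ∈ Finset.Icc 1 ⌊r⌋₊, dconv f (kernelK d q r Ψ) x

/-- The Euclidean norm `|x|` of `x ∈ ℤ^d`. -/
def euclNormZ {d : ℕ} (x : Fin d → ℤ) : ℝ := Real.sqrt (∑ i, ((x i : ℝ)) ^ 2)

section

/-- Layer-cake formula for a single extended nonnegative number. -/
lemma ENNReal.rpow_eq_lintegral_layer (g : ℝ≥0∞) {p : ℝ} (hp : 0 < p) :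
    g ^ p = ENNReal.ofReal p * ∫⁻ t in Set.Ioi (0 : ℝ),
      (if ENNReal.ofReal t < g then 1 else 0) * ENNReal.ofReal (t ^ (p - 1)) := by
  have key : ∀ v : ℝ, 0 ≤ v → ENNReal.ofReal (v ^ p) = ENNReal.ofReal p *
      ∫⁻ t in Set.Ioi (0 : ℝ), (if t < v then 1 else 0) * ENNReal.ofReal (t ^ (p - 1)) := by
    intro v hv
    have h1 : ∀ t : ℝ, (if t < v then (1 : ℝ≥0∞) else 0) * ENNReal.ofReal (t ^ (p - 1))
        = (Set.Iio v).indicator (fun t => ENNReal.ofReal (t ^ (p - 1))) t := by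
      intro t; by_cases h : t < v <;> simp [h]
    simp_rw [h1]
    rw [lintegral_indicator measurableSet_Iio, Measure.restrict_restrict measurableSet_Iio,
      Set.inter_comm, Set.Ioi_inter_Iio, restrict_Ioo_eq_restrict_Ioc,
      ← ofReal_integral_eq_lintegral_ofReal]
    · rw [← intervalIntegral.integral_of_le hv, integral_rpow (Or.inl (by linarith)),
        ← ENNReal.ofReal_mul hp.le]
      congr 1
      rw [sub_add_cancel, Real.zero_rpow hp.ne']
      field_simp
      ring
    · exact (intervalIntegrable_iff_integrableOn_Ioc_of_le hv).1
        (intervalIntegral.intervalIntegrable_rpow' (by linarith))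
    · filter_upwards [ae_restrict_mem measurableSet_Ioc] with t ht
      exact Real.rpow_nonneg ht.1.le _
  rcases eq_or_ne g ∞ with rfl | hg
  · rw [ENNReal.top_rpow_of_pos hp]
    symm
    refine ENNReal.eq_top_of_forall_nnreal_le fun r => ?_
    set v : ℝ := (r : ℝ) ^ (1 / p) with hv
    have hv0 : 0 ≤ v := by positivity
    have := key v hv0
    have h2 : (r : ℝ≥0∞) = ENNReal.ofReal (v ^ p) := by
      rw [hv, ← Real.rpow_mul (NNReal.coe_nonneg r), one_div_mul_cancel hp.ne', Real.rpow_one,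
        ENNReal.ofReal_coe_nnreal]
    rw [h2, this]
    gcongr with t
    split_ifs
    all_goals simp_all
  · lift g to ℝ≥0 using hg
    have := key g g.2
    rw [← ENNReal.ofReal_coe_nnreal, ENNReal.ofReal_rpow_of_nonneg (NNReal.coe_nonneg g) hp.le,
      this]
    congr 1
    refine setLIntegral_congr_fun measurableSet_Ioi fun t ht => ?_
    have : (ENNReal.ofReal t < (g : ℝ≥0∞)) ↔ t < g := by
      rw [← ENNReal.ofReal_coe_nnreal, ENNReal.ofReal_lt_ofReal_iff']
      constructor
      · exact fun h => h.1
      · exact fun h => ⟨h, lt_trans ht h⟩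
    simp [this]

lemma lintegral_layer_large {p γ c v : ℝ} (hp : 1 < p) (hγ : 0 < γ) (hc : 0 ≤ c) (hv : 0 ≤ v) :
    ∫⁻ t in Set.Ioi (0 : ℝ), ENNReal.ofReal (c / t) * (if γ * t < v then ENNReal.ofReal v else 0)
      * ENNReal.ofReal (t ^ (p - 1)) ≤ ENNReal.ofReal (c * γ ^ (1 - p) / (p - 1)) *
        ENNReal.ofReal (v ^ p) := by
  have hvγ : 0 ≤ v / γ := by positivity
  have h1 : ∀ t ∈ Set.Ioi (0 : ℝ), ENNReal.ofReal (c / t) *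
      (if γ * t < v then ENNReal.ofReal v else 0) * ENNReal.ofReal (t ^ (p - 1))
        = (Set.Iio (v / γ)).indicator (fun t => ENNReal.ofReal (c * v * t ^ (p - 2))) t := by
    intro t ht
    have ht : 0 < t := ht
    by_cases h : γ * t < v
    · have h' : t < v / γ := by rw [lt_div_iff₀ hγ]; linarith
      rw [if_pos h, Set.indicator_of_mem (Set.mem_Iio.2 h'), ← ENNReal.ofReal_mul (by positivity),
        ← ENNReal.ofReal_mul (by positivity)]
      congr 1
      rw [show p - 1 = (p - 2) + 1 by ring, Real.rpow_add_one ht.ne']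
      field_simp
    · have h' : ¬ t < v / γ := by rw [lt_div_iff₀ hγ]; linarith
      rw [if_neg h, Set.indicator_of_notMem (by simpa using h')]
      simp
  rw [setLIntegral_congr_fun measurableSet_Ioi h1, lintegral_indicator measurableSet_Iio,
    Measure.restrict_restrict measurableSet_Iio, Set.inter_comm, Set.Ioi_inter_Iio,
    restrict_Ioo_eq_restrict_Ioc, ← ofReal_integral_eq_lintegral_ofReal]
  · rw [← intervalIntegral.integral_of_le hvγ, intervalIntegral.integral_const_mul,
      integral_rpow (Or.inl (by linarith)), ← ENNReal.ofReal_mul (by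
        have : 0 < p - 1 := by linarith
        positivity)]
    apply le_of_eq
    congr 1
    rw [show p - 2 + 1 = p - 1 by ring, Real.zero_rpow (by linarith), Real.div_rpow hv hγ.le,
      show (1 - p) = -(p - 1) by ring, Real.rpow_neg hγ.le]
    rcases hv.eq_or_lt with rfl | hv
    · simp [Real.zero_rpow (show p ≠ 0 by linarith)]
    · rw [show p = (p - 1) + 1 by ring, Real.rpow_add_one hv.ne']
      simp only [add_sub_cancel_right, sub_zero]
      ring
  · exact ((intervalIntegrable_iff_integrableOn_Ioc_of_le hvγ).1
        (intervalIntegral.intervalIntegrable_rpow' (by linarith))).const_mul _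
  · filter_upwards [ae_restrict_mem measurableSet_Ioc] with t ht
    have := Real.rpow_nonneg ht.1.le (p - 2)
    positivity

lemma lintegral_layer_small {p γ a v : ℝ} (hp : p < 2 ∨ a = 0) (hγ : 0 < γ)
    (ha : 0 ≤ a) (hv : 0 ≤ v) :
    ∫⁻ t in Set.Ioi (0 : ℝ), ENNReal.ofReal (a / t ^ 2) *
      (if v ≤ γ * t then ENNReal.ofReal (v ^ 2) else 0)
      * ENNReal.ofReal (t ^ (p - 1)) ≤ ENNReal.ofReal (a * γ ^ (2 - p) / (2 - p)) *
        ENNReal.ofReal (v ^ p) := by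
  rcases hp with hp | rfl
  swap
  · simp
  rcases hv.eq_or_lt with rfl | hv
  · simp
  have hvγ : 0 < v / γ := by positivity
  have h1 : ∀ t ∈ Set.Ioi (0 : ℝ), ENNReal.ofReal (a / t ^ 2) *
      (if v ≤ γ * t then ENNReal.ofReal (v ^ 2) else 0) * ENNReal.ofReal (t ^ (p - 1))
        = (Set.Ici (v / γ)).indicator (fun t => ENNReal.ofReal (a * v ^ 2 * t ^ (p - 3))) t := by
    intro t ht
    have ht : 0 < t := ht
    by_cases h : v ≤ γ * t
    · have h' : v / γ ≤ t := by rw [div_le_iff₀ hγ]; linarith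
      rw [if_pos h, Set.indicator_of_mem (Set.mem_Ici.2 h'), ← ENNReal.ofReal_mul (by positivity),
        ← ENNReal.ofReal_mul (by positivity)]
      congr 1
      rw [show p - 1 = (p - 3) + (2 : ℕ) by push_cast; ring, Real.rpow_add_natCast ht.ne']
      field_simp
    · have h' : ¬ v / γ ≤ t := by rw [div_le_iff₀ hγ]; linarith
      rw [if_neg h, Set.indicator_of_notMem (by simpa using h')]
      simp
  rw [setLIntegral_congr_fun measurableSet_Ioi h1, lintegral_indicator measurableSet_Ici,
    Measure.restrict_restrict measurableSet_Ici, Set.inter_eq_left.2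
      (Set.Ici_subset_Ioi.2 hvγ), ← restrict_Ioi_eq_restrict_Ici,
      ← ofReal_integral_eq_lintegral_ofReal]
  · rw [integral_const_mul, integral_Ioi_rpow_of_lt (by linarith) hvγ, ← ENNReal.ofReal_mul (by
        have : 0 < 2 - p := by linarith
        positivity)]
    apply le_of_eq
    congr 1
    rw [show p - 3 + 1 = - (2 - p) by ring, Real.rpow_neg hvγ.le, Real.div_rpow hv.le hγ.le]
    have h2 : v ^ p = v ^ 2 * (v ^ (2 - p))⁻¹ := by
      rw [← Real.rpow_neg hv.le, ← Real.rpow_natCast, ← Real.rpow_add hv]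
      congr 1; push_cast; ring
    rw [h2]
    have : 2 - p ≠ 0 := by linarith
    have : v ^ (2 - p) ≠ 0 := by positivity
    have : γ ^ (2 - p) ≠ 0 := by positivity
    field_simp
  · exact (integrableOn_Ioi_rpow_of_lt (by linarith) hvγ).const_mul _
  · filter_upwards [ae_restrict_mem measurableSet_Ioi] with t ht
    have := Real.rpow_nonneg (hvγ.trans ht).le (p - 3)
    positivity

/-- Marcinkiewicz interpolation, given level set estimates with a truncation at height `γ * t`. -/
theorem marcinkiewicz {ι : Type*} [Countable ι] {M : ι → ℝ≥0∞} {F : ι → ℝ} (hF : ∀ x, 0 ≤ F x)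
    {p γ c a : ℝ} (hp1 : 1 < p) (hp : p < 2 ∨ a = 0) (hγ : 0 < γ) (hc : 0 ≤ c) (ha : 0 ≤ a)
    (h : ∀ t : ℝ, 0 < t → ∑' x, (if ENNReal.ofReal t < M x then (1 : ℝ≥0∞) else 0) ≤
      ENNReal.ofReal (c / t) * ∑' x, (if γ * t < F x then ENNReal.ofReal (F x) else 0) +
      ENNReal.ofReal (a / t ^ 2) * ∑' x, (if F x ≤ γ * t then ENNReal.ofReal (F x ^ 2) else 0)) :
    ∑' x, M x ^ p ≤ ENNReal.ofReal (p * (c * γ ^ (1 - p) / (p - 1) + a * γ ^ (2 - p) / (2 - p))) *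
      ∑' x, ENNReal.ofReal (F x ^ p) := by
  have hp0 : 0 < p := by linarith
  have m1 : ∀ x, Measurable fun t : ℝ => (if ENNReal.ofReal t < M x then (1 : ℝ≥0∞) else 0) *
      ENNReal.ofReal (t ^ (p - 1)) := fun x => by
    refine Measurable.mul (Measurable.ite ?_ measurable_const measurable_const) (by fun_prop)
    exact measurableSet_lt (by fun_prop) (by fun_prop)
  have m2 : ∀ x, Measurable fun t : ℝ => ENNReal.ofReal (c / t) *
      (if γ * t < F x then ENNReal.ofReal (F x) else 0) * ENNReal.ofReal (t ^ (p - 1)) := fun x => by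
    refine Measurable.mul (Measurable.mul (by fun_prop)
      (Measurable.ite ?_ measurable_const measurable_const)) (by fun_prop)
    exact measurableSet_lt (by fun_prop) (by fun_prop)
  have m3 : ∀ x, Measurable fun t : ℝ => ENNReal.ofReal (a / t ^ 2) *
      (if F x ≤ γ * t then ENNReal.ofReal (F x ^ 2) else 0) * ENNReal.ofReal (t ^ (p - 1)) :=
    fun x => by
    refine Measurable.mul (Measurable.mul (by fun_prop)
      (Measurable.ite ?_ measurable_const measurable_const)) (by fun_prop)
    exact measurableSet_le (by fun_prop) (by fun_prop)
  calc ∑' x, M x ^ p = ENNReal.ofReal p * ∫⁻ t in Set.Ioi (0 : ℝ),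
        (∑' x, (if ENNReal.ofReal t < M x then 1 else 0)) * ENNReal.ofReal (t ^ (p - 1)) := by
        simp_rw [fun x => ENNReal.rpow_eq_lintegral_layer (M x) hp0, ENNReal.tsum_mul_left]
        rw [← lintegral_tsum (fun x => (m1 x).aemeasurable)]
        simp_rw [ENNReal.tsum_mul_right]
    _ ≤ ENNReal.ofReal p * ∫⁻ t in Set.Ioi (0 : ℝ),
        ((∑' x, ENNReal.ofReal (c / t) * (if γ * t < F x then ENNReal.ofReal (F x) else 0)
            * ENNReal.ofReal (t ^ (p - 1))) +
          ∑' x, ENNReal.ofReal (a / t ^ 2) * (if F x ≤ γ * t then ENNReal.ofReal (F x ^ 2) else 0)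
            * ENNReal.ofReal (t ^ (p - 1))) := by
        gcongr ENNReal.ofReal p * ?_
        refine setLIntegral_mono' measurableSet_Ioi fun t ht => ?_
        simp_rw [ENNReal.tsum_mul_right, ENNReal.tsum_mul_left]
        rw [← add_mul]
        gcongr
        exact h t ht
    _ ≤ ENNReal.ofReal p * (∑' x, ENNReal.ofReal (c * γ ^ (1 - p) / (p - 1)) *
          ENNReal.ofReal (F x ^ p) + ∑' x, ENNReal.ofReal (a * γ ^ (2 - p) / (2 - p)) *
          ENNReal.ofReal (F x ^ p)) := by
        rw [lintegral_add_left (Measurable.tsum m2),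
          lintegral_tsum (fun x => (m2 x).aemeasurable),
          lintegral_tsum (fun x => (m3 x).aemeasurable)]
        gcongr with x x
        · exact lintegral_layer_large hp1 hγ hc (hF x)
        · exact lintegral_layer_small hp hγ ha (hF x)
    _ = _ := by
        have h2 : 0 ≤ a * γ ^ (2 - p) / (2 - p) := by
          rcases hp with hp | rfl
          · have : 0 < 2 - p := by linarith
            positivity
          · simp
        have h1 : 0 ≤ c * γ ^ (1 - p) / (p - 1) := by
          have : 0 < p - 1 := by linarith
          positivity
        rw [ENNReal.tsum_mul_left, ENNReal.tsum_mul_left, ← add_mul, ← ENNReal.ofReal_add h1 h2,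
          ← mul_assoc, ← ENNReal.ofReal_mul hp0.le]

end

section

/-- The number of points where an extended nonnegative function exceeds `t`. -/
def levelCount {ι : Type*} (M : ι → ℝ≥0∞) (t : ℝ) : ℝ≥0∞ :=
  ∑' x, (if ENNReal.ofReal t < M x then (1 : ℝ≥0∞) else 0)

lemma levelCount_le_add {ι : Type*} {M M₁ M₂ : ι → ℝ≥0∞} (h : ∀ x, M x ≤ M₁ x + M₂ x) (t : ℝ)
    (ht : 0 < t) : levelCount M t ≤ levelCount M₁ (t / 2) + levelCount M₂ (t / 2) := by
  unfold levelCount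
  rw [← ENNReal.tsum_add]
  refine ENNReal.tsum_le_tsum fun x => ?_
  by_cases h1 : ENNReal.ofReal (t / 2) < M₁ x
  · rw [if_pos h1]
    split_ifs <;> simp
  by_cases h2 : ENNReal.ofReal (t / 2) < M₂ x
  · rw [if_pos h2]
    split_ifs <;> simp
  have : ¬ ENNReal.ofReal t < M x := by
    push Not at h1 h2 ⊢
    calc M x ≤ M₁ x + M₂ x := h x
      _ ≤ ENNReal.ofReal (t / 2) + ENNReal.ofReal (t / 2) := add_le_add h1 h2
      _ = ENNReal.ofReal t := by rw [← ENNReal.ofReal_add (by positivity) (by positivity), add_halves]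
  simp [this]

/-- Markov's inequality for counting. -/
lemma levelCount_le {ι : Type*} (M : ι → ℝ≥0∞) {t : ℝ} (ht : 0 < t) :
    levelCount M t ≤ ENNReal.ofReal (1 / t) * ∑' x, M x := by
  unfold levelCount
  rw [← ENNReal.tsum_mul_left]
  refine ENNReal.tsum_le_tsum fun x => ?_
  split_ifs with h
  · calc (1 : ℝ≥0∞) = ENNReal.ofReal (1 / t) * ENNReal.ofReal t := by
          rw [← ENNReal.ofReal_mul (by positivity), one_div_mul_cancel ht.ne', ENNReal.ofReal_one]
      _ ≤ _ := by gcongr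
  · simp

/-- Chebyshev's inequality for counting. -/
lemma levelCount_le_sq {ι : Type*} (M : ι → ℝ≥0∞) {t : ℝ} (ht : 0 < t) :
    levelCount M t ≤ ENNReal.ofReal (1 / t ^ 2) * ∑' x, M x ^ 2 := by
  unfold levelCount
  rw [← ENNReal.tsum_mul_left]
  refine ENNReal.tsum_le_tsum fun x => ?_
  split_ifs with h
  · calc (1 : ℝ≥0∞) = ENNReal.ofReal (1 / t ^ 2) * ENNReal.ofReal t ^ 2 := by
          rw [← ENNReal.ofReal_pow ht.le, ← ENNReal.ofReal_mul (by positivity),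
            one_div_mul_cancel (by positivity), ENNReal.ofReal_one]
      _ ≤ _ := by gcongr
  · simp

/-- Interpolation of a sublinear operator between a weak type `(1,1)` bound and a level set bound
for small functions. -/
theorem interpolate_weak {ι : Type*} [Countable ι] {M : (ι → ℂ) → ι → ℝ≥0∞}
    (hsub : ∀ f g : ι → ℂ, f.support.Finite → g.support.Finite → ∀ x, M (f + g) x ≤ M f x + M g x)
    {p γ c a : ℝ} (hp1 : 1 < p) (hp : p < 2 ∨ a = 0) (hγ : 0 < γ) (hc : 0 ≤ c) (ha : 0 ≤ a)
    (hweak : ∀ f : ι → ℂ, f.support.Finite → ∀ t : ℝ, 0 < t →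
      levelCount (M f) t ≤ ENNReal.ofReal (c / t) * ∑' x, ‖f x‖ₑ)
    (hsmall : ∀ f : ι → ℂ, f.support.Finite → ∀ t : ℝ, 0 < t → (∀ x, ‖f x‖ ≤ γ * t) →
      levelCount (M f) t ≤ ENNReal.ofReal (a / t ^ 2) * ∑' x, ‖f x‖ₑ ^ 2)
    (f : ι → ℂ) (hf : f.support.Finite) :
    ∑' x, M f x ^ p ≤ ENNReal.ofReal (p * (2 * c * (γ / 2) ^ (1 - p) / (p - 1) +
      4 * a * (γ / 2) ^ (2 - p) / (2 - p))) * ∑' x, ‖f x‖ₑ ^ p := by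
  have hnorm : ∀ x, ‖f x‖ₑ ^ p = ENNReal.ofReal (‖f x‖ ^ p) := fun x => by
    rw [← ofReal_norm, ENNReal.ofReal_rpow_of_nonneg (norm_nonneg _) (by linarith)]
  simp_rw [hnorm]
  refine marcinkiewicz (fun x => norm_nonneg _) hp1 (hp.imp_right fun h => by simp [h])
    (by positivity) (by positivity) (by positivity) fun t ht => ?_
  classical
  set f₁ : ι → ℂ := fun x => if γ / 2 * t < ‖f x‖ then f x else 0 with hf₁
  set f₂ : ι → ℂ := fun x => if γ / 2 * t < ‖f x‖ then 0 else f x with hf₂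
  have h12 : f = f₁ + f₂ := by
    ext x; simp only [hf₁, hf₂, Pi.add_apply]; split_ifs <;> simp
  have s1 : f₁.support.Finite := hf.subset fun x hx hx' => hx (by simp [hf₁, hx'])
  have s2 : f₂.support.Finite := hf.subset fun x hx hx' => hx (by simp [hf₂, hx'])
  have ht2 : 0 < t / 2 := by positivity
  refine (levelCount_le_add (M₁ := M f₁) (M₂ := M f₂) (fun x => ?_) t ht).trans ?_
  · conv_lhs => rw [h12]
    exact hsub f₁ f₂ s1 s2 x
  refine add_le_add ((hweak f₁ s1 _ ht2).trans (le_of_eq ?_))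
    ((hsmall f₂ s2 _ ht2 fun x => ?_).trans (le_of_eq ?_))
  · congr 1
    · congr 1; field_simp
    · refine tsum_congr fun x => ?_
      simp only [hf₁]
      split_ifs
      · rw [ofReal_norm]
      · simp
  · simp only [hf₂]
    split_ifs with h
    · simp; positivity
    · linarith
  · congr 1
    · congr 1; field_simp; norm_num
    · refine tsum_congr fun x => ?_
      simp only [hf₂]
      by_cases h : γ / 2 * t < ‖f x‖
      · rw [if_pos h, if_neg (not_le.2 h)]; simp
      · rw [if_neg h, if_pos (not_lt.1 h), ENNReal.ofReal_pow (norm_nonneg _), ofReal_norm]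

/-! ### Dyadic cubes in `ℤ^d` -/

variable {d : ℕ}

/-- The corner of the dyadic cube of side `2 ^ i` containing `x`. -/
def dyCorner (i : ℕ) (x : Fin d → ℤ) : Fin d → ℤ := fun j => 2 ^ i * (x j / 2 ^ i)

/-- The dyadic cube of side `2 ^ i` containing `x`. -/
def dyCube (i : ℕ) (x : Fin d → ℤ) : Finset (Fin d → ℤ) :=
  Fintype.piFinset fun j => Finset.Ico (dyCorner i x j) (dyCorner i x j + 2 ^ i)

lemma mem_dyCube {i : ℕ} {x y : Fin d → ℤ} : y ∈ dyCube i x ↔ dyCorner i y = dyCorner i x := by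
  have h2 : (0 : ℤ) < 2 ^ i := by positivity
  simp only [dyCube, Fintype.mem_piFinset, Finset.mem_Ico, dyCorner, funext_iff]
  refine forall_congr' fun j => ?_
  rw [mul_right_inj' h2.ne']
  constructor
  · rintro ⟨h3, h4⟩
    exact le_antisymm (Int.lt_add_one_iff.1 (Int.ediv_lt_of_lt_mul h2 (by linarith)))
      ((Int.le_ediv_iff_mul_le h2).2 (by linarith))
  · intro h
    have := Int.mul_ediv_add_emod (y j) (2 ^ i)
    have h5 := Int.emod_nonneg (y j) h2.ne'
    have h6 := Int.emod_lt_of_pos (y j) h2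
    rw [h] at this
    constructor <;> linarith

lemma mem_dyCube_self (i : ℕ) (x : Fin d → ℤ) : x ∈ dyCube i x := mem_dyCube.2 rfl

lemma mem_dyCube_comm {i : ℕ} {x y : Fin d → ℤ} : y ∈ dyCube i x ↔ x ∈ dyCube i y := by
  rw [mem_dyCube, mem_dyCube, eq_comm]

lemma card_dyCube (i : ℕ) (x : Fin d → ℤ) : (dyCube i x).card = 2 ^ (i * d) := by
  have h : ((2 : ℤ) ^ i).toNat = 2 ^ i := by exact_mod_cast Int.toNat_natCast (2 ^ i)
  simp [dyCube, Fintype.card_piFinset, pow_mul, h]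

lemma dyCube_eq_of_mem {i : ℕ} {x y : Fin d → ℤ} (h : y ∈ dyCube i x) : dyCube i y = dyCube i x := by
  ext z; rw [mem_dyCube, mem_dyCube, mem_dyCube.1 h]

lemma dyCube_mono {i k : ℕ} (hik : i ≤ k) {x y : Fin d → ℤ} (h : y ∈ dyCube i x) :
    y ∈ dyCube k x := by
  rw [mem_dyCube] at h ⊢
  obtain ⟨m, rfl⟩ := Nat.exists_eq_add_of_le hik
  have h2 : (2 ^ i : ℤ) ≠ 0 := by positivity
  ext j
  have hj := mul_left_cancel₀ h2 (congrFun h j)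
  simp only [dyCorner]
  rw [pow_add, ← Int.ediv_ediv_of_nonneg (by positivity), hj,
    ← Int.ediv_ediv_of_nonneg (by positivity)]

lemma dyCube_subset {i k : ℕ} (hik : i ≤ k) (x : Fin d → ℤ) : dyCube i x ⊆ dyCube k x :=
  fun _ h => dyCube_mono hik h

lemma abs_sub_dyCorner_lt (i : ℕ) (x : Fin d → ℤ) (j : Fin d) :
    |x j - dyCorner i x j| < 2 ^ i := by
  have h2 : (0 : ℤ) < 2 ^ i := by positivity
  have := Int.mul_ediv_add_emod (x j) (2 ^ i)
  have h5 := Int.emod_nonneg (x j) h2.ne'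
  have h6 := Int.emod_lt_of_pos (x j) h2
  simp only [dyCorner]
  rw [abs_lt]; constructor <;> linarith

/-- Symmetry of the relation of lying in the same dyadic cube, as an exchange of summations. -/
lemma tsum_sum_dyCube_comm (i : ℕ) (w : (Fin d → ℤ) → (Fin d → ℤ) → ℝ≥0∞) :
    ∑' x, ∑ y ∈ dyCube i x, w x y = ∑' y, ∑ x ∈ dyCube i y, w x y := by
  classical
  have h : ∀ (x : Fin d → ℤ) (v : (Fin d → ℤ) → ℝ≥0∞), ∑ y ∈ dyCube i x, v y =
      ∑' y, if y ∈ dyCube i x then v y else 0 := fun x v => by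
    rw [tsum_eq_sum (s := dyCube i x) (fun y hy => if_neg hy)]
    exact Finset.sum_congr rfl fun y hy => (if_pos hy).symm
  simp_rw [h]
  rw [ENNReal.tsum_comm]
  simp_rw [mem_dyCube_comm]

/-- The average of `‖F‖` over the dyadic cube at level `i`. -/
def dyAvg (F : (Fin d → ℤ) → ℂ) (i : ℕ) (x : Fin d → ℤ) : ℝ≥0∞ :=
  ((2 : ℝ≥0∞) ^ (i * d))⁻¹ * ∑ y ∈ dyCube i x, ‖F y‖ₑ

/-- The mean of `F` over the dyadic cube at level `i`. -/
def dyMean (F : (Fin d → ℤ) → ℂ) (i : ℕ) (x : Fin d → ℤ) : ℂ :=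
  ((2 : ℂ) ^ (i * d))⁻¹ * ∑ y ∈ dyCube i x, F y

lemma enorm_dyMean_le (F : (Fin d → ℤ) → ℂ) (i : ℕ) (x : Fin d → ℤ) :
    ‖dyMean F i x‖ₑ ≤ dyAvg F i x := by
  unfold dyMean dyAvg
  rw [enorm_mul, enorm_inv (pow_ne_zero _ two_ne_zero), enorm_pow]
  gcongr
  · rw [← ofReal_norm]; simp
  · exact enorm_sum_le _ _

lemma dyAvg_le_succ (F : (Fin d → ℤ) → ℂ) (i : ℕ) (x : Fin d → ℤ) :
    dyAvg F i x ≤ 2 ^ d * dyAvg F (i + 1) x := by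
  unfold dyAvg
  rw [← mul_assoc, add_mul, one_mul, pow_add, ENNReal.mul_inv (by simp) (by simp),
    mul_comm (2 ^ d : ℝ≥0∞), mul_assoc _ _ (2 ^ d : ℝ≥0∞),
    ENNReal.inv_mul_cancel (by positivity) (by simp), mul_one]
  gcongr
  exact dyCube_subset (Nat.le_succ i) x

lemma dyAvg_zero (F : (Fin d → ℤ) → ℂ) (x : Fin d → ℤ) : dyAvg F 0 x = ‖F x‖ₑ := by
  have : dyCube 0 x = {x} := by
    ext y; rw [mem_dyCube]; simp [dyCorner, funext_iff]
  simp [dyAvg, this]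

lemma dyAvg_le (F : (Fin d → ℤ) → ℂ) (i : ℕ) (x : Fin d → ℤ) :
    dyAvg F i x ≤ ((2 : ℝ≥0∞) ^ (i * d))⁻¹ * ∑' y, ‖F y‖ₑ := by
  unfold dyAvg
  gcongr
  exact ENNReal.sum_le_tsum _

/-- The dyadic cube of `x` at level `i` is a maximal one with average above `α`. -/
def IsStop (F : (Fin d → ℤ) → ℂ) (α : ℝ≥0∞) (i : ℕ) (x : Fin d → ℤ) : Prop :=
  α < dyAvg F i x ∧ ∀ k, i < k → dyAvg F k x ≤ α

lemma isStop_congr {F : (Fin d → ℤ) → ℂ} {α : ℝ≥0∞} {i : ℕ} {x y : Fin d → ℤ}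
    (h : y ∈ dyCube i x) : IsStop F α i y ↔ IsStop F α i x := by
  have : ∀ k, i ≤ k → dyAvg F k y = dyAvg F k x := fun k hk => by
    unfold dyAvg; rw [dyCube_eq_of_mem (dyCube_mono hk h)]
  unfold IsStop
  rw [this i le_rfl]
  refine and_congr_right fun _ => forall_congr' fun k => ?_
  exact ⟨fun h hk => this k hk.le ▸ h hk, fun h hk => (this k hk.le).symm ▸ h hk⟩

lemma IsStop.unique {F : (Fin d → ℤ) → ℂ} {α : ℝ≥0∞} {i k : ℕ} {x : Fin d → ℤ}
    (h : IsStop F α i x) (h' : IsStop F α k x) : i = k := by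
  rcases lt_trichotomy i k with hl | hl | hl
  · exact absurd (h.2 k hl) (not_le.2 h'.1)
  · exact hl
  · exact absurd (h'.2 i hl) (not_le.2 h.1)

lemma dyMean_congr (F : (Fin d → ℤ) → ℂ) {i : ℕ} {x y : Fin d → ℤ}
    (h : y ∈ dyCube i x) : dyMean F i y = dyMean F i x := by
  unfold dyMean; rw [dyCube_eq_of_mem h]

open Classical in
/-- The part of the bad function at level `i`. -/
def badPart (F : (Fin d → ℤ) → ℂ) (α : ℝ≥0∞) (i : ℕ) (x : Fin d → ℤ) : ℂ :=
  if IsStop F α i x then F x - dyMean F i x else 0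

lemma sum_badPart_dyCube (F : (Fin d → ℤ) → ℂ) (α : ℝ≥0∞) (i : ℕ) (x : Fin d → ℤ) :
    ∑ y ∈ dyCube i x, badPart F α i y = 0 := by
  classical
  by_cases h : IsStop F α i x
  · have : ∀ y ∈ dyCube i x, badPart F α i y = F y - dyMean F i x := fun y hy => by
      rw [badPart, if_pos ((isStop_congr hy).2 h), dyMean_congr F hy]
    rw [Finset.sum_congr rfl this, Finset.sum_sub_distrib, Finset.sum_const, card_dyCube, dyMean,
      nsmul_eq_mul]
    push_cast
    rw [mul_inv_cancel_left₀ (pow_ne_zero _ two_ne_zero), sub_self]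
  · refine Finset.sum_eq_zero fun y hy => ?_
    rw [badPart, if_neg (mt (isStop_congr hy).1 h)]

open Classical in
lemma tsum_isStop_dyAvg (F : (Fin d → ℤ) → ℂ) (α : ℝ≥0∞) (i : ℕ) :
    ∑' x, (if IsStop F α i x then dyAvg F i x else 0) =
      ∑' x, if IsStop F α i x then ‖F x‖ₑ else 0 := by
  have h1 : ∀ x, (if IsStop F α i x then dyAvg F i x else 0) = ∑ y ∈ dyCube i x,
      ((2 : ℝ≥0∞) ^ (i * d))⁻¹ * if IsStop F α i y then ‖F y‖ₑ else 0 := fun x => by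
    rw [← Finset.mul_sum]
    split_ifs with h
    · rw [dyAvg]
      congr 1
      exact Finset.sum_congr rfl fun y hy => (if_pos ((isStop_congr hy).2 h)).symm
    · rw [Finset.sum_eq_zero fun y hy => if_neg (mt (isStop_congr hy).1 h), mul_zero]
  simp_rw [h1]
  rw [tsum_sum_dyCube_comm]
  refine tsum_congr fun y => ?_
  rw [Finset.sum_const, card_dyCube, nsmul_eq_mul, ← mul_assoc]
  push_cast
  rw [ENNReal.mul_inv_cancel (by positivity) (by simp), one_mul]

open Classical in
lemma sum_isStop_le (F : (Fin d → ℤ) → ℂ) (α : ℝ≥0∞) (I : ℕ) (x : Fin d → ℤ) (v : ℝ≥0∞) :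
    ∑ i ∈ Finset.range I, (if IsStop F α i x then v else 0) ≤ v := by
  by_cases h : ∃ i ∈ Finset.range I, IsStop F α i x
  · obtain ⟨i, hi, h⟩ := h
    rw [Finset.sum_eq_single_of_mem i hi fun k _ hk => if_neg fun h' => hk (h'.unique h), if_pos h]
  · push Not at h
    rw [Finset.sum_eq_zero fun i hi => if_neg (h i hi)]
    exact zero_le

open Classical in
lemma sum_tsum_isStop_dyAvg_le (F : (Fin d → ℤ) → ℂ) (α : ℝ≥0∞) (I : ℕ) :
    ∑ i ∈ Finset.range I, ∑' x, (if IsStop F α i x then dyAvg F i x else 0) ≤ ∑' x, ‖F x‖ₑ := by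
  simp_rw [tsum_isStop_dyAvg]
  rw [← Summable.tsum_finsetSum fun _ _ => ENNReal.summable]
  exact ENNReal.tsum_le_tsum fun x => sum_isStop_le F α I x _

lemma sum_tsum_badPart_le (F : (Fin d → ℤ) → ℂ) (α : ℝ≥0∞) (I : ℕ) :
    ∑ i ∈ Finset.range I, ∑' x, ‖badPart F α i x‖ₑ ≤ 2 * ∑' x, ‖F x‖ₑ := by
  classical
  have h1 : ∀ i x, ‖badPart F α i x‖ₑ ≤ (if IsStop F α i x then ‖F x‖ₑ else 0) +
      (if IsStop F α i x then dyAvg F i x else 0) := fun i x => by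
    unfold badPart
    split_ifs
    · exact (enorm_sub_le).trans (add_le_add le_rfl (enorm_dyMean_le F i x))
    · simp
  calc _ ≤ ∑ i ∈ Finset.range I, (∑' x, (if IsStop F α i x then dyAvg F i x else 0) +
        ∑' x, (if IsStop F α i x then dyAvg F i x else 0)) := by
        refine Finset.sum_le_sum fun i _ => ?_
        refine (ENNReal.tsum_le_tsum (h1 i)).trans (le_of_eq ?_)
        rw [ENNReal.tsum_add, ← tsum_isStop_dyAvg]
    _ ≤ _ := by
        rw [Finset.sum_add_distrib, two_mul]
        exact add_le_add (sum_tsum_isStop_dyAvg_le F α I) (sum_tsum_isStop_dyAvg_le F α I)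

lemma support_badPart_finite (F : (Fin d → ℤ) → ℂ) (hF : F.support.Finite) (α : ℝ≥0∞) (i : ℕ) :
    (badPart F α i).support.Finite := by
  classical
  refine (hF.toFinset.biUnion fun z => dyCube i z).finite_toSet.subset fun x hx => ?_
  have h : IsStop F α i x := by
    by_contra h; exact hx (if_neg h)
  have h1 : dyAvg F i x ≠ 0 := (lt_of_le_of_lt zero_le h.1).ne'
  have h2 : ∑ y ∈ dyCube i x, ‖F y‖ₑ ≠ 0 := fun h0 => h1 (by rw [dyAvg, h0, mul_zero])
  obtain ⟨y, hy, hy'⟩ := Finset.exists_ne_zero_of_sum_ne_zero h2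
  simp only [Finset.coe_biUnion, Set.mem_iUnion]
  exact ⟨y, by simpa using hy', by simpa using mem_dyCube_comm.1 hy⟩

end

section

variable {d : ℕ}

lemma tsum_mul_dyCorner_eq_zero {b : (Fin d → ℤ) → ℂ} (hb : b.support.Finite) (i : ℕ)
    (h0 : ∀ x, ∑ y ∈ dyCube i x, b y = 0) (G : (Fin d → ℤ) → ℂ) :
    ∑' y, b y * G (dyCorner i y) = 0 := by
  classical
  set T := hb.toFinset.biUnion fun z => dyCube i z with hT
  rw [tsum_eq_sum (s := T) fun y hy => ?_]
  · rw [← Finset.sum_image' (f := fun _ => (0 : ℂ)) (g := dyCorner i)]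
    · simp
    intro c hc
    have : {x ∈ T | dyCorner i x = dyCorner i c} = dyCube i c := by
      ext x
      rw [Finset.mem_filter, mem_dyCube, and_iff_right_iff_imp]
      intro hx
      obtain ⟨z, hz, hz'⟩ := Finset.mem_biUnion.1 hc
      exact Finset.mem_biUnion.2 ⟨z, hz, by rw [mem_dyCube, hx, mem_dyCube.1 hz']⟩
    rw [this, Finset.sum_congr rfl fun x hx => by rw [mem_dyCube.1 hx], ← Finset.sum_mul, h0,
      zero_mul]
  · by_contra h
    have : b y ≠ 0 := fun h' => h (by simp [h'])
    exact hy (Finset.mem_biUnion.2 ⟨y, by simpa using this, mem_dyCube_self i y⟩)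

lemma summable_mul_of_support_finite {ι : Type*} {f : ι → ℂ} (hf : f.support.Finite) (g : ι → ℂ) :
    Summable fun y => f y * g y :=
  summable_of_hasFiniteSupport (hf.subset fun y hy h => hy (by simp [h]))

lemma dconv_add {f g : (Fin d → ℤ) → ℂ} (hf : f.support.Finite) (hg : g.support.Finite)
    (K : (Fin d → ℤ) → ℂ) (x : Fin d → ℤ) : dconv (f + g) K x = dconv f K x + dconv g K x := by
  unfold dconv
  rw [← (summable_mul_of_support_finite hf _).tsum_add (summable_mul_of_support_finite hg _)]
  simp [add_mul]

/-- The maximal function attached to a family of convolution kernels. -/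
def maxConv {κ : Type*} (K : κ → (Fin d → ℤ) → ℂ) (f : (Fin d → ℤ) → ℂ) (x : Fin d → ℤ) : ℝ≥0∞ :=
  ⨆ k, ‖dconv f (K k) x‖ₑ

lemma maxConv_add {κ : Type*} (K : κ → (Fin d → ℤ) → ℂ) {f g : (Fin d → ℤ) → ℂ}
    (hf : f.support.Finite) (hg : g.support.Finite) (x : Fin d → ℤ) :
    maxConv K (f + g) x ≤ maxConv K f x + maxConv K g x := by
  refine iSup_le fun k => ?_
  rw [dconv_add hf hg]
  exact (enorm_add_le _ _).trans (add_le_add (le_iSup (fun k => ‖dconv f (K k) x‖ₑ) k)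
    (le_iSup (fun k => ‖dconv g (K k) x‖ₑ) k))

lemma maxConv_zero {κ : Type*} (K : κ → (Fin d → ℤ) → ℂ) (x : Fin d → ℤ) :
    maxConv K 0 x = 0 := by
  simp [maxConv, dconv]

lemma support_sum_finite {ι : Type*} (s : Finset ι) {b : ι → (Fin d → ℤ) → ℂ}
    (hb : ∀ i ∈ s, (b i).support.Finite) : (∑ i ∈ s, b i).support.Finite := by
  classical
  refine (s.finite_toSet.biUnion (t := fun i => (b i).support) hb).subset fun x hx => ?_
  simp only [Function.mem_support, Finset.sum_apply] at hx
  obtain ⟨i, hi, h⟩ := Finset.exists_ne_zero_of_sum_ne_zero hx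
  exact Set.mem_biUnion hi h

lemma maxConv_sum_le {κ ι : Type*} (K : κ → (Fin d → ℤ) → ℂ) (s : Finset ι)
    {b : ι → (Fin d → ℤ) → ℂ} (hb : ∀ i ∈ s, (b i).support.Finite) (x : Fin d → ℤ) :
    maxConv K (∑ i ∈ s, b i) x ≤ ∑ i ∈ s, maxConv K (b i) x := by
  classical
  induction s using Finset.induction_on with
  | empty => simp [maxConv_zero]
  | insert i s hi ih =>
    rw [Finset.sum_insert hi, Finset.sum_insert hi]
    refine (maxConv_add K (hb i (Finset.mem_insert_self i s))
      (support_sum_finite s fun j hj => hb j (Finset.mem_insert_of_mem hj)) x).trans ?_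
    exact add_le_add le_rfl (ih fun j hj => hb j (Finset.mem_insert_of_mem hj))

lemma maxConv_badPart_le {κ : Type*} (K : κ → (Fin d → ℤ) → ℂ) {b : (Fin d → ℤ) → ℂ}
    (hb : b.support.Finite) (i : ℕ) (h0 : ∀ x, ∑ y ∈ dyCube i x, b y = 0) (x : Fin d → ℤ) :
    maxConv K b x ≤
      ∑' y, ‖b y‖ₑ * ⨆ k, ‖K k (x - dyCorner i y - (y - dyCorner i y)) - K k (x - dyCorner i y)‖ₑ := by
  refine iSup_le fun k => ?_
  have h1 : dconv b (K k) x = ∑' y, b y * (K k (x - y) - K k (x - dyCorner i y)) := by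
    simp_rw [mul_sub]
    rw [(summable_mul_of_support_finite hb _).tsum_sub (summable_mul_of_support_finite hb _),
      tsum_mul_dyCorner_eq_zero hb i h0 fun c => K k (x - c), sub_zero]
    rfl
  rw [h1]
  refine enorm_tsum_le_tsum_enorm.trans (ENNReal.tsum_le_tsum fun y => ?_)
  rw [enorm_mul, sub_sub_sub_cancel_right]
  gcongr
  refine le_trans ?_ (le_iSup _ k)
  simp

lemma tsum_box_le (i : ℕ) (c : Fin d → ℤ) :
    ∑' x : Fin d → ℤ, (if ∀ j, |x j - c j| < 2 * 2 ^ i then (1 : ℝ≥0∞) else 0) ≤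
      4 ^ d * 2 ^ (i * d) := by
  classical
  set S : Finset (Fin d → ℤ) :=
    Fintype.piFinset fun j => Finset.Ioo (c j - 2 * 2 ^ i) (c j + 2 * 2 ^ i)
  rw [tsum_eq_sum (s := S) fun x hx => if_neg fun h => hx (Fintype.mem_piFinset.2 fun j => by
    have := abs_lt.1 (h j)
    rw [Finset.mem_Ioo]; constructor <;> linarith)]
  refine (Finset.sum_le_sum (g := fun _ => (1 : ℝ≥0∞)) fun x _ => by split_ifs <;> simp).trans ?_
  rw [Finset.sum_const, nsmul_eq_mul, mul_one]
  have hS : S.card ≤ (4 * 2 ^ i) ^ d := by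
    simp only [S, Fintype.card_piFinset, Int.card_Ioo]
    refine (Finset.prod_le_pow_card _ _ (4 * 2 ^ i) fun j _ => ?_).trans (by simp)
    have : (((4 * 2 ^ i : ℕ)) : ℤ) = 4 * 2 ^ i := by push_cast; ring
    omega
  calc (S.card : ℝ≥0∞) ≤ ((4 * 2 ^ i) ^ d : ℕ) := by exact_mod_cast hS
    _ = _ := by push_cast; rw [mul_pow, pow_mul]

open Classical in
/-- The union of the dilated stopping cubes. -/
def stopNbhd (F : (Fin d → ℤ) → ℂ) (α : ℝ≥0∞) (I : ℕ) : Set (Fin d → ℤ) :=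
  {x | ∃ i ∈ Finset.range I, ∃ y, IsStop F α i y ∧ ∀ j, |x j - dyCorner i y j| < 2 * 2 ^ i}

open Classical in
lemma tsum_stopNbhd_le (F : (Fin d → ℤ) → ℂ) {α : ℝ≥0∞} (hα : α ≠ 0) (hα' : α ≠ ⊤) (I : ℕ) :
    ∑' x, (if x ∈ stopNbhd F α I then (1 : ℝ≥0∞) else 0) ≤ 4 ^ d * α⁻¹ * ∑' x, ‖F x‖ₑ := by
  set w : ℕ → (Fin d → ℤ) → (Fin d → ℤ) → ℝ≥0∞ := fun i y x =>
    (if IsStop F α i y then ((2 : ℝ≥0∞) ^ (i * d))⁻¹ else 0) *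
      (if ∀ j, |x j - dyCorner i y j| < 2 * 2 ^ i then (1 : ℝ≥0∞) else 0) with hw
  have h1 : ∀ x, (if x ∈ stopNbhd F α I then (1 : ℝ≥0∞) else 0) ≤
      ∑ i ∈ Finset.range I, ∑' y, w i y x := fun x => by
    split_ifs with h
    · obtain ⟨i, hi, y, hy, hx⟩ := h
      refine le_trans ?_ (Finset.single_le_sum (f := fun i => ∑' y, w i y x)
        (fun _ _ => zero_le) hi)
      refine le_trans ?_ (ENNReal.sum_le_tsum (dyCube i y))
      rw [Finset.sum_congr rfl (g := fun _ => ((2 : ℝ≥0∞) ^ (i * d))⁻¹) fun z hz => ?_,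
        Finset.sum_const, card_dyCube, nsmul_eq_mul]
      · push_cast
        rw [ENNReal.mul_inv_cancel (by positivity) (by simp)]
      · simp only [hw]
        rw [if_pos ((isStop_congr hz).2 hy), mem_dyCube.1 hz, if_pos hx, mul_one]
    · exact zero_le
  calc _ ≤ ∑' x, ∑ i ∈ Finset.range I, ∑' y, w i y x := ENNReal.tsum_le_tsum h1
    _ = ∑ i ∈ Finset.range I, ∑' y, ∑' x, w i y x := by
        rw [Summable.tsum_finsetSum fun _ _ => ENNReal.summable]
        exact Finset.sum_congr rfl fun i _ => ENNReal.tsum_comm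
    _ ≤ ∑ i ∈ Finset.range I, ∑' y, 4 ^ d * α⁻¹ * (if IsStop F α i y then dyAvg F i y else 0) := by
        refine Finset.sum_le_sum fun i _ => ENNReal.tsum_le_tsum fun y => ?_
        simp only [hw]
        rw [ENNReal.tsum_mul_left]
        split_ifs with h
        · calc _ ≤ ((2 : ℝ≥0∞) ^ (i * d))⁻¹ * (4 ^ d * 2 ^ (i * d)) := by
                gcongr; exact tsum_box_le i _
            _ = 4 ^ d * 1 := by
                rw [mul_left_comm, ENNReal.inv_mul_cancel (by positivity) (by simp)]
            _ = 4 ^ d * (α⁻¹ * α) := by rw [ENNReal.inv_mul_cancel hα hα']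
            _ ≤ _ := by rw [mul_assoc]; gcongr; exact h.1.le
        · simp
    _ ≤ _ := by
        simp_rw [ENNReal.tsum_mul_left]
        rw [← Finset.mul_sum]
        gcongr
        exact sum_tsum_isStop_dyAvg_le F α I

lemma exists_forall_dyAvg_le (hd : 0 < d) (F : (Fin d → ℤ) → ℂ) (hF : ∑' x, ‖F x‖ₑ ≠ ⊤) {α : ℝ≥0∞}
    (hα : α ≠ 0) (hα' : α ≠ ⊤) : ∃ I : ℕ, ∀ i, I ≤ i → ∀ x, dyAvg F i x ≤ α := by
  obtain ⟨n, hn⟩ := ENNReal.exists_nat_gt (ENNReal.div_lt_top hF hα).ne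
  refine ⟨n, fun i hi x => (dyAvg_le F i x).trans ?_⟩
  rw [mul_comm, ← div_eq_mul_inv]
  refine ENNReal.div_le_of_le_mul ?_
  have h1 : ∑' x, ‖F x‖ₑ ≤ n * α := (ENNReal.div_le_iff hα hα').1 hn.le
  refine h1.trans ?_
  rw [mul_comm]
  gcongr
  have : n ≤ 2 ^ (i * d) := (hi.trans (Nat.le_mul_of_pos_right i hd)).trans Nat.lt_two_pow_self.le
  exact_mod_cast this

lemma enorm_good_le (F : (Fin d → ℤ) → ℂ) {α : ℝ≥0∞} {I : ℕ} (hI : ∀ i, I ≤ i → ∀ x, dyAvg F i x ≤ α)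
    (x : Fin d → ℤ) : ‖(F - ∑ i ∈ Finset.range I, badPart F α i) x‖ₑ ≤ 2 ^ d * α := by
  classical
  rw [Pi.sub_apply, Finset.sum_apply]
  by_cases h : ∃ i ∈ Finset.range I, IsStop F α i x
  · obtain ⟨i, hi, h⟩ := h
    have h1 : ∀ k ∈ Finset.range I, k ≠ i → badPart F α k x = 0 := fun k _ hk =>
      if_neg fun h' => hk (IsStop.unique h' h)
    rw [Finset.sum_eq_single_of_mem i hi h1, badPart, if_pos h, sub_sub_cancel]
    exact (enorm_dyMean_le F i x).trans ((dyAvg_le_succ F i x).trans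
      (by gcongr; exact h.2 _ (Nat.lt_succ_self i)))
  · push Not at h
    have h1 : ∀ i ∈ Finset.range I, badPart F α i x = 0 := fun i hi => if_neg (h i hi)
    rw [Finset.sum_eq_zero h1, sub_zero, ← dyAvg_zero]
    have h0 : dyAvg F 0 x ≤ α := by
      by_contra h0
      push Not at h0
      set m := Nat.findGreatest (fun i => α < dyAvg F i x) I
      have hm : α < dyAvg F m x := Nat.findGreatest_spec (P := fun i => α < dyAvg F i x)
        (Nat.zero_le I) h0
      have hmI : m < I := by
        by_contra h'
        exact absurd (hI m (not_lt.1 h') x) (not_le.2 hm)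
      refine h m (Finset.mem_range.2 hmI) ⟨hm, fun k hk => ?_⟩
      by_cases hkI : k ≤ I
      · exact not_lt.1 (Nat.findGreatest_is_greatest (P := fun i => α < dyAvg F i x) hk hkI)
      · exact hI k (not_le.1 hkI).le x
    calc _ ≤ α := h0
      _ = 1 * α := (one_mul _).symm
      _ ≤ _ := by gcongr; exact one_le_pow₀ (by norm_num)

lemma tsum_enorm_good_le (F : (Fin d → ℤ) → ℂ) (α : ℝ≥0∞) (I : ℕ) :
    ∑' x, ‖(F - ∑ i ∈ Finset.range I, badPart F α i) x‖ₑ ≤ 3 * ∑' x, ‖F x‖ₑ := by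
  calc _ ≤ ∑' x, (‖F x‖ₑ + ∑ i ∈ Finset.range I, ‖badPart F α i x‖ₑ) := by
        refine ENNReal.tsum_le_tsum fun x => ?_
        rw [Pi.sub_apply, Finset.sum_apply]
        exact enorm_sub_le.trans (add_le_add le_rfl (enorm_sum_le _ _))
    _ = ∑' x, ‖F x‖ₑ + ∑ i ∈ Finset.range I, ∑' x, ‖badPart F α i x‖ₑ := by
        rw [ENNReal.tsum_add, Summable.tsum_finsetSum fun _ _ => ENNReal.summable]
    _ ≤ ∑' x, ‖F x‖ₑ + 2 * ∑' x, ‖F x‖ₑ := by gcongr; exact sum_tsum_badPart_le F α I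
    _ = _ := by ring

/-- The Hörmander condition for a family of kernels on `ℤ^d`. -/
def Hormander {κ : Type*} (K : κ → (Fin d → ℤ) → ℂ) (B : ℝ) : Prop :=
  ∀ (i : ℕ) (h : Fin d → ℤ), (∀ j, |h j| < 2 ^ i) →
    ∑' x : Fin d → ℤ, (if ∀ j, |x j| < 2 * 2 ^ i then 0 else ⨆ k, ‖K k (x - h) - K k x‖ₑ) ≤
      ENNReal.ofReal B

open Classical in
lemma tsum_maxConv_badPart_le {κ : Type*} {K : κ → (Fin d → ℤ) → ℂ} {B : ℝ} (hB : Hormander K B)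
    (F : (Fin d → ℤ) → ℂ) (hF : F.support.Finite) (α : ℝ≥0∞) (I : ℕ) {i : ℕ}
    (hi : i ∈ Finset.range I) :
    ∑' x, (if x ∈ stopNbhd F α I then 0 else maxConv K (badPart F α i) x) ≤
      ENNReal.ofReal B * ∑' x, ‖badPart F α i x‖ₑ := by
  set W : (Fin d → ℤ) → (Fin d → ℤ) → ℝ≥0∞ := fun h x =>
    if ∀ j, |x j| < 2 * 2 ^ i then 0 else ⨆ k, ‖K k (x - h) - K k x‖ₑ with hW
  calc _ ≤ ∑' x, ∑' y, ‖badPart F α i y‖ₑ * W (y - dyCorner i y) (x - dyCorner i y) := by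
        refine ENNReal.tsum_le_tsum fun x => ?_
        split_ifs with hx
        · exact zero_le
        refine (maxConv_badPart_le K (support_badPart_finite F hF α i) i
          (sum_badPart_dyCube F α i) x).trans (ENNReal.tsum_le_tsum fun y => ?_)
        by_cases hy : IsStop F α i y
        · simp only [hW]
          rw [if_neg fun h => hx ⟨i, hi, y, hy, by simpa using h⟩]
        · simp [badPart, hy]
    _ = ∑' y, ‖badPart F α i y‖ₑ * ∑' x, W (y - dyCorner i y) x := by
        rw [ENNReal.tsum_comm]
        refine tsum_congr fun y => ?_
        rw [ENNReal.tsum_mul_left]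
        congr 1
        exact (Equiv.subRight (dyCorner i y)).tsum_eq (W (y - dyCorner i y))
    _ ≤ ∑' y, ‖badPart F α i y‖ₑ * ENNReal.ofReal B := by
        refine ENNReal.tsum_le_tsum fun y => ?_
        gcongr
        exact hB i _ fun j => abs_sub_dyCorner_lt i y j
    _ = _ := by rw [ENNReal.tsum_mul_right, mul_comm]

/-- The Calderón–Zygmund decomposition yields a weak type `(1,1)` bound. -/
theorem calderon_zygmund (hd : 0 < d) {κ : Type*} {K : κ → (Fin d → ℤ) → ℂ} {a γ B : ℝ}
    (ha : 0 ≤ a) (hγ : 0 < γ) (hB0 : 0 ≤ B)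
    (hsmall : ∀ g : (Fin d → ℤ) → ℂ, g.support.Finite → ∀ t : ℝ, 0 < t → (∀ x, ‖g x‖ ≤ γ * t) →
      levelCount (maxConv K g) t ≤ ENNReal.ofReal (a / t ^ 2) * ∑' x, ‖g x‖ₑ ^ 2)
    (hB : Hormander K B) (F : (Fin d → ℤ) → ℂ) (hF : F.support.Finite) (t : ℝ) (ht : 0 < t) :
    levelCount (maxConv K F) t ≤
      ENNReal.ofReal ((6 * a * γ + 2 ^ (3 * d + 1) / γ + 4 * B) / t) * ∑' x, ‖F x‖ₑ := by
  classical
  set N := ∑' x, ‖F x‖ₑ with hN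
  have hNt : N ≠ ⊤ := by
    rw [hN, tsum_eq_sum (s := hF.toFinset) fun x hx => by
      simpa using hx]
    simp
  set α : ℝ≥0∞ := ENNReal.ofReal (γ * t / 2 ^ (d + 1)) with hα
  have hα0 : α ≠ 0 := by rw [hα, Ne, ENNReal.ofReal_eq_zero, not_le]; positivity
  have hα1 : α ≠ ⊤ := ENNReal.ofReal_ne_top
  obtain ⟨I, hI⟩ := exists_forall_dyAvg_le hd F hNt hα0 hα1
  set b := ∑ i ∈ Finset.range I, badPart F α i with hb
  have hbfin : b.support.Finite := support_sum_finite _ fun i _ => support_badPart_finite F hF α i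
  set g := F - b with hg
  have hgfin : g.support.Finite := (hF.union hbfin).subset (Function.support_sub F b)
  have ht2 : 0 < t / 2 := by positivity
  have hαd : 2 ^ d * α = ENNReal.ofReal (γ * (t / 2)) := by
    rw [hα, show (2 : ℝ≥0∞) ^ d = ENNReal.ofReal (2 ^ d) by
      rw [ENNReal.ofReal_pow (by norm_num)]; simp, ← ENNReal.ofReal_mul (by positivity)]
    congr 1
    rw [pow_succ]; field_simp
  have hgb : ∀ x, ‖g x‖ₑ ≤ ENNReal.ofReal (γ * (t / 2)) := fun x => by
    rw [← hαd]; exact enorm_good_le F hI x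
  have hg1 : levelCount (maxConv K g) (t / 2) ≤ ENNReal.ofReal (6 * a * γ / t) * N := by
    refine (hsmall g hgfin _ ht2 fun x => ?_).trans ?_
    · have := hgb x
      rwa [← ofReal_norm, ENNReal.ofReal_le_ofReal_iff (by positivity)] at this
    calc _ ≤ ENNReal.ofReal (a / (t / 2) ^ 2) * (ENNReal.ofReal (γ * (t / 2)) * (3 * N)) := by
          gcongr
          calc _ ≤ ∑' x, ENNReal.ofReal (γ * (t / 2)) * ‖g x‖ₑ := by
                refine ENNReal.tsum_le_tsum fun x => ?_
                rw [sq]; gcongr; exact hgb x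
            _ ≤ _ := by rw [ENNReal.tsum_mul_left]; gcongr; exact tsum_enorm_good_le F α I
      _ = _ := by
          rw [show (3 : ℝ≥0∞) = ENNReal.ofReal 3 by simp, ← mul_assoc, ← mul_assoc,
            ← ENNReal.ofReal_mul (by positivity), ← ENNReal.ofReal_mul (by positivity)]
          congr 2; field_simp; ring
  have hb1 : levelCount (maxConv K b) (t / 2) ≤
      ENNReal.ofReal (2 ^ (3 * d + 1) / γ / t) * N + ENNReal.ofReal (4 * B / t) * N := by
    calc _ ≤ ∑' x, ((if x ∈ stopNbhd F α I then (1 : ℝ≥0∞) else 0) +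
          (if ENNReal.ofReal (t / 2) < (if x ∈ stopNbhd F α I then 0 else maxConv K b x)
            then 1 else 0)) := by
          refine ENNReal.tsum_le_tsum fun x => ?_
          by_cases hx : x ∈ stopNbhd F α I
          · simp only [hx, if_true]; split_ifs <;> simp
          · simp [hx]
      _ ≤ 4 ^ d * α⁻¹ * N + ENNReal.ofReal (1 / (t / 2)) * (ENNReal.ofReal B * (2 * N)) := by
          rw [ENNReal.tsum_add]
          refine add_le_add (tsum_stopNbhd_le F hα0 hα1 I) ((levelCount_le _ ht2).trans ?_)
          gcongr
          calc _ ≤ ∑' x, ∑ i ∈ Finset.range I,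
                (if x ∈ stopNbhd F α I then 0 else maxConv K (badPart F α i) x) := by
                refine ENNReal.tsum_le_tsum fun x => ?_
                split_ifs with hx
                · exact zero_le
                · exact maxConv_sum_le K _ (fun i _ => support_badPart_finite F hF α i) x
            _ ≤ ∑ i ∈ Finset.range I, ENNReal.ofReal B * ∑' x, ‖badPart F α i x‖ₑ := by
                rw [Summable.tsum_finsetSum fun _ _ => ENNReal.summable]
                exact Finset.sum_le_sum fun i hi => tsum_maxConv_badPart_le hB F hF α I hi
            _ ≤ _ := by
                rw [← Finset.mul_sum]; gcongr; exact sum_tsum_badPart_le F α I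
      _ = _ := by
          rw [hα, ← ENNReal.ofReal_inv_of_pos (by positivity),
            show (4 : ℝ≥0∞) ^ d = ENNReal.ofReal (4 ^ d) by
              rw [ENNReal.ofReal_pow (by norm_num)]; simp,
            ← ENNReal.ofReal_mul (by positivity), show (2 : ℝ≥0∞) = ENNReal.ofReal 2 by simp,
            ← mul_assoc, ← mul_assoc, ← ENNReal.ofReal_mul (by positivity),
            ← ENNReal.ofReal_mul (by positivity)]
          congr 3
          · rw [show (4 : ℝ) = 2 ^ 2 by norm_num, ← pow_mul, show 3 * d + 1 = 2 * d + (d + 1) by ring,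
              pow_add, pow_succ]
            field_simp
            ring
          · field_simp; ring
  have hFgb : F = g + b := by rw [hg, sub_add_cancel]
  refine (levelCount_le_add (M₁ := maxConv K g) (M₂ := maxConv K b) (fun x => ?_) t ht).trans ?_
  · conv_lhs => rw [hFgb]
    exact maxConv_add K hgfin hbfin x
  refine (add_le_add hg1 hb1).trans (le_of_eq ?_)
  rw [← add_mul, ← add_mul, ← ENNReal.ofReal_add (by positivity) (by positivity),
    ← ENNReal.ofReal_add (by positivity) (by positivity)]
  congr 2; ring

end

section

variable {d : ℕ}

lemma tsum_pi_prod {d : ℕ} (f : Fin d → ℤ → ℝ≥0∞) :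
    ∑' x : Fin d → ℤ, ∏ i, f i (x i) = ∏ i, ∑' n, f i n := by
  induction d with
  | zero => simp
  | succ d ih =>
    rw [← (Fin.consEquiv fun _ => ℤ).tsum_eq, ENNReal.tsum_prod', Fin.prod_univ_succ, ← ih,
      ← ENNReal.tsum_mul_right]
    refine tsum_congr fun n => ?_
    rw [← ENNReal.tsum_mul_left]
    refine tsum_congr fun x => ?_
    simp [Fin.prod_univ_succ, Fin.consEquiv]

lemma one_add_sq_le_three_mul {u v : ℝ} (h : |u - v| ≤ 1) : 1 + u ^ 2 ≤ 3 * (1 + v ^ 2) := by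
  have h1 : (u - v) ^ 2 ≤ 1 := by rw [← sq_abs]; nlinarith [abs_nonneg (u - v)]
  nlinarith [sq_nonneg (u - v - v)]

lemma lintegral_inv_one_add_sq {s : ℝ} (hs : 0 < s) (y : ℝ) :
    ∫⁻ w, ENNReal.ofReal (1 + ((w - y) / s) ^ 2)⁻¹ = ENNReal.ofReal (Real.pi * s) := by
  have h2 : Integrable fun w : ℝ => (1 + ((w - y) / s) ^ 2)⁻¹ :=
    (integrable_inv_one_add_sq.comp_div hs.ne').comp_sub_right y
  rw [← ofReal_integral_eq_lintegral_ofReal h2 (Filter.Eventually.of_forall fun w => by positivity)]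
  congr 1
  rw [integral_sub_right_eq_self (fun w : ℝ => (1 + (w / s) ^ 2)⁻¹) y,
    Measure.integral_comp_div (fun w : ℝ => (1 + w ^ 2)⁻¹) s, integral_univ_inv_one_add_sq,
    abs_of_pos hs, smul_eq_mul, mul_comm]

lemma tsum_inv_one_add_sq_le {s : ℝ} (hs : 1 ≤ s) (y : ℝ) :
    ∑' n : ℤ, ENNReal.ofReal (1 + (((n : ℝ) - y) / s) ^ 2)⁻¹ ≤ ENNReal.ofReal (3 * Real.pi * s) := by
  have hs0 : 0 < s := by linarith
  calc _ ≤ ∑' n : ℤ, ∫⁻ w in Set.Ioc (n : ℝ) (n + 1),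
        ENNReal.ofReal 3 * ENNReal.ofReal (1 + ((w - y) / s) ^ 2)⁻¹ := by
        refine ENNReal.tsum_le_tsum fun n => ?_
        have : ENNReal.ofReal (1 + (((n : ℝ) - y) / s) ^ 2)⁻¹ =
            ∫⁻ _ in Set.Ioc (n : ℝ) (n + 1), ENNReal.ofReal (1 + (((n : ℝ) - y) / s) ^ 2)⁻¹ := by
          simp
        rw [this]
        refine setLIntegral_mono (by fun_prop) fun w hw => ?_
        rw [← ENNReal.ofReal_mul (by norm_num)]
        refine ENNReal.ofReal_le_ofReal ?_
        have h3 := one_add_sq_le_three_mul (u := (w - y) / s) (v := ((n : ℝ) - y) / s) (by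
          rw [← sub_div, abs_div, abs_of_pos hs0, div_le_one hs0, sub_sub_sub_cancel_right, abs_le]
          constructor <;> linarith [hw.1, hw.2])
        rw [inv_le_comm₀ (by positivity) (by positivity), mul_inv, inv_inv,
          inv_mul_le_iff₀ (by norm_num)]
        exact h3
    _ = ENNReal.ofReal 3 * ∫⁻ w, ENNReal.ofReal (1 + ((w - y) / s) ^ 2)⁻¹ := by
        rw [← lintegral_iUnion (fun _ => measurableSet_Ioc) (Set.pairwise_disjoint_Ioc_intCast ℝ),
          iUnion_Ioc_intCast, setLIntegral_univ, lintegral_const_mul _ (by fun_prop)]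
    _ = _ := by
        rw [lintegral_inv_one_add_sq hs0, ← ENNReal.ofReal_mul (by norm_num), mul_assoc]

/-- An integrable product weight on `ℝ^d`. -/
def weight (v : Fin d → ℝ) : ℝ := ∏ i, (1 + v i ^ 2)⁻¹

lemma weight_pos (v : Fin d → ℝ) : 0 < weight v := Finset.prod_pos fun i _ => by positivity

lemma weight_le_one (v : Fin d → ℝ) : weight v ≤ 1 :=
  Finset.prod_le_one (fun i _ => by positivity) fun i _ => inv_le_one_of_one_le₀ (by nlinarith [sq_nonneg (v i)])

lemma weight_le_of_near {u v : Fin d → ℝ} (h : ∀ i, |u i - v i| ≤ 1) :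
    weight u ≤ 3 ^ d * weight v := by
  unfold weight
  have : (3 : ℝ) ^ d = ∏ _i : Fin d, 3 := by simp
  rw [this, ← Finset.prod_mul_distrib]
  refine Finset.prod_le_prod (fun i _ => by positivity) fun i _ => ?_
  have := one_add_sq_le_three_mul (u := v i) (v := u i) (by rw [abs_sub_comm]; exact h i)
  rw [inv_le_comm₀ (by positivity) (by positivity), mul_inv, inv_inv, inv_mul_le_iff₀ (by norm_num)]
  exact this

lemma tsum_weight_le {s : ℝ} (hs : 1 ≤ s) (y : Fin d → ℝ) :
    ∑' x : Fin d → ℤ, ENNReal.ofReal (weight fun i => ((x i : ℝ) - y i) / s) ≤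
      ENNReal.ofReal ((3 * Real.pi * s) ^ d) := by
  have h0 : (0 : ℝ) ≤ 3 * Real.pi * s := by positivity
  simp only [weight]
  simp_rw [ENNReal.ofReal_prod_of_nonneg fun i _ => (inv_nonneg.2
    (add_nonneg zero_le_one (sq_nonneg _)) : (0 : ℝ) ≤ (1 + _ ^ 2)⁻¹)]
  rw [tsum_pi_prod fun i n => ENNReal.ofReal (1 + (((n : ℝ) - y i) / s) ^ 2)⁻¹,
    ENNReal.ofReal_pow h0]
  calc _ ≤ ∏ _i : Fin d, ENNReal.ofReal (3 * Real.pi * s) :=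
        Finset.prod_le_prod' fun i _ => tsum_inv_one_add_sq_le hs (y i)
    _ = _ := by simp

lemma measurable_weight : Measurable (weight : (Fin d → ℝ) → ℝ) := by
  unfold weight; fun_prop

end

section

variable {d : ℕ}

/-- Pointwise decay and regularity of a kernel on `ℝ^d`, relative to `weight`. -/
structure NiceKernel (g : (Fin d → ℝ) → ℂ) (A : ℝ) : Prop where
  continuous : Continuous g
  norm_le : ∀ v, ‖g v‖ ≤ A * weight v
  abs_mul_norm_le : ∀ v j, |v j| * ‖g v‖ ≤ A * weight v
  norm_sub_le : ∀ v θ δ, 0 ≤ δ → δ ≤ 1 → (∀ j, |θ j| ≤ δ) → ‖g (v - θ) - g v‖ ≤ A * δ * weight v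

lemma inv_one_add_pow_le_weight (v : Fin d → ℝ) :
    ((1 + ‖WithLp.toLp 2 v‖) ^ (2 * d))⁻¹ ≤ weight v := by
  unfold weight
  rw [Finset.prod_inv_distrib]
  refine inv_anti₀ (Finset.prod_pos fun i _ => by positivity) ?_
  calc ∏ i, (1 + v i ^ 2) ≤ ∏ _i : Fin d, (1 + ‖WithLp.toLp 2 v‖) ^ 2 := by
        refine Finset.prod_le_prod (fun i _ => by positivity) fun i _ => ?_
        have h := PiLp.norm_apply_le (WithLp.toLp 2 v) i
        simp only [Real.norm_eq_abs] at h
        have : v i ^ 2 ≤ ‖WithLp.toLp 2 v‖ ^ 2 := sq_le_sq' (by linarith [abs_le.1 h]) (abs_le.1 h).2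
        nlinarith [norm_nonneg (WithLp.toLp 2 v)]
    _ = _ := by simp [pow_mul]

lemma SchwartzMap.exists_niceKernel (G : SchwartzMap (EuclideanSpace ℝ (Fin d)) ℂ) :
    ∃ A, 0 ≤ A ∧ NiceKernel (fun v => G (WithLp.toLp 2 v)) A := by
  set C := 2 ^ (2 * d + 1) * (Finset.Iic (2 * d + 1, 1)).sup
    (fun m => SchwartzMap.seminorm ℝ m.1 m.2) G with hC
  have hC0 : 0 ≤ C := by positivity
  have h0 : ∀ v : Fin d → ℝ, (1 + ‖WithLp.toLp 2 v‖) ^ (2 * d + 1) * ‖G (WithLp.toLp 2 v)‖ ≤ C :=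
    fun v => by
    have := SchwartzMap.one_add_le_sup_seminorm_apply (𝕜 := ℝ) (m := (2 * d + 1, 1)) le_rfl
      (Nat.zero_le 1) G (WithLp.toLp 2 v)
    rwa [norm_iteratedFDeriv_zero] at this
  have h1 : ∀ v : Fin d → ℝ, (1 + ‖WithLp.toLp 2 v‖) ^ (2 * d) * ‖fderiv ℝ G (WithLp.toLp 2 v)‖ ≤ C :=
    fun v => by
    have := SchwartzMap.one_add_le_sup_seminorm_apply (𝕜 := ℝ) (m := (2 * d + 1, 1))
      (Nat.le_succ (2 * d)) le_rfl G (WithLp.toLp 2 v)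
    rwa [norm_iteratedFDeriv_one] at this
  have hw : ∀ (v : Fin d → ℝ) (y : ℝ), 0 ≤ y → (1 + ‖WithLp.toLp 2 v‖) ^ (2 * d) * y ≤ C →
      y ≤ C * weight v := fun v y hy h => by
    have hp : (0 : ℝ) < (1 + ‖WithLp.toLp 2 v‖) ^ (2 * d) := by positivity
    calc y ≤ C * ((1 + ‖WithLp.toLp 2 v‖) ^ (2 * d))⁻¹ := by
          rw [← div_eq_mul_inv, le_div_iff₀ hp]; linarith
      _ ≤ _ := by gcongr; exact inv_one_add_pow_le_weight v
  have hxl : ∀ v : Fin d → ℝ, (1 + ‖WithLp.toLp 2 v‖) * ‖G (WithLp.toLp 2 v)‖ ≤ C * weight v :=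
    fun v => hw v _ (by positivity) (by rw [← mul_assoc, ← pow_succ]; exact h0 v)
  have hCA : C ≤ C * (3 ^ d * (d + 1)) := by
    refine le_mul_of_one_le_right hC0 ?_
    have : (1 : ℝ) ≤ 3 ^ d := one_le_pow₀ (by norm_num)
    nlinarith [(Nat.cast_nonneg d : (0 : ℝ) ≤ d)]
  refine ⟨C * (3 ^ d * (d + 1)), by positivity, ?_, fun v => ?_, fun v j => ?_,
    fun v θ δ hδ0 hδ hθ => ?_⟩
  · exact G.continuous.comp (PiLp.continuous_toLp 2 _)
  · refine le_trans ?_ (mul_le_mul_of_nonneg_right hCA (weight_pos v).le)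
    refine le_trans ?_ (hxl v)
    exact le_mul_of_one_le_left (norm_nonneg _) (by linarith [norm_nonneg (WithLp.toLp 2 v)])
  · refine le_trans ?_ (mul_le_mul_of_nonneg_right hCA (weight_pos v).le)
    refine le_trans ?_ (hxl v)
    gcongr
    have := PiLp.norm_apply_le (WithLp.toLp 2 v) j
    simp only [Real.norm_eq_abs] at this
    linarith
  · have hseg : ∀ z ∈ segment ℝ (WithLp.toLp 2 v) (WithLp.toLp 2 (v - θ)),
        ‖fderiv ℝ G z‖ ≤ C * (3 ^ d * weight v) := fun z hz => by
      rw [segment_eq_image'] at hz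
      obtain ⟨τ, hτ, rfl⟩ := hz
      have e : (WithLp.toLp 2 v + τ • (WithLp.toLp 2 (v - θ) - WithLp.toLp 2 v)) =
        WithLp.toLp 2 (v - τ • θ) := by
        ext i; simp; ring
      beta_reduce
      rw [e]
      refine (hw _ _ (norm_nonneg _) (h1 _)).trans ?_
      gcongr
      refine weight_le_of_near fun i => ?_
      simp only [Pi.sub_apply, Pi.smul_apply, smul_eq_mul, sub_sub_cancel_left, abs_neg, abs_mul]
      rw [abs_of_nonneg hτ.1]
      calc τ * |θ i| ≤ 1 * 1 := by
            gcongr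
            · exact hτ.2
            · exact (hθ i).trans hδ
        _ = 1 := one_mul 1
    have h2 := (convex_segment (𝕜 := ℝ) (WithLp.toLp 2 v) (WithLp.toLp 2 (v - θ))).norm_image_sub_le_of_norm_fderiv_le
      (𝕜 := ℝ) (fun x _ => G.differentiableAt) hseg (left_mem_segment ℝ _ _) (right_mem_segment ℝ _ _)
    refine h2.trans ?_
    have h3 : ‖WithLp.toLp 2 (v - θ) - WithLp.toLp 2 v‖ ≤ (d + 1) * δ := by
      have : WithLp.toLp 2 (v - θ) - WithLp.toLp 2 v = WithLp.toLp 2 (-θ) := by ext i; simp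
      rw [this, EuclideanSpace.norm_eq, Real.sqrt_le_left (by positivity)]
      calc _ ≤ ∑ _i : Fin d, δ ^ 2 := by
            refine Finset.sum_le_sum fun i _ => ?_
            simp only [Pi.neg_apply, norm_neg, Real.norm_eq_abs]
            exact pow_le_pow_left₀ (abs_nonneg _) (hθ i) 2
        _ = d * δ ^ 2 := by simp
        _ ≤ _ := by nlinarith [sq_nonneg δ, (Nat.cast_nonneg d : (0 : ℝ) ≤ d),
              mul_nonneg (Nat.cast_nonneg d : (0 : ℝ) ≤ d) (sq_nonneg δ),
              mul_nonneg (mul_nonneg (Nat.cast_nonneg d : (0 : ℝ) ≤ d) (Nat.cast_nonneg d : (0 : ℝ) ≤ d)) (sq_nonneg δ)]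
    calc _ ≤ C * (3 ^ d * weight v) * ((d + 1) * δ) := by
          gcongr
          have := weight_pos v; positivity
      _ = _ := by ring

/-- The inverse Fourier transform of a real function on `ℝ^d`. -/
def invFT (Ψ : (Fin d → ℝ) → ℝ) (v : Fin d → ℝ) : ℂ :=
  ∫ ξ : Fin d → ℝ, (Ψ ξ : ℂ) * eC (-∑ i, v i * ξ i)

lemma exists_niceKernel_invFT {Ψ : (Fin d → ℝ) → ℝ} (hΨ : ContDiff ℝ (⊤ : ℕ∞) Ψ) {c : ℝ}
    (hsupp : ∀ x, x ∉ Set.Icc (fun _ => -c) (fun _ => c) → Ψ x = 0) :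
    ∃ A, 0 ≤ A ∧ NiceKernel (invFT Ψ) A := by
  have hcs : HasCompactSupport Ψ := HasCompactSupport.intro isCompact_Icc hsupp
  have h1 : HasCompactSupport fun x : EuclideanSpace ℝ (Fin d) => (Ψ x.ofLp : ℂ) :=
    (hcs.comp_homeomorph (PiLp.homeomorph 2 fun _ => ℝ)).comp_left (g := fun x : ℝ => (x : ℂ)) (by simp)
  have h2 : ContDiff ℝ (⊤ : ℕ∞) fun x : EuclideanSpace ℝ (Fin d) => (Ψ x.ofLp : ℂ) :=
    Complex.ofRealCLM.contDiff.comp (hΨ.comp (PiLp.contDiff_ofLp (p := 2)))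
  obtain ⟨A, hA, h⟩ := (FourierTransform.fourier (h1.toSchwartzMap h2)).exists_niceKernel
  refine ⟨A, hA, ?_⟩
  convert h using 1
  ext v
  rw [SchwartzMap.fourier_coe, Real.fourier_eq',
    ← (PiLp.volume_preserving_toLp (Fin d)).integral_comp (MeasurableEquiv.toLp 2 _).measurableEmbedding]
  unfold invFT
  refine integral_congr_ae (Filter.Eventually.of_forall fun ξ => ?_)
  simp only [eC, smul_eq_mul, HasCompactSupport.toSchwartzMap_toFun, PiLp.inner_apply]
  rw [mul_comm]
  congr 2
  push_cast
  simp
  ring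

end

section

variable {d : ℕ}

/-- The convolution of a measure with the `L¹`-normalised dilate of `g` at scale `s`. -/
def avgK (g : (Fin d → ℝ) → ℂ) (s : ℝ) (μ : Measure (EuclideanSpace ℝ (Fin d)))
    (v : Fin d → ℝ) : ℂ :=
  ∫ y : EuclideanSpace ℝ (Fin d), ((s⁻¹ ^ d : ℝ) : ℂ) * g (fun i => (v i - y i) / s) ∂μ

variable {μ : Measure (EuclideanSpace ℝ (Fin d))}

lemma tsum_enorm_integral_le {G : (Fin d → ℤ) → EuclideanSpace ℝ (Fin d) → ℂ} {B s : ℝ}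
    (hB : 0 ≤ B) (hs : 1 ≤ s)
    (h : ∀ x, ∀ᵐ y ∂μ, ‖G x y‖ ≤ B * s⁻¹ ^ d * weight fun i => ((x i : ℝ) - y i) / s) :
    ∑' x, ‖∫ y, G x y ∂μ‖ₑ ≤ ENNReal.ofReal (B * (3 * Real.pi) ^ d) * μ Set.univ := by
  have hs0 : 0 < s := by linarith
  calc ∑' x, ‖∫ y, G x y ∂μ‖ₑ
      ≤ ∑' x : Fin d → ℤ, ∫⁻ y, ENNReal.ofReal (B * s⁻¹ ^ d) *
          ENNReal.ofReal (weight fun i => ((x i : ℝ) - y i) / s) ∂μ := by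
        refine ENNReal.tsum_le_tsum fun x => (enorm_integral_le_lintegral_enorm _).trans ?_
        refine lintegral_mono_ae ?_
        filter_upwards [h x] with y hy
        rw [← ENNReal.ofReal_mul (by positivity), ← ofReal_norm]
        exact ENNReal.ofReal_le_ofReal hy
    _ = ∫⁻ y, ∑' x : Fin d → ℤ, ENNReal.ofReal (B * s⁻¹ ^ d) *
          ENNReal.ofReal (weight fun i => ((x i : ℝ) - y i) / s) ∂μ := by
        rw [lintegral_tsum]
        intro x
        refine (Measurable.const_mul ?_ _).aemeasurable
        refine (measurable_weight.comp ?_).ennreal_ofReal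
        fun_prop
    _ ≤ ∫⁻ _y, ENNReal.ofReal (B * (3 * Real.pi) ^ d) ∂μ := by
        refine lintegral_mono fun y => ?_
        rw [ENNReal.tsum_mul_left]
        refine (mul_le_mul_right (tsum_weight_le hs fun i => y i) _).trans ?_
        rw [← ENNReal.ofReal_mul (by positivity)]
        apply ENNReal.ofReal_le_ofReal
        rw [mul_pow _ s, mul_comm _ (s ^ d), ← mul_assoc, mul_assoc B, ← mul_pow,
          inv_mul_cancel₀ hs0.ne', one_pow, mul_one]
    _ = _ := by simp

namespace NiceKernel

variable {g : (Fin d → ℝ) → ℂ} {A s : ℝ}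

lemma norm_dilate_le (hg : NiceKernel g A) (hs : 0 < s) (v : Fin d → ℝ) :
    ‖((s⁻¹ ^ d : ℝ) : ℂ) * g v‖ ≤ A * s⁻¹ ^ d * weight v := by
  rw [norm_mul, Complex.norm_real, Real.norm_of_nonneg (by positivity)]
  calc s⁻¹ ^ d * ‖g v‖ ≤ s⁻¹ ^ d * (A * weight v) := by gcongr; exact hg.norm_le v
    _ = _ := by ring

lemma tsum_avgK_le (hg : NiceKernel g A) (hA : 0 ≤ A) (hs : 1 ≤ s) :
    ∑' x : Fin d → ℤ, ‖avgK g s μ (fun i => x i)‖ₑ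
      ≤ ENNReal.ofReal (A * (3 * Real.pi) ^ d) * μ Set.univ :=
  tsum_enorm_integral_le hA hs fun x => Filter.Eventually.of_forall fun y =>
    hg.norm_dilate_le (by linarith) _

lemma tsum_avgK_tail_le (hg : NiceKernel g A) (hA : 0 ≤ A) (hs : 1 ≤ s) {t ρ : ℝ} (hst : s ≤ t)
    (hμ : ∀ᵐ y ∂μ, ∀ i, |y i| ≤ t) (hρ : 0 < ρ) :
    ∑' x : Fin d → ℤ, (if ∀ j, |(x j : ℝ)| < ρ then 0 else ‖avgK g s μ (fun i => x i)‖ₑ)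
      ≤ ENNReal.ofReal (2 * t / ρ * A * (3 * Real.pi) ^ d) * μ Set.univ := by
  have hs0 : 0 < s := by linarith
  have ht0 : 0 < t := by linarith
  have key : ∀ x : Fin d → ℤ, (if ∀ j, |(x j : ℝ)| < ρ then 0 else ‖avgK g s μ (fun i => x i)‖ₑ)
      = ‖∫ y, (if ∀ j, |(x j : ℝ)| < ρ then 0 else
          ((s⁻¹ ^ d : ℝ) : ℂ) * g (fun i => ((x i : ℝ) - y i) / s)) ∂μ‖ₑ := fun x => by
    split_ifs with h
    · simp
    · rfl
  simp only [key]
  refine tsum_enorm_integral_le (by positivity) hs fun x => ?_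
  filter_upwards [hμ] with y hy
  have hw := weight_pos fun i => ((x i : ℝ) - y i) / s
  split_ifs with h
  · rw [norm_zero]; positivity
  push Not at h
  obtain ⟨j, hj⟩ := h
  rw [norm_mul, Complex.norm_real, Real.norm_of_nonneg (by positivity)]
  set v : Fin d → ℝ := fun i => ((x i : ℝ) - y i) / s with hv
  have h1 : ρ ≤ s * |v j| + t := by
    have : (x j : ℝ) = s * v j + y j := by rw [hv]; field_simp; ring
    have h2 := abs_add_le (s * v j) (y j)
    rw [← this, abs_mul, abs_of_pos hs0] at h2
    linarith [hy j]
  have h3 : ρ * ‖g v‖ ≤ 2 * t * (A * weight v) := by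
    calc ρ * ‖g v‖ ≤ (s * |v j| + t) * ‖g v‖ := by gcongr
      _ = s * (|v j| * ‖g v‖) + t * ‖g v‖ := by ring
      _ ≤ t * (A * weight v) + t * (A * weight v) := by
          have := hg.abs_mul_norm_le v j
          have := hg.norm_le v
          refine add_le_add (mul_le_mul hst ‹_› (by positivity) ht0.le) ?_
          gcongr
      _ = _ := by ring
  have h4 : ‖g v‖ ≤ 2 * t / ρ * A * weight v := by
    rw [div_mul_eq_mul_div, div_mul_eq_mul_div, le_div_iff₀ hρ]; linarith
  calc s⁻¹ ^ d * ‖g v‖ ≤ s⁻¹ ^ d * (2 * t / ρ * A * weight v) := by gcongr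
    _ = _ := by ring

lemma integrable_dilate [IsFiniteMeasure μ] (hg : NiceKernel g A) (hA : 0 ≤ A) (hs : 0 < s)
    (v : Fin d → ℝ) :
    Integrable (fun y : EuclideanSpace ℝ (Fin d) =>
      ((s⁻¹ ^ d : ℝ) : ℂ) * g (fun i => (v i - y i) / s)) μ := by
  refine Integrable.of_bound (C := A * s⁻¹ ^ d) ?_ (Filter.Eventually.of_forall fun y => ?_)
  · refine (continuous_const.mul (hg.continuous.comp ?_)).aestronglyMeasurable
    fun_prop
  · refine (hg.norm_dilate_le hs _).trans ?_
    exact mul_le_of_le_one_right (by positivity) (weight_le_one _)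

lemma tsum_avgK_sub_le [IsFiniteMeasure μ] (hg : NiceKernel g A) (hA : 0 ≤ A) (hs : 1 ≤ s)
    {ρ : ℝ} (hρ : 0 ≤ ρ) (h : Fin d → ℤ) (hh : ∀ j, |(h j : ℝ)| ≤ ρ) :
    ∑' x : Fin d → ℤ, ‖avgK g s μ (fun i => ((x - h) i : ℤ)) - avgK g s μ (fun i => x i)‖ₑ
      ≤ ENNReal.ofReal (2 * ρ / s * A * (3 * Real.pi) ^ d) * μ Set.univ := by
  have hs0 : 0 < s := by linarith
  rcases le_total ρ s with hρs | hρs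
  · have key : ∀ x : Fin d → ℤ,
        avgK g s μ (fun i => ((x - h) i : ℤ)) - avgK g s μ (fun i => x i) =
        ∫ y, (((s⁻¹ ^ d : ℝ) : ℂ) * (g ((fun i => ((x i : ℝ) - y i) / s) - fun i => h i / s) -
          g (fun i => ((x i : ℝ) - y i) / s))) ∂μ := fun x => by
      rw [avgK, avgK, ← integral_sub (hg.integrable_dilate hA hs0 _) (hg.integrable_dilate hA hs0 _)]
      refine integral_congr_ae (Filter.Eventually.of_forall fun y => ?_)
      simp only [mul_sub]
      congr 3
      ext i
      simp
      ring
    simp only [key]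
    refine tsum_enorm_integral_le (by positivity) hs fun x => Filter.Eventually.of_forall fun y => ?_
    rw [norm_mul, Complex.norm_real, Real.norm_of_nonneg (by positivity)]
    have h1 := hg.norm_sub_le (fun i => ((x i : ℝ) - y i) / s) (fun i => h i / s) (ρ / s)
      (by positivity) ((div_le_one hs0).2 hρs) fun j => by
        rw [abs_div, abs_of_pos hs0]; gcongr; exact hh j
    have hw := weight_pos fun i => ((x i : ℝ) - y i) / s
    calc _ ≤ s⁻¹ ^ d * (A * (ρ / s) * weight fun i => ((x i : ℝ) - y i) / s) := by gcongr
      _ ≤ 2 * (s⁻¹ ^ d * (A * (ρ / s) * weight fun i => ((x i : ℝ) - y i) / s)) :=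
          le_mul_of_one_le_left (by positivity) (by norm_num)
      _ = _ := by ring
  · calc _ ≤ ∑' x : Fin d → ℤ, (‖avgK g s μ (fun i => ((x - h) i : ℤ))‖ₑ
          + ‖avgK g s μ (fun i => x i)‖ₑ) := ENNReal.tsum_le_tsum fun x => enorm_sub_le
      _ = (∑' x : Fin d → ℤ, ‖avgK g s μ (fun i => x i)‖ₑ)
          + ∑' x : Fin d → ℤ, ‖avgK g s μ (fun i => x i)‖ₑ := by
          rw [ENNReal.tsum_add]
          congr 1
          exact (Equiv.subRight h).tsum_eq fun x : Fin d → ℤ => ‖avgK g s μ (fun i => x i)‖ₑ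
      _ ≤ ENNReal.ofReal (A * (3 * Real.pi) ^ d) * μ Set.univ
          + ENNReal.ofReal (A * (3 * Real.pi) ^ d) * μ Set.univ :=
          add_le_add (hg.tsum_avgK_le hA hs) (hg.tsum_avgK_le hA hs)
      _ ≤ _ := by
          rw [← add_mul, ← ENNReal.ofReal_add (by positivity) (by positivity)]
          gcongr
          have : 1 ≤ ρ / s := (one_le_div hs0).2 hρs
          have h2 : 0 ≤ A * (3 * Real.pi) ^ d := by positivity
          calc _ = 2 * 1 * (A * (3 * Real.pi) ^ d) := by ring
            _ ≤ 2 * (ρ / s) * (A * (3 * Real.pi) ^ d) := by gcongr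
            _ = _ := by ring

end NiceKernel

end

section

variable {d : ℕ}

lemma norm_eC (t : ℝ) : ‖eC t‖ = 1 := by
  rw [eC, show (2 * Real.pi * Complex.I * t : ℂ) = ((2 * Real.pi * t : ℝ) : ℂ) * Complex.I by
    push_cast; ring]
  exact Complex.norm_exp_ofReal_mul_I _

lemma eC_add (s t : ℝ) : eC (s + t) = eC s * eC t := by
  rw [eC, eC, eC, ← Complex.exp_add]; congr 1; push_cast; ring

lemma eC_zero : eC 0 = 1 := by simp [eC]

lemma eC_neg (t : ℝ) : eC (-t) = (starRingEnd ℂ) (eC t) := by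
  rw [eC, eC, ← Complex.exp_conj]; congr 1; simp [map_ofNat]

lemma eC_int (n : ℤ) : eC n = 1 := by
  rw [eC, Complex.exp_eq_one_iff]; exact ⟨n, by push_cast; ring⟩

lemma eC_add_int (t : ℝ) (n : ℤ) : eC (t + n) = eC t := by rw [eC_add, eC_int, mul_one]

lemma eC_eq_cos_add_sin (t : ℝ) :
    eC t = (Real.cos (2 * Real.pi * t) : ℂ) + (Real.sin (2 * Real.pi * t) : ℂ) * Complex.I := by
  rw [eC, show (2 * Real.pi * Complex.I * t : ℂ) = ((2 * Real.pi * t : ℝ) : ℂ) * Complex.I by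
    push_cast; ring, Complex.exp_mul_I, Complex.ofReal_cos, Complex.ofReal_sin]

@[fun_prop]
lemma continuous_eC : Continuous eC := by unfold eC; fun_prop

/-- The Fourier transform of a measure. -/
def measFT (μ : Measure (EuclideanSpace ℝ (Fin d))) (ξ : Fin d → ℝ) : ℂ :=
  ∫ y : EuclideanSpace ℝ (Fin d), eC (∑ i, y i * ξ i) ∂μ

variable {μ : Measure (EuclideanSpace ℝ (Fin d))}

lemma norm_measFT_le (μ : Measure (EuclideanSpace ℝ (Fin d))) [IsFiniteMeasure μ] (ξ : Fin d → ℝ) :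
    ‖measFT μ ξ‖ ≤ μ.real Set.univ := by
  have := norm_integral_le_of_norm_le_const (μ := μ) (C := 1)
    (f := fun y : EuclideanSpace ℝ (Fin d) => eC (∑ i, y i * ξ i))
    (Filter.Eventually.of_forall fun y => (norm_eC _).le)
  simpa [measFT] using this

lemma continuous_measFT [IsFiniteMeasure μ] : Continuous (measFT μ) := by
  refine continuous_of_dominated (bound := fun _ => (1 : ℝ)) (fun ξ => ?_)
    (fun ξ => Filter.Eventually.of_forall fun y => (norm_eC _).le) (integrable_const _)
    (Filter.Eventually.of_forall fun y => ?_)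
  · exact (by fun_prop : Continuous fun y : EuclideanSpace ℝ (Fin d) => eC (∑ i, y i * ξ i)).aestronglyMeasurable
  · fun_prop

/-- The kernel with multiplier `Ψ(sξ) 𝓕μ(ξ)`. -/
def scaleK (Ψ : (Fin d → ℝ) → ℝ) (μ : Measure (EuclideanSpace ℝ (Fin d))) (s : ℝ)
    (v : Fin d → ℝ) : ℂ :=
  ∫ ξ : Fin d → ℝ, (Ψ (s • ξ) : ℂ) * measFT μ ξ * eC (-∑ i, v i * ξ i)

lemma scaleK_eq_avgK [IsFiniteMeasure μ] {Ψ : (Fin d → ℝ) → ℝ} (hΨ : Continuous Ψ)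
    (hsupp : HasCompactSupport Ψ) {s : ℝ} (hs : 0 < s) (v : Fin d → ℝ) :
    scaleK Ψ μ s v = avgK (invFT Ψ) s μ v := by
  have h1 : ∀ y : EuclideanSpace ℝ (Fin d),
      ((s⁻¹ ^ d : ℝ) : ℂ) * invFT Ψ (fun i => (v i - y i) / s) =
      ∫ ξ : Fin d → ℝ, (Ψ (s • ξ) : ℂ) * (eC (∑ i, y i * ξ i) * eC (-∑ i, v i * ξ i)) := fun y => by
    have := Measure.integral_comp_smul_of_nonneg (volume : Measure (Fin d → ℝ))
      (fun ξ => (Ψ ξ : ℂ) * eC (-∑ i, (v i - y i) / s * ξ i)) s (hR := hs.le)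
    rw [Module.finrank_fin_fun, ← inv_pow, Complex.real_smul] at this
    rw [invFT, ← this]
    refine integral_congr_ae (Filter.Eventually.of_forall fun ξ => ?_)
    simp only [Pi.smul_apply, smul_eq_mul]
    rw [← eC_add]
    congr 2
    rw [← sub_eq_add_neg, ← Finset.sum_sub_distrib, ← Finset.sum_neg_distrib]
    refine Finset.sum_congr rfl fun i _ => ?_
    field_simp
    ring
  rw [avgK, integral_congr_ae (Filter.Eventually.of_forall h1), integral_integral_swap]
  · refine integral_congr_ae (Filter.Eventually.of_forall fun ξ => ?_)
    simp only
    rw [integral_const_mul, integral_mul_const, mul_assoc]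
    rfl
  · have h2 : Integrable (fun ξ : Fin d → ℝ => (Ψ (s • ξ) : ℂ)) := by
      refine Continuous.integrable_of_hasCompactSupport (by fun_prop) ?_
      exact (hsupp.comp_smul hs.ne').comp_left (g := fun x : ℝ => (x : ℂ)) (by simp)
    refine (h2.comp_snd μ).mono ?_ (Filter.Eventually.of_forall fun z => ?_)
    · refine Continuous.aestronglyMeasurable ?_
      simp only [Function.uncurry_def]
      fun_prop
    · simp [Function.uncurry_def, norm_eC]

end

section

variable {d : ℕ}

lemma mul_sq_le_of_bessel_ode {u u' u'' : ℝ → ℝ} {b c M : ℝ} (hb : 2 ≤ b) (hM : 0 ≤ M)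
    (hu : ∀ r, HasDerivAt u (u' r) r) (hu' : ∀ r, HasDerivAt u' (u'' r) r)
    (hode : ∀ r, r * (u'' r + c ^ 2 * u r) + b * u' r = 0)
    (hMu : ∀ r, |u r| ≤ M) (hMu' : ∀ r, |u' r| ≤ M) :
    ∃ C, 0 ≤ C ∧ ∀ r, 0 < r → c ^ 2 * (r * u r ^ 2) ≤ C := by
  set D := b ^ 2 * M ^ 2 with hD
  set G : ℝ → ℝ := fun r => r * (u' r ^ 2 + c ^ 2 * u r ^ 2) + u r * u' r + D * r⁻¹ with hG
  have hGd : ∀ r, 0 < r → HasDerivAt G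
      (1 * (u' r ^ 2 + c ^ 2 * u r ^ 2) + r * (2 * u' r * u'' r + c ^ 2 * (2 * u r * u' r))
        + (u' r * u' r + u r * u'' r) + D * (-(r ^ 2)⁻¹)) r := fun r hr => by
    have h1 := ((hu' r).pow 2)
    have h2 := ((hu r).pow 2).const_mul (c ^ 2)
    have h3 := (hasDerivAt_id r).mul (h1.add h2)
    have h4 := (h3.add ((hu r).mul (hu' r))).add ((hasDerivAt_inv hr.ne').const_mul D)
    refine h4.congr_deriv ?_
    simp
  have hanti : AntitoneOn G (Set.Ici 1) := by
    refine antitoneOn_of_deriv_nonpos (convex_Ici 1)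
      (fun r hr => (hGd r (lt_of_lt_of_le one_pos hr)).continuousAt.continuousWithinAt)
      (fun r hr => ?_) fun r hr => ?_
    · rw [interior_Ici] at hr
      exact (hGd r (one_pos.trans hr)).differentiableAt.differentiableWithinAt
    · rw [interior_Ici] at hr
      have hr0 : 0 < r := one_pos.trans hr
      rw [(hGd r hr0).deriv]
      have e : u'' r = -b * u' r * r⁻¹ - c ^ 2 * u r := by
        field_simp
        linarith [hode r]
      have e2 : 1 * (u' r ^ 2 + c ^ 2 * u r ^ 2) + r * (2 * u' r * u'' r + c ^ 2 * (2 * u r * u' r))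
        + (u' r * u' r + u r * u'' r) + D * (-(r ^ 2)⁻¹)
        = -(2 * b - 2) * u' r ^ 2 - b * (u r * r⁻¹) * u' r - b ^ 2 * M ^ 2 * (r⁻¹) ^ 2 := by
        rw [e, hD]; field_simp; ring
      rw [e2]
      have h5 : b ^ 2 * (u r * r⁻¹) ^ 2 ≤ b ^ 2 * M ^ 2 * (r⁻¹) ^ 2 := by
        rw [mul_pow, ← mul_assoc]
        gcongr ?_ * _
        gcongr ?_ * ?_
        exact sq_le_sq' (by linarith [abs_le.1 (hMu r)]) (abs_le.1 (hMu r)).2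
      nlinarith [sq_nonneg (b * (u r * r⁻¹) + u' r), sq_nonneg (u' r)]
  have huu : ∀ r, -M ^ 2 ≤ u r * u' r := fun r => by
    have := abs_mul (u r) (u' r)
    have h2 : |u r| * |u' r| ≤ M * M := mul_le_mul (hMu r) (hMu' r) (abs_nonneg _) hM
    have := neg_abs_le (u r * u' r)
    nlinarith
  refine ⟨|G 1| + M ^ 2 + c ^ 2 * M ^ 2, by positivity, fun r hr => ?_⟩
  rcases le_total 1 r with h | h
  · have h1 := hanti (Set.mem_Ici.2 le_rfl) (Set.mem_Ici.2 h) h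
    have h2 : 0 ≤ D * r⁻¹ := by positivity
    have h3 : 0 ≤ r * u' r ^ 2 := by positivity
    have h4 : G r = r * u' r ^ 2 + c ^ 2 * (r * u r ^ 2) + u r * u' r + D * r⁻¹ := by
      simp only [hG]; ring
    have h5 : 0 ≤ c ^ 2 * M ^ 2 := by positivity
    linarith [le_abs_self (G 1), huu r]
  · have h1 : u r ^ 2 ≤ M ^ 2 := sq_le_sq' (by linarith [abs_le.1 (hMu r)]) (abs_le.1 (hMu r)).2
    have h2 : c ^ 2 * (r * u r ^ 2) ≤ c ^ 2 * (1 * M ^ 2) := by gcongr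
    have := abs_nonneg (G 1)
    nlinarith [sq_nonneg M]

/-- A finite rotation-invariant measure on the unit sphere. -/
structure IsSpherical (ν : Measure (EuclideanSpace ℝ (Fin d))) : Prop where
  finite : IsFiniteMeasure ν
  ae_norm : ∀ᵐ y ∂ν, ‖y‖ = 1
  map_eq : ∀ L : EuclideanSpace ℝ (Fin d) ≃ₗᵢ[ℝ] EuclideanSpace ℝ (Fin d), ν.map L = ν

variable {ν : Measure (EuclideanSpace ℝ (Fin d))}

lemma hasDerivAt_integral_of_bound [IsFiniteMeasure ν] {F F' : ℝ → EuclideanSpace ℝ (Fin d) → ℝ}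
    {C : ℝ} (hF : ∀ r, Continuous (F r)) (hF' : ∀ r, Continuous (F' r))
    (hd : ∀ r y, HasDerivAt (F · y) (F' r y) r)
    (hFC : ∀ᵐ y ∂ν, ∀ r, |F r y| ≤ C) (hFC' : ∀ᵐ y ∂ν, ∀ r, |F' r y| ≤ C) (r : ℝ) :
    HasDerivAt (fun r => ∫ y, F r y ∂ν) (∫ y, F' r y ∂ν) r := by
  refine (hasDerivAt_integral_of_dominated_loc_of_deriv_le (s := Set.univ) (bound := fun _ => C)
    Filter.univ_mem (Filter.Eventually.of_forall fun r => (hF r).aestronglyMeasurable) ?_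
    (hF' r).aestronglyMeasurable ?_ (integrable_const _)
    (Filter.Eventually.of_forall fun y r _ => hd r y)).2
  · exact Integrable.of_bound (hF r).aestronglyMeasurable C (hFC.mono fun y hy => hy r)
  · exact hFC'.mono fun y hy r _ => hy r

lemma abs_coord_le_one {y : EuclideanSpace ℝ (Fin d)} (hy : ‖y‖ = 1) (i : Fin d) : |y i| ≤ 1 := by
  have := PiLp.norm_apply_le y i
  rwa [Real.norm_eq_abs, hy] at this

namespace IsSpherical

lemma integral_comp (hν : IsSpherical ν) {F : Type*} [NormedAddCommGroup F] [NormedSpace ℝ F]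
    (L : EuclideanSpace ℝ (Fin d) ≃ₗᵢ[ℝ] EuclideanSpace ℝ (Fin d))
    (f : EuclideanSpace ℝ (Fin d) → F) : ∫ y, f (L y) ∂ν = ∫ y, f y ∂ν := by
  conv_rhs => rw [← hν.map_eq L]
  exact (L.toHomeomorph.measurableEmbedding.integral_map f).symm

lemma integral_rotation (hν : IsSpherical ν) {i j : Fin d} (hij : i ≠ j) (φ : ℝ)
    (f : ℝ → ℝ → ℝ) :
    ∫ y, f (Real.cos φ * y i + Real.sin φ * y j) (Real.sin φ * y i - Real.cos φ * y j) ∂ν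
      = ∫ y, f (y i) (y j) ∂ν := by
  set n : EuclideanSpace ℝ (Fin d) := EuclideanSpace.single i (Real.cos (φ / 2)) +
    EuclideanSpace.single j (Real.sin (φ / 2)) with hn
  have hni : n i = Real.cos (φ / 2) := by simp [hn, hij]
  have hnj : n j = Real.sin (φ / 2) := by simp [hn, hij.symm]
  have hinner : ∀ y : EuclideanSpace ℝ (Fin d),
      inner ℝ n y = Real.cos (φ / 2) * y i + Real.sin (φ / 2) * y j := fun y => by
    rw [hn, inner_add_left, EuclideanSpace.inner_single_left, EuclideanSpace.inner_single_left]
    simp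
  have hnorm : ‖n‖ ^ 2 = 1 := by
    rw [← real_inner_self_eq_norm_sq, hinner, hni, hnj]
    nlinarith [Real.sin_sq_add_cos_sq (φ / 2)]
  have hc : Real.cos φ = 2 * Real.cos (φ / 2) ^ 2 - 1 := by
    rw [← Real.cos_two_mul]; ring_nf
  have hs : Real.sin φ = 2 * Real.sin (φ / 2) * Real.cos (φ / 2) := by
    rw [← Real.sin_two_mul]; ring_nf
  symm
  rw [← hν.integral_comp (Submodule.reflection (Submodule.span ℝ {n}))]
  refine integral_congr_ae (Filter.Eventually.of_forall fun y => ?_)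
  simp only [Submodule.reflection_singleton_apply]
  have hsq := Real.sin_sq_add_cos_sq (φ / 2)
  congr 1 <;> simp [hinner, hni, hnj, hnorm, hc, hs]
  · ring
  · linear_combination (2 * y j) * hsq

end IsSpherical

end

section

variable {d : ℕ}
variable {ν : Measure (EuclideanSpace ℝ (Fin d))}

namespace IsSpherical

lemma integral_mul_sin (hν : IsSpherical ν) {i j : Fin d} (hij : i ≠ j) (κ : ℝ) :
    ∫ y, y i * Real.sin (κ * y i) ∂ν = κ * ∫ y, y j ^ 2 * Real.cos (κ * y i) ∂ν := by
  have := hν.finite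
  set F : ℝ → EuclideanSpace ℝ (Fin d) → ℝ := fun φ y =>
    (Real.sin φ * y i - Real.cos φ * y j) * Real.sin (κ * (Real.cos φ * y i + Real.sin φ * y j)) with hF
  set F' : ℝ → EuclideanSpace ℝ (Fin d) → ℝ := fun φ y =>
    (Real.cos φ * y i + Real.sin φ * y j) * Real.sin (κ * (Real.cos φ * y i + Real.sin φ * y j)) +
    (Real.sin φ * y i - Real.cos φ * y j) * (Real.cos (κ * (Real.cos φ * y i + Real.sin φ * y j)) *
      (κ * (-Real.sin φ * y i + Real.cos φ * y j))) with hF'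
  have hb : ∀ a b p q : ℝ, |a| ≤ 1 → |b| ≤ 1 → |p| ≤ 1 → |q| ≤ 1 → |a * p| + |b * q| ≤ 2 := by
    intro a b p q ha hb hp hq
    rw [abs_mul, abs_mul]
    have := mul_le_mul ha hp (abs_nonneg _) zero_le_one
    have := mul_le_mul hb hq (abs_nonneg _) zero_le_one
    linarith
  have hder := hasDerivAt_integral_of_bound (ν := ν) (F := F) (F' := F') (C := 2 + 2 * (|κ| * 2))
    (fun r => by simp only [hF]; fun_prop) (fun r => by simp only [hF']; fun_prop)
    (fun φ y => by
      have h1 := ((Real.hasDerivAt_sin φ).mul_const (y i)).sub ((Real.hasDerivAt_cos φ).mul_const (y j))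
      have h2 := (((Real.hasDerivAt_cos φ).mul_const (y i)).add
        ((Real.hasDerivAt_sin φ).mul_const (y j))).const_mul κ
      refine (h1.mul h2.sin).congr_deriv ?_
      simp [hF'])
    (hν.ae_norm.mono fun y hy φ => by
      have hi := abs_coord_le_one hy i
      have hj := abs_coord_le_one hy j
      have := hb _ _ _ _ (Real.abs_sin_le_one φ) (Real.abs_cos_le_one φ) hi hj
      simp only [hF]
      rw [abs_mul]
      have h3 := abs_sub (Real.sin φ * y i) (Real.cos φ * y j)
      have h4 := mul_le_mul (h3.trans this) (Real.abs_sin_le_one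
        (κ * (Real.cos φ * y i + Real.sin φ * y j))) (abs_nonneg _) zero_le_two
      nlinarith [abs_nonneg κ])
    (hν.ae_norm.mono fun y hy φ => by
      have hi := abs_coord_le_one hy i
      have hj := abs_coord_le_one hy j
      have h1 := (abs_sub (Real.sin φ * y i) (Real.cos φ * y j)).trans
        (hb _ _ _ _ (Real.abs_sin_le_one φ) (Real.abs_cos_le_one φ) hi hj)
      have h2 := (abs_add_le (Real.cos φ * y i) (Real.sin φ * y j)).trans
        (hb _ _ _ _ (Real.abs_cos_le_one φ) (Real.abs_sin_le_one φ) hi hj)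
      have h3 := (abs_add_le (-Real.sin φ * y i) (Real.cos φ * y j)).trans
        (hb _ _ _ _ (by rw [abs_neg]; exact Real.abs_sin_le_one φ) (Real.abs_cos_le_one φ) hi hj)
      have h4 := Real.abs_sin_le_one (κ * (Real.cos φ * y i + Real.sin φ * y j))
      have h5 := Real.abs_cos_le_one (κ * (Real.cos φ * y i + Real.sin φ * y j))
      simp only [hF']
      refine (abs_add_le _ _).trans (add_le_add ?_ ?_)
      · rw [abs_mul]
        calc _ ≤ (2 : ℝ) * 1 := mul_le_mul h2 h4 (abs_nonneg _) zero_le_two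
          _ = 2 := mul_one 2
      · rw [abs_mul, abs_mul, abs_mul κ]
        refine mul_le_mul h1 ?_ (by positivity) zero_le_two
        calc _ ≤ 1 * (|κ| * 2) := by gcongr
          _ = _ := one_mul _) 0
  have hconst : (fun φ => ∫ y, F φ y ∂ν) = fun _ => ∫ y, y j * Real.sin (κ * y i) ∂ν := by
    ext φ
    exact hν.integral_rotation hij φ fun a b => b * Real.sin (κ * a)
  rw [hconst] at hder
  have h0 := hder.unique (hasDerivAt_const _ _)
  have h1 : ∀ y, F' 0 y = y i * Real.sin (κ * y i) - κ * (y j ^ 2 * Real.cos (κ * y i)) := fun y => by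
    simp [hF']; ring
  simp only [h1] at h0
  rw [integral_sub, integral_const_mul, sub_eq_zero] at h0
  · exact h0
  · refine Integrable.of_bound (by fun_prop) 1 (hν.ae_norm.mono fun y hy => ?_)
    rw [norm_mul]
    exact mul_le_one₀ (abs_coord_le_one hy i) (norm_nonneg _) (Real.abs_sin_le_one _)
  · refine Integrable.const_mul (Integrable.of_bound (by fun_prop) 1 (hν.ae_norm.mono fun y hy => ?_)) _
    rw [norm_mul, norm_pow]
    exact mul_le_one₀ (pow_le_one₀ (norm_nonneg _) (abs_coord_le_one hy j)) (norm_nonneg _)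
      (Real.abs_cos_le_one _)

lemma measFT_eq (hν : IsSpherical ν) (i : Fin d) (ξ : Fin d → ℝ) :
    measFT ν ξ = ((∫ y, Real.cos (2 * Real.pi * ‖WithLp.toLp 2 ξ‖ * y i) ∂ν : ℝ) : ℂ) := by
  have := hν.finite
  set ρ := ‖WithLp.toLp 2 ξ‖ with hρ
  set w : EuclideanSpace ℝ (Fin d) := EuclideanSpace.single i ρ with hw
  have hnorm : ‖w‖ = ‖WithLp.toLp 2 ξ‖ := by
    rw [hw, PiLp.norm_single, Real.norm_of_nonneg (norm_nonneg _)]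
  set L := Submodule.reflection (Submodule.span ℝ {w - WithLp.toLp 2 ξ})ᗮ
  have hL : L w = WithLp.toLp 2 ξ := Submodule.reflection_sub hnorm
  have h1 : measFT ν ξ = ∫ y, eC (ρ * y i) ∂ν := by
    rw [measFT, ← hν.integral_comp L]
    refine integral_congr_ae (Filter.Eventually.of_forall fun y => ?_)
    simp only
    congr 1
    have h2 := L.inner_map_map w y
    rw [hL, PiLp.inner_apply, hw, EuclideanSpace.inner_single_left] at h2
    simpa using h2
  have hsin : ∫ y, Real.sin (2 * Real.pi * ρ * y i) ∂ν = 0 := by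
    have := hν.integral_comp (LinearIsometryEquiv.neg ℝ) fun y => Real.sin (2 * Real.pi * ρ * y i)
    simp only [LinearIsometryEquiv.coe_neg, PiLp.neg_apply, mul_neg, Real.sin_neg, integral_neg] at this
    linarith
  have hi : ∀ f : ℝ → ℝ, Continuous f → (∀ t, |f t| ≤ 1) →
      Integrable (fun y : EuclideanSpace ℝ (Fin d) => f (2 * Real.pi * ρ * y i)) ν := fun f hf h =>
    Integrable.of_bound (hf.comp (by fun_prop)).aestronglyMeasurable 1
      (Filter.Eventually.of_forall fun y => h _)
  have h3 : ∀ y : EuclideanSpace ℝ (Fin d), eC (ρ * y i) =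
      (Real.cos (2 * Real.pi * ρ * y i) : ℂ) + (Real.sin (2 * Real.pi * ρ * y i) : ℂ) * Complex.I :=
    fun y => by rw [eC_eq_cos_add_sin, ← mul_assoc]
  simp only [h1, h3]
  rw [integral_add, integral_mul_const, integral_complex_ofReal, integral_complex_ofReal, hsin]
  · simp
  · exact (hi _ Real.continuous_cos Real.abs_cos_le_one).ofReal
  · exact (hi _ Real.continuous_sin Real.abs_sin_le_one).ofReal.mul_const _

lemma exists_decay (hν : IsSpherical ν) (hd : 3 ≤ d) :
    ∃ C, 0 ≤ C ∧ ∀ (ξ : Fin d → ℝ) (j : Fin d), |ξ j| * ‖measFT ν ξ‖ ^ 2 ≤ C := by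
  have := hν.finite
  set i : Fin d := ⟨0, by omega⟩
  set c := 2 * Real.pi with hc
  have hc0 : 0 < c := by positivity
  have hc1 : 1 ≤ c := by have := Real.pi_gt_three; linarith
  set V := ν.real Set.univ
  have hbddint : ∀ f : EuclideanSpace ℝ (Fin d) → ℝ, Continuous f → ∀ B, (∀ᵐ y ∂ν, |f y| ≤ B) →
      Integrable f ν ∧ |∫ y, f y ∂ν| ≤ B * V := fun f hf B h =>
    ⟨Integrable.of_bound hf.aestronglyMeasurable B h, by
      rw [← Real.norm_eq_abs]
      exact norm_integral_le_of_norm_le_const h⟩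
  have b0 : ∀ r, ∀ y : EuclideanSpace ℝ (Fin d), |Real.cos (c * r * y i)| ≤ 1 := fun r y =>
    Real.abs_cos_le_one _
  have b1 : ∀ᵐ y ∂ν, ∀ r, |-(c * y i) * Real.sin (c * r * y i)| ≤ c := by
    filter_upwards [hν.ae_norm] with y hy r
    rw [abs_mul, abs_neg, abs_mul, abs_of_pos hc0]
    calc _ ≤ c * 1 * 1 := by
          gcongr
          · exact abs_coord_le_one hy i
          · exact Real.abs_sin_le_one _
      _ = c := by ring
  have b2 : ∀ᵐ y ∂ν, ∀ r, |-(c * y i) * (Real.cos (c * r * y i) * (c * y i))| ≤ c ^ 2 := by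
    filter_upwards [hν.ae_norm] with y hy r
    rw [abs_mul, abs_neg, abs_mul (Real.cos _), abs_mul c, abs_of_pos hc0]
    calc _ ≤ c * 1 * (1 * (c * 1)) := by
          gcongr
          · exact abs_coord_le_one hy i
          · exact Real.abs_cos_le_one _
          · exact abs_coord_le_one hy i
      _ = c ^ 2 := by ring
  have hV : 0 ≤ V := measureReal_nonneg
  have hode : ∀ r : ℝ, r * ((∫ y, -(c * y i) * (Real.cos (c * r * y i) * (c * y i)) ∂ν) +
      c ^ 2 * ∫ y, Real.cos (c * r * y i) ∂ν) +
      ((d : ℝ) - 1) * (∫ y, -(c * y i) * Real.sin (c * r * y i) ∂ν) = 0 := fun r => by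
    have hcos : ∀ j : Fin d, Integrable (fun y => y j ^ 2 * Real.cos (c * r * y i)) ν := fun j => by
      refine (hbddint _ (by fun_prop) 1 (hν.ae_norm.mono fun y hy => ?_)).1
      rw [abs_mul, abs_pow]
      exact mul_le_one₀ (pow_le_one₀ (abs_nonneg _) (abs_coord_le_one hy j)) (abs_nonneg _) (b0 r y)
    have e1 : ∫ y, -(c * y i) * (Real.cos (c * r * y i) * (c * y i)) ∂ν =
        -c ^ 2 * ∫ y, y i ^ 2 * Real.cos (c * r * y i) ∂ν := by
      rw [← integral_const_mul]; congr 1; ext y; ring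
    have e2 : ∫ y, -(c * y i) * Real.sin (c * r * y i) ∂ν =
        -c * ∫ y, y i * Real.sin (c * r * y i) ∂ν := by
      rw [← integral_const_mul]; congr 1; ext y; ring
    have e3 : ∫ y, Real.cos (c * r * y i) ∂ν = ∑ j, ∫ y, y j ^ 2 * Real.cos (c * r * y i) ∂ν := by
      rw [← integral_finsetSum _ fun j _ => hcos j]
      refine integral_congr_ae (hν.ae_norm.mono fun y hy => ?_)
      simp only
      rw [← Finset.sum_mul]
      have : ∑ j, y j ^ 2 = 1 := by
        rw [← EuclideanSpace.real_norm_sq_eq, hy, one_pow]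
      rw [this, one_mul]
    have e4 : ∑ j ∈ Finset.univ.erase i, (c * r * ∫ y, y j ^ 2 * Real.cos (c * r * y i) ∂ν) =
        (d - 1) * ∫ y, y i * Real.sin (c * r * y i) ∂ν := by
      rw [Finset.sum_congr rfl fun j hj => (hν.integral_mul_sin (Finset.ne_of_mem_erase hj).symm _).symm,
        Finset.sum_const, Finset.card_erase_of_mem (Finset.mem_univ _), Finset.card_univ,
        Fintype.card_fin, nsmul_eq_mul, Nat.cast_sub (by omega), Nat.cast_one]
    simp only [e1, e2, e3]
    rw [← Finset.add_sum_erase _ _ (Finset.mem_univ i)]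
    rw [← Finset.mul_sum] at e4
    linear_combination c * e4
  obtain ⟨C, hC, h⟩ := mul_sq_le_of_bessel_ode (b := d - 1) (c := c) (M := c * V)
    (u := fun r => ∫ y, Real.cos (c * r * y i) ∂ν)
    (u' := fun r => ∫ y, -(c * y i) * Real.sin (c * r * y i) ∂ν)
    (u'' := fun r => ∫ y, -(c * y i) * (Real.cos (c * r * y i) * (c * y i)) ∂ν)
    (by have : (3 : ℝ) ≤ d := by exact_mod_cast hd
        linarith) (by positivity)
    (fun r => hasDerivAt_integral_of_bound (F := fun r y => Real.cos (c * r * y i)) (C := c)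
      (fun r => by fun_prop) (fun r => by fun_prop)
      (fun r y => by
        have := (((hasDerivAt_id r).const_mul c).mul_const (y i)).cos
        refine this.congr_deriv ?_
        simp; ring)
      (Filter.Eventually.of_forall fun y r => (b0 r y).trans hc1) b1 r)
    (fun r => hasDerivAt_integral_of_bound (F := fun r y => -(c * y i) * Real.sin (c * r * y i))
      (C := c ^ 2) (fun r => by fun_prop) (fun r => by fun_prop)
      (fun r y => by
        have := (((hasDerivAt_id r).const_mul c).mul_const (y i)).sin.const_mul (-(c * y i))
        refine this.congr_deriv ?_
        simp)
      (b1.mono fun y hy r => (hy r).trans (by nlinarith)) b2 r)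
    hode
    (fun r => (hbddint _ (by fun_prop) 1 (Filter.Eventually.of_forall (b0 r))).2.trans (by gcongr))
    (fun r => (hbddint _ (by fun_prop) c (b1.mono fun y hy => hy r)).2)
  refine ⟨C, hC, fun ξ j => ?_⟩
  have hj : |ξ j| ≤ ‖WithLp.toLp 2 ξ‖ := PiLp.norm_apply_le (WithLp.toLp 2 ξ) j
  rw [hν.measFT_eq i, Complex.norm_real, Real.norm_eq_abs, sq_abs]
  rcases (norm_nonneg (WithLp.toLp 2 ξ)).eq_or_lt with h0 | h0
  · have : |ξ j| = 0 := le_antisymm (by rw [h0]; exact hj) (abs_nonneg _)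
    rw [this, zero_mul]; exact hC
  · have h1 := h _ h0
    set X := ∫ y, Real.cos (c * ‖WithLp.toLp 2 ξ‖ * y i) ∂ν
    calc |ξ j| * X ^ 2 ≤ ‖WithLp.toLp 2 ξ‖ * X ^ 2 := by gcongr
      _ ≤ c ^ 2 * (‖WithLp.toLp 2 ξ‖ * X ^ 2) :=
          le_mul_of_one_le_left (by positivity) (one_le_pow₀ hc1)
      _ ≤ C := h1
end IsSpherical

end

section

variable {d : ℕ}
variable {ν : Measure (EuclideanSpace ℝ (Fin d))}

lemma isSpherical_sphMeasure (h : IsFiniteMeasure (sphMeasure d 1)) : IsSpherical (sphMeasure d 1) where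
  finite := h
  ae_norm := by
    rw [sphMeasure]
    refine Measure.ae_smul_measure ?_ _
    filter_upwards [ae_restrict_mem Metric.isClosed_sphere.measurableSet] with y hy
    simpa using hy
  map_eq := fun L => by
    rw [sphMeasure, Measure.map_smul]
    congr 1
    have h1 := (L.toIsometryEquiv.measurePreserving_hausdorffMeasure ((d : ℝ) - 1)).restrict_preimage
      (Metric.isClosed_sphere (x := (0 : EuclideanSpace ℝ (Fin d))) (ε := 1)).measurableSet
    have h2 : L.toIsometryEquiv ⁻¹' Metric.sphere (0 : EuclideanSpace ℝ (Fin d)) 1 = Metric.sphere 0 1 := by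
      ext y; simp
    rw [h2] at h1
    exact h1.map_eq

open scoped Pointwise in
lemma sphMeasure_eq_map (hd : 1 ≤ d) {r : ℝ} (hr : 0 < r) :
    sphMeasure d r = (sphMeasure d 1).map (fun y => r • y) := by
  have hm : Measurable fun y : EuclideanSpace ℝ (Fin d) => r • y := by fun_prop
  rw [sphMeasure, sphMeasure, Measure.map_smul]
  ext A hA
  have hd' : (0 : ℝ) ≤ d - 1 := by
    have : (1 : ℝ) ≤ d := by exact_mod_cast hd
    linarith
  simp only [Measure.smul_apply, smul_eq_mul]
  rw [Measure.map_apply hm hA, Measure.restrict_apply hA, Measure.restrict_apply (hm hA)]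
  have h1 : A ∩ Metric.sphere 0 r = r • ((fun y => r • y) ⁻¹' A ∩ Metric.sphere (0 : EuclideanSpace ℝ (Fin d)) 1) := by
    ext y
    rw [Set.mem_smul_set_iff_inv_smul_mem₀ hr.ne']
    simp only [Set.mem_inter_iff, Set.mem_preimage, smul_inv_smul₀ hr.ne', mem_sphere_iff_norm, sub_zero,
      norm_smul, norm_inv, Real.norm_of_nonneg hr.le]
    rw [inv_mul_eq_iff_eq_mul₀ hr.ne', mul_one]
  rw [h1, Measure.hausdorffMeasure_smul₀ hd' hr.ne', ENNReal.smul_def, smul_eq_mul, ← mul_assoc]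
  congr 1
  rw [one_pow, mul_one, ENNReal.ofReal_mul zero_le_two, ENNReal.mul_inv (by simp) (by simp), mul_assoc]
  have h2 : ((‖r‖₊ ^ ((d : ℝ) - 1) : ℝ≥0) : ℝ≥0∞) = ENNReal.ofReal (r ^ (d - 1)) := by
    rw [show ((d : ℝ) - 1) = ((d - 1 : ℕ) : ℝ) by push_cast [hd]; ring, NNReal.rpow_natCast,
      ENNReal.ofReal_pow hr.le, ENNReal.coe_pow]
    congr 1
    rw [← Real.toNNReal_eq_nnnorm_of_nonneg hr.le]; rfl
  rw [h2, ENNReal.inv_mul_cancel, mul_one]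
  · simp [hr]
  · simp

lemma measFT_map_smul (t : ℝ) (ξ : Fin d → ℝ) :
    measFT (ν.map (fun y => t • y)) ξ = measFT ν (t • ξ) := by
  rw [measFT, measFT, integral_map (by fun_prop) (Continuous.aestronglyMeasurable (by fun_prop))]
  refine integral_congr_ae (Filter.Eventually.of_forall fun y => ?_)
  simp only [PiLp.smul_apply, Pi.smul_apply, smul_eq_mul]
  congr 2; ext i; ring

lemma fourierSphMeasure_eq (hd : 1 ≤ d) {r : ℝ} (hr : 0 < r) (ξ : Fin d → ℝ) :
    fourierSphMeasure d r ξ = measFT (sphMeasure d 1) (r • ξ) := by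
  rw [← measFT_map_smul, ← sphMeasure_eq_map hd hr]; rfl

lemma measFT_eq_zero_of_not_finite (h : ¬ IsFiniteMeasure ν) (ξ : Fin d → ℝ) : measFT ν ξ = 0 := by
  refine integral_undef fun hi => h ?_
  have h1 := hi.norm
  simp only [norm_eC] at h1
  exact (integrable_const_iff.1 h1).resolve_left one_ne_zero

namespace IsSpherical

lemma ae_map_smul (hν : IsSpherical ν) {t : ℝ} (ht : 0 ≤ t) :
    ∀ᵐ y ∂(ν.map fun y => t • y), ∀ i, |y i| ≤ t := by
  rw [ae_map_iff (by fun_prop)]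
  · filter_upwards [hν.ae_norm] with y hy i
    rw [PiLp.smul_apply, smul_eq_mul, abs_mul, abs_of_nonneg ht]
    exact mul_le_of_le_one_right ht (abs_coord_le_one hy i)
  · simp only [Set.ofPred_forall]
    refine MeasurableSet.iInter fun i => measurableSet_le ?_ measurable_const
    fun_prop

end IsSpherical

lemma map_smul_univ (t : ℝ) : (ν.map fun y => t • y) Set.univ = ν Set.univ := by
  rw [Measure.map_apply (by fun_prop) MeasurableSet.univ, Set.preimage_univ]

end

section

variable {d : ℕ}

/-- The half-open unit cube with corner `a`. -/
def ubox (a : Fin d → ℝ) : Set (Fin d → ℝ) := {x | ∀ i, x i ∈ Set.Ioc (a i) (a i + 1)}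

lemma measurableSet_ubox (a : Fin d → ℝ) : MeasurableSet (ubox a) :=
  MeasurableSet.univ_pi' fun _ => measurableSet_Ioc

lemma volume_ubox (a : Fin d → ℝ) : volume (ubox a) = 1 := by
  have : ubox a = Set.univ.pi fun i => Set.Ioc (a i) (a i + 1) := by
    ext x; simp [ubox, Set.mem_pi]
  rw [this, Real.volume_pi_Ioc]
  simp

instance (a : Fin d → ℝ) : IsFiniteMeasure (volume.restrict (ubox a)) :=
  ⟨by rw [Measure.restrict_apply_univ, volume_ubox]; exact ENNReal.one_lt_top⟩

/-- Fourier coefficients over the unit cube with corner `a`. -/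
def boxCoeff (a : Fin d → ℝ) (g : (Fin d → ℝ) → ℂ) (z : Fin d → ℤ) : ℂ :=
  ∫ ξ in ubox a, g ξ * eC (-∑ i, (z i : ℝ) * ξ i)

section

local instance unitAddCircleMeasureSpace : MeasureSpace UnitAddCircle := ⟨AddCircle.haarAddCircle⟩

local instance unitAddCircleIsProbabilityMeasure :
    IsProbabilityMeasure (volume : Measure UnitAddCircle) :=
  inferInstanceAs (IsProbabilityMeasure AddCircle.haarAddCircle)

open UnitAddTorus

lemma mFourier_neg_coe (n : Fin d → ℤ) (x : Fin d → ℝ) :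
    mFourier (-n) (fun i => (x i : UnitAddCircle)) = eC (-∑ i, (n i : ℝ) * x i) := by
  simp only [mFourier, ContinuousMap.coe_mk, fourier_coe_apply, eC]
  rw [← Complex.exp_sum]
  congr 1
  push_cast
  rw [mul_neg, Finset.mul_sum, ← Finset.sum_neg_distrib]
  refine Finset.sum_congr rfl fun i _ => ?_
  simp
  ring

lemma exists_torus_lift (a : Fin d → ℝ) {g : (Fin d → ℝ) → ℂ} (hg : Measurable g) {M : ℝ}
    (hM : ∀ ξ, ‖g ξ‖ ≤ M) :
    ∃ G : UnitAddTorus (Fin d) → ℂ, MemLp G 2 volume ∧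
      ∀ x ∈ ubox a, G (fun i => (x i : UnitAddCircle)) = g x := by
  refine ⟨fun x => g (measurableEquivPiIoc a x).1, ?_, fun x hx => ?_⟩
  · refine MemLp.of_bound (C := M) ?_ (Filter.Eventually.of_forall fun x => hM _)
    exact (hg.comp (measurable_subtype_coe.comp (measurableEquivPiIoc a).measurable)).aestronglyMeasurable
  · have : (measurableEquivPiIoc a) (fun i => (x i : UnitAddCircle)) = ⟨x, hx⟩ :=
      (measurableEquivPiIoc a).apply_symm_apply ⟨x, hx⟩
    simp only [this]

theorem hasSum_boxCoeff (a : Fin d → ℝ) {g h : (Fin d → ℝ) → ℂ} (hg : Measurable g)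
    (hh : Measurable h) {M : ℝ} (hMg : ∀ ξ, ‖g ξ‖ ≤ M) (hMh : ∀ ξ, ‖h ξ‖ ≤ M) :
    HasSum (fun z => (starRingEnd ℂ) (boxCoeff a g z) * boxCoeff a h z)
      (∫ ξ in ubox a, (starRingEnd ℂ) (g ξ) * h ξ) := by
  obtain ⟨G, hG, hG'⟩ := exists_torus_lift a hg hMg
  obtain ⟨H, hH, hH'⟩ := exists_torus_lift a hh hMh
  have hcoef : ∀ {F : UnitAddTorus (Fin d) → ℂ} {f : (Fin d → ℝ) → ℂ} (hF : MemLp F 2 volume)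
      (_ : ∀ x ∈ ubox a, F (fun i => (x i : UnitAddCircle)) = f x) (z : Fin d → ℤ),
      mFourierCoeff (hF.toLp F) z = boxCoeff a f z := fun {F f} hF hf z => by
    have h1 : mFourierCoeff (hF.toLp F) z = mFourierCoeff F z :=
      integral_congr_ae (hF.coeFn_toLp.mono fun t ht => by simp only [ht])
    rw [h1, mFourierCoeff_eq_integral F z a, boxCoeff]
    refine setIntegral_congr_fun (measurableSet_ubox a) fun x hx => ?_
    simp only [mFourier_neg_coe, hf x hx, smul_eq_mul]
    exact mul_comm _ _
  have := hasSum_prod_mFourierCoeff (hG.toLp G) (hH.toLp H)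
  simp only [hcoef hG hG', hcoef hH hH'] at this
  convert! this using 1
  have h2 : ∫ t, (starRingEnd ℂ) ((hG.toLp G) t) * (hH.toLp H) t = ∫ t, (starRingEnd ℂ) (G t) * H t := by
    refine integral_congr_ae ?_
    filter_upwards [hG.coeFn_toLp, hH.coeFn_toLp] with t h1 h2
    rw [h1, h2]
  rw [h2, integral_preimage _ a]
  refine setIntegral_congr_fun (measurableSet_ubox a) fun x hx => ?_
  simp only [hG' x hx, hH' x hx]

end

lemma tsum_enorm_boxCoeff_sq (a : Fin d → ℝ) {g : (Fin d → ℝ) → ℂ} (hg : Measurable g) {M : ℝ}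
    (hM : ∀ ξ, ‖g ξ‖ ≤ M) :
    ∑' z, ‖boxCoeff a g z‖ₑ ^ 2 = ∫⁻ ξ in ubox a, ‖g ξ‖ₑ ^ 2 := by
  have hM0 : 0 ≤ M := (norm_nonneg _).trans (hM 0)
  have h := Complex.hasSum_re (hasSum_boxCoeff a hg hg hM hM)
  have e : ∀ w : ℂ, (starRingEnd ℂ) w * w = ((‖w‖ ^ 2 : ℝ) : ℂ) := fun w => by
    rw [mul_comm, Complex.mul_conj, Complex.normSq_eq_norm_sq]
  simp only [e, integral_complex_ofReal, Complex.ofReal_re] at h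
  have hen : ∀ w : ℂ, ‖w‖ₑ ^ 2 = ENNReal.ofReal (‖w‖ ^ 2) := fun w => by
    rw [← ofReal_norm, ENNReal.ofReal_pow (norm_nonneg _)]
  simp only [hen]
  rw [← ENNReal.ofReal_tsum_of_nonneg (fun _ => by positivity) h.summable, h.tsum_eq,
    ofReal_integral_eq_lintegral_ofReal]
  · refine Integrable.of_bound (hg.norm.pow_const 2).aestronglyMeasurable (M ^ 2)
      (Filter.Eventually.of_forall fun ξ => ?_)
    rw [Real.norm_of_nonneg (by positivity)]
    gcongr; exact hM ξ
  · exact Filter.Eventually.of_forall fun ξ => by positivity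

end

section

variable {d : ℕ}

lemma ftZ_eq_sum {f : (Fin d → ℤ) → ℂ} (hf : f.support.Finite) (ξ : Fin d → ℝ) :
    ftZ f ξ = ∑ n ∈ hf.toFinset, f n * eC (∑ i, (n i : ℝ) * ξ i) := by
  refine tsum_eq_sum fun n hn => ?_
  rw [Set.Finite.mem_toFinset, Function.notMem_support] at hn
  rw [hn, zero_mul]

lemma continuous_ftZ {f : (Fin d → ℤ) → ℂ} (hf : f.support.Finite) : Continuous (ftZ f) := by
  have : ftZ f = fun ξ => ∑ n ∈ hf.toFinset, f n * eC (∑ i, (n i : ℝ) * ξ i) :=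
    funext (ftZ_eq_sum hf)
  rw [this]
  have := continuous_eC
  fun_prop

lemma norm_ftZ_le {f : (Fin d → ℤ) → ℂ} (hf : f.support.Finite) (ξ : Fin d → ℝ) :
    ‖ftZ f ξ‖ ≤ ∑ n ∈ hf.toFinset, ‖f n‖ := by
  rw [ftZ_eq_sum hf]
  refine (norm_sum_le _ _).trans (Finset.sum_le_sum fun n _ => ?_)
  rw [norm_mul, norm_eC, mul_one]

lemma integrable_boxCoeff (a : Fin d → ℝ) {m : (Fin d → ℝ) → ℂ} (hm : Measurable m) {M : ℝ}
    (hM : ∀ ξ, ‖m ξ‖ ≤ M) (z : Fin d → ℤ) :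
    Integrable (fun ξ => m ξ * eC (-∑ i, (z i : ℝ) * ξ i)) (volume.restrict (ubox a)) := by
  refine Integrable.of_bound (C := M) ?_ (Filter.Eventually.of_forall fun ξ => ?_)
  · refine (hm.mul ?_).aestronglyMeasurable
    exact (continuous_eC.comp (by fun_prop)).measurable
  · rw [norm_mul, norm_eC, mul_one]; exact hM ξ

lemma dconv_boxCoeff (a : Fin d → ℝ) {m : (Fin d → ℝ) → ℂ} (hm : Measurable m) {M : ℝ}
    (hM : ∀ ξ, ‖m ξ‖ ≤ M) {f : (Fin d → ℤ) → ℂ} (hf : f.support.Finite) (x : Fin d → ℤ) :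
    dconv f (boxCoeff a m) x = boxCoeff a (fun ξ => m ξ * ftZ f ξ) x := by
  have h1 : dconv f (boxCoeff a m) x = ∑ y ∈ hf.toFinset, f y * boxCoeff a m (x - y) := by
    refine tsum_eq_sum fun n hn => ?_
    rw [Set.Finite.mem_toFinset, Function.notMem_support] at hn
    rw [hn, zero_mul]
  rw [h1]
  simp only [boxCoeff, ← integral_const_mul]
  rw [← integral_finsetSum _ fun y _ => (integrable_boxCoeff a hm hM (x - y)).const_mul (f y)]
  refine integral_congr_ae (Filter.Eventually.of_forall fun ξ => ?_)
  simp only [ftZ_eq_sum hf, Finset.mul_sum, Finset.sum_mul]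
  refine Finset.sum_congr rfl fun y _ => ?_
  have : (-∑ i, (((x - y) i : ℤ) : ℝ) * ξ i)
      = (∑ i, (y i : ℝ) * ξ i) + -∑ i, (x i : ℝ) * ξ i := by
    simp only [Pi.sub_apply, Int.cast_sub, sub_mul, Finset.sum_sub_distrib]; ring
  rw [this, eC_add]
  ring

lemma boxCoeff_one (a : Fin d → ℝ) (z : Fin d → ℤ) :
    boxCoeff a (fun _ => 1) z = if z = 0 then 1 else 0 := by
  have hbox : ubox a = Set.univ.pi fun i => Set.Ioc (a i) (a i + 1) := by
    ext x; simp [ubox, Set.mem_pi]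
  have h1 : boxCoeff a (fun _ => 1) z
      = ∏ i, ∫ t in Set.Ioc (a i) (a i + 1), eC (-((z i : ℝ) * t)) := by
    rw [boxCoeff, hbox, volume_pi, Measure.restrict_pi_pi,
      ← integral_fintype_prod_eq_prod (fun i t => eC (-((z i : ℝ) * t)))]
    refine integral_congr_ae (Filter.Eventually.of_forall fun ξ => ?_)
    simp only [one_mul, eC, ← Complex.exp_sum]
    congr 1
    push_cast
    rw [mul_neg, Finset.mul_sum, ← Finset.sum_neg_distrib]
    exact Finset.sum_congr rfl fun i _ => by ring
  rw [h1]
  split_ifs with hz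
  · subst hz
    refine Finset.prod_eq_one fun i _ => ?_
    simp [eC_zero]
  · obtain ⟨i, hi⟩ := Function.ne_iff.1 hz
    refine Finset.prod_eq_zero (Finset.mem_univ i) ?_
    rw [← intervalIntegral.integral_of_le (by linarith)]
    have hi' : (z i : ℂ) ≠ 0 := by exact_mod_cast hi
    have hc : -(2 * Real.pi * Complex.I * (z i : ℂ)) ≠ 0 := by
      simp [hi', Real.pi_ne_zero]
    have : (fun t : ℝ => eC (-((z i : ℝ) * t)))
        = fun t : ℝ => Complex.exp (-(2 * Real.pi * Complex.I * (z i : ℂ)) * t) := by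
      funext t; simp only [eC]; congr 1; push_cast; ring
    rw [this, integral_exp_mul_complex hc, div_eq_zero_iff, sub_eq_zero]
    left
    rw [Complex.exp_eq_exp_iff_exists_int]
    refine ⟨-z i, ?_⟩
    push_cast; ring

lemma dconv_boxCoeff_one (a : Fin d → ℝ) (f : (Fin d → ℤ) → ℂ) (x : Fin d → ℤ) :
    dconv f (boxCoeff a fun _ => 1) x = f x := by
  rw [dconv, tsum_eq_single x fun y hy => by
    rw [boxCoeff_one, if_neg (sub_ne_zero.2 hy.symm), mul_zero]]
  rw [boxCoeff_one, if_pos (sub_self x), mul_one]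

lemma tsum_dconv_boxCoeff_sq (a : Fin d → ℝ) {m : (Fin d → ℝ) → ℂ} (hm : Measurable m) {M : ℝ}
    (hM : ∀ ξ, ‖m ξ‖ ≤ M) {f : (Fin d → ℤ) → ℂ} (hf : f.support.Finite) :
    ∑' x, ‖dconv f (boxCoeff a m) x‖ₑ ^ 2 = ∫⁻ ξ in ubox a, ‖m ξ‖ₑ ^ 2 * ‖ftZ f ξ‖ₑ ^ 2 := by
  simp only [dconv_boxCoeff a hm hM hf]
  rw [tsum_enorm_boxCoeff_sq a (g := fun ξ => m ξ * ftZ f ξ) (hm.mul (continuous_ftZ hf).measurable)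
    (M := M * ∑ n ∈ hf.toFinset, ‖f n‖)]
  · simp only [enorm_mul, mul_pow]
  · intro ξ
    rw [norm_mul]
    exact mul_le_mul (hM ξ) (norm_ftZ_le hf ξ) (norm_nonneg _) ((norm_nonneg _).trans (hM ξ))

lemma lintegral_ftZ_sq (a : Fin d → ℝ) {f : (Fin d → ℤ) → ℂ} (hf : f.support.Finite) :
    ∫⁻ ξ in ubox a, ‖ftZ f ξ‖ₑ ^ 2 = ∑' x, ‖f x‖ₑ ^ 2 := by
  have := tsum_dconv_boxCoeff_sq a (m := fun _ => 1) measurable_const (M := 1) (by simp) hf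
  simp only [dconv_boxCoeff_one] at this
  rw [this]
  simp

/-- A maximal operator whose multipliers have a bounded square function is bounded on `ℓ²`. -/
lemma tsum_maxConv_boxCoeff_sq_le {κ : Type*} [Countable κ] (a : Fin d → ℝ)
    {m : κ → (Fin d → ℝ) → ℂ} (hm : ∀ k, Measurable (m k)) {b : ℝ≥0∞} {M : ℝ}
    (hM : ∀ k ξ, ‖m k ξ‖ ≤ M) (hb : ∀ ξ, ∑' k, ‖m k ξ‖ₑ ^ 2 ≤ b)
    {f : (Fin d → ℤ) → ℂ} (hf : f.support.Finite) :
    ∑' x, maxConv (fun k => boxCoeff a (m k)) f x ^ 2 ≤ b * ∑' x, ‖f x‖ₑ ^ 2 := by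
  calc ∑' x, maxConv (fun k => boxCoeff a (m k)) f x ^ 2
      ≤ ∑' x, ∑' k, ‖dconv f (boxCoeff a (m k)) x‖ₑ ^ 2 := by
        refine ENNReal.tsum_le_tsum fun x => ?_
        have : (maxConv (fun k => boxCoeff a (m k)) f x) ^ 2
            = ⨆ k, ‖dconv f (boxCoeff a (m k)) x‖ₑ ^ 2 := by
          rw [maxConv]
          exact ENNReal.iSup_pow_of_ne_zero two_ne_zero _
        rw [this]
        exact iSup_le fun k => ENNReal.le_tsum k
    _ = ∑' k, ∫⁻ ξ in ubox a, ‖m k ξ‖ₑ ^ 2 * ‖ftZ f ξ‖ₑ ^ 2 := by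
        rw [ENNReal.tsum_comm]
        exact tsum_congr fun k => tsum_dconv_boxCoeff_sq a (hm k) (hM k) hf
    _ = ∫⁻ ξ in ubox a, ∑' k, ‖m k ξ‖ₑ ^ 2 * ‖ftZ f ξ‖ₑ ^ 2 := by
        refine (lintegral_tsum fun k => ?_).symm
        exact (((hm k).enorm.pow_const 2).mul
          ((continuous_ftZ hf).measurable.enorm.pow_const 2)).aemeasurable
    _ ≤ ∫⁻ ξ in ubox a, b * ‖ftZ f ξ‖ₑ ^ 2 := by
        refine lintegral_mono fun ξ => ?_
        rw [ENNReal.tsum_mul_right]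
        gcongr
        exact hb ξ
    _ = b * ∑' x, ‖f x‖ₑ ^ 2 := by
        rw [lintegral_const_mul _ ((continuous_ftZ hf).measurable.enorm.pow_const 2),
          lintegral_ftZ_sq a hf]

end

section

variable {d : ℕ}

/-- The restriction of `avgK` to the integer lattice. -/
def latK (g : (Fin d → ℝ) → ℂ) (s : ℝ) (μ : Measure (EuclideanSpace ℝ (Fin d)))
    (x : Fin d → ℤ) : ℂ := avgK g s μ (fun i => x i)

lemma tsum_dyadic_min_le {w : ℕ → ℝ≥0∞} {i j : ℕ} (h1 : ∀ n, w n ≤ 1)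
    (h2 : ∀ n, w (n + i) ≤ 2⁻¹ ^ n) (h3 : ∀ m n, n + m + 1 = i → w n ≤ 2 ^ j * 2⁻¹ ^ m) :
    ∑' n, w n ≤ j + 4 := by
  have geo : ∑' n : ℕ, (2⁻¹ : ℝ≥0∞) ^ n = 2 := by
    rw [ENNReal.tsum_geometric, ENNReal.one_sub_inv_two, inv_inv]
  rw [← Summable.sum_add_tsum_nat_add' (k := i) ENNReal.summable]
  have hA : ∑' n, w (n + i) ≤ 2 := by
    rw [← geo]; exact ENNReal.tsum_le_tsum h2
  have hB : ∑ n ∈ Finset.range i, w n ≤ j + 2 := by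
    rw [← Finset.sum_range_reflect]
    set v : ℕ → ℝ≥0∞ := fun m => min 1 (2 ^ j * 2⁻¹ ^ m) with hv
    calc ∑ m ∈ Finset.range i, w (i - 1 - m) ≤ ∑ m ∈ Finset.range i, v m := by
          refine Finset.sum_le_sum fun m hm => le_min (h1 _) (h3 _ _ ?_)
          have := Finset.mem_range.1 hm; omega
      _ ≤ ∑' m, v m := ENNReal.sum_le_tsum _
      _ = ∑ m ∈ Finset.range j, v m + ∑' m, v (m + j) :=
          (Summable.sum_add_tsum_nat_add' ENNReal.summable).symm
      _ ≤ ∑ m ∈ Finset.range j, 1 + ∑' m : ℕ, (2⁻¹ : ℝ≥0∞) ^ m := by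
          refine add_le_add (Finset.sum_le_sum fun m _ => min_le_left _ _)
            (ENNReal.tsum_le_tsum fun m => (min_le_right _ _).trans_eq ?_)
          rw [pow_add, mul_comm ((2⁻¹ : ℝ≥0∞) ^ m), ← mul_assoc, ← mul_pow,
            ENNReal.mul_inv_cancel two_ne_zero ENNReal.ofNat_ne_top, one_pow, one_mul]
      _ = j + 2 := by rw [geo]; simp
  calc _ ≤ ((j : ℝ≥0∞) + 2) + 2 := add_le_add hB hA
    _ = j + 4 := by rw [add_assoc]; norm_num

lemma tsum_comp_sub_right (h : Fin d → ℤ) (F : (Fin d → ℤ) → ℝ≥0∞) :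
    ∑' x, F (x - h) = ∑' x, F x := (Equiv.subRight h).tsum_eq F

lemma Hormander.comp {κ κ' : Type*} {K : κ → (Fin d → ℤ) → ℂ} {B : ℝ} (hB : Hormander K B)
    (e : κ' → κ) : Hormander (fun k => K (e k)) B := fun i h hh => by
  refine le_trans (ENNReal.tsum_le_tsum fun x => ?_) (hB i h hh)
  split_ifs
  · exact le_rfl
  · exact iSup_le fun k => le_iSup (fun k => ‖K k (x - h) - K k x‖ₑ) (e k)

lemma Hormander.sub {κ : Type*} {K K' : κ → (Fin d → ℤ) → ℂ} {B B' : ℝ} (hB : Hormander K B)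
    (hB' : Hormander K' B') (h0 : 0 ≤ B) (h0' : 0 ≤ B') :
    Hormander (fun k x => K k x - K' k x) (B + B') := fun i h hh => by
  rw [ENNReal.ofReal_add h0 h0']
  refine le_trans ?_ (add_le_add (hB i h hh) (hB' i h hh))
  rw [← ENNReal.tsum_add]
  refine ENNReal.tsum_le_tsum fun x => ?_
  split_ifs
  · simp
  · refine iSup_le fun k => ?_
    calc ‖K k (x - h) - K' k (x - h) - (K k x - K' k x)‖ₑ
        = ‖(K k (x - h) - K k x) - (K' k (x - h) - K' k x)‖ₑ := by congr 1; ring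
      _ ≤ ‖K k (x - h) - K k x‖ₑ + ‖K' k (x - h) - K' k x‖ₑ := enorm_sub_le
      _ ≤ _ := add_le_add (le_iSup (fun k => ‖K k (x - h) - K k x‖ₑ) k)
          (le_iSup (fun k => ‖K' k (x - h) - K' k x‖ₑ) k)

lemma NiceKernel.hormander_latK {g : (Fin d → ℝ) → ℂ} {A w : ℝ} (hg : NiceKernel g A)
    (hA : 0 ≤ A) {j : ℕ} {μ : ℕ → Measure (EuclideanSpace ℝ (Fin d))}
    (hμf : ∀ n, IsFiniteMeasure (μ n)) (hw : 0 ≤ w) (hμw : ∀ n, μ n Set.univ ≤ ENNReal.ofReal w)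
    (hμ : ∀ n, ∀ᵐ y ∂(μ n), ∀ i, |y i| ≤ 2 ^ (j + n + 1)) :
    Hormander (fun n => latK g (2 ^ n) (μ n)) (8 * (A * (3 * Real.pi) ^ d * w) * (j + 4)) := by
  intro i h hh
  set D := A * (3 * Real.pi) ^ d * w with hD
  have hpi := Real.pi_pos
  have hD0 : 0 ≤ D := by positivity
  have hh' : ∀ k, |(h k : ℝ)| < 2 ^ i := fun k => by exact_mod_cast hh k
  have toD : ∀ (n : ℕ) (c : ℝ), 0 ≤ c →
      ENNReal.ofReal (c * A * (3 * Real.pi) ^ d) * μ n Set.univ ≤ ENNReal.ofReal (c * D) :=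
    fun n c hc => by
      refine (mul_le_mul_right (hμw n) _).trans_eq ?_
      rw [← ENNReal.ofReal_mul (by positivity)]
      congr 1; rw [hD]; ring
  have toD1 : ∀ n, ENNReal.ofReal (A * (3 * Real.pi) ^ d) * μ n Set.univ ≤ ENNReal.ofReal D :=
    fun n => by simpa using toD n 1 zero_le_one
  set S : ℕ → ℝ≥0∞ := fun n => ∑' x : Fin d → ℤ, (if ∀ j, |x j| < 2 * 2 ^ i then 0 else
    ‖latK g (2 ^ n) (μ n) (x - h) - latK g (2 ^ n) (μ n) x‖ₑ) with hS
  have one_le : ∀ n : ℕ, (1 : ℝ) ≤ 2 ^ n := fun n => one_le_pow₀ (by norm_num)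
  have hS1 : ∀ n, S n ≤ ENNReal.ofReal (8 * D) := fun n => by
    calc S n ≤ ∑' x : Fin d → ℤ, (‖latK g (2 ^ n) (μ n) (x - h)‖ₑ + ‖latK g (2 ^ n) (μ n) x‖ₑ) := by
          refine ENNReal.tsum_le_tsum fun x => ?_
          split_ifs
          · simp
          · exact enorm_sub_le
      _ = 2 * ∑' x, ‖latK g (2 ^ n) (μ n) x‖ₑ := by
          rw [ENNReal.tsum_add, tsum_comp_sub_right h fun x => ‖latK g (2 ^ n) (μ n) x‖ₑ, two_mul]
      _ ≤ 2 * ENNReal.ofReal D := by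
          gcongr
          exact (hg.tsum_avgK_le hA (one_le n)).trans (toD1 n)
      _ = ENNReal.ofReal (2 * D) := by
          rw [ENNReal.ofReal_mul zero_le_two, ENNReal.ofReal_ofNat]
      _ ≤ _ := ENNReal.ofReal_le_ofReal (by linarith)
  have hS2 : ∀ n, S n ≤ ENNReal.ofReal (2 * 2 ^ i / 2 ^ n * D) := fun n => by
    refine le_trans (ENNReal.tsum_le_tsum fun x => ?_)
      ((hg.tsum_avgK_sub_le hA (one_le n) (by positivity) h fun k => (hh' k).le).trans
        (toD n (2 * 2 ^ i / 2 ^ n) (by positivity)))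
    split_ifs
    · simp
    · exact le_rfl
  have hS3 : ∀ n, S n ≤ ENNReal.ofReal (8 * 2 ^ (j + n) / 2 ^ i * D) := fun n => by
    have hst : (2 : ℝ) ^ n ≤ 2 ^ (j + n + 1) := pow_le_pow_right₀ (by norm_num) (by omega)
    set T : (Fin d → ℤ) → ℝ≥0∞ := fun x =>
      if ∀ j, |(x j : ℝ)| < 2 ^ i then 0 else ‖avgK g (2 ^ n) (μ n) (fun i => x i)‖ₑ with hT
    have hTs : ∑' x, T x ≤ ENNReal.ofReal (2 * 2 ^ (j + n + 1) / 2 ^ i * D) :=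
      (hg.tsum_avgK_tail_le hA (one_le n) hst (hμ n) (by positivity)).trans
        (toD n _ (by positivity))
    calc S n ≤ ∑' x, (T (x - h) + T x) := by
          refine ENNReal.tsum_le_tsum fun x => ?_
          split_ifs with hx
          · simp
          · push Not at hx
            obtain ⟨k, hk⟩ := hx
            have hk' : (2 : ℝ) * 2 ^ i ≤ |(x k : ℝ)| := by exact_mod_cast hk
            have hp : (0 : ℝ) < 2 ^ i := by positivity
            have h1 : T x = ‖latK g (2 ^ n) (μ n) x‖ₑ := by
              rw [hT]; beta_reduce; rw [if_neg]; rfl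
              push Not
              exact ⟨k, by linarith⟩
            have h2 : T (x - h) = ‖latK g (2 ^ n) (μ n) (x - h)‖ₑ := by
              rw [hT]; beta_reduce; rw [if_neg]; rfl
              push Not
              refine ⟨k, ?_⟩
              rw [Pi.sub_apply, Int.cast_sub]
              have := abs_sub_abs_le_abs_sub (x k : ℝ) (h k)
              linarith [hh' k]
            rw [h1, h2]
            exact enorm_sub_le
      _ = 2 * ∑' x, T x := by rw [ENNReal.tsum_add, tsum_comp_sub_right h T, two_mul]
      _ ≤ 2 * ENNReal.ofReal (2 * 2 ^ (j + n + 1) / 2 ^ i * D) := by gcongr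
      _ = ENNReal.ofReal (8 * 2 ^ (j + n) / 2 ^ i * D) := by
          rw [show (2 : ℝ≥0∞) = ENNReal.ofReal 2 by simp, ← ENNReal.ofReal_mul (by norm_num)]
          congr 1; rw [pow_succ]; ring
  have ofReal_inv_two_pow : ∀ m : ℕ, (2⁻¹ : ℝ≥0∞) ^ m = ENNReal.ofReal (1 / 2 ^ m) := fun m => by
    rw [one_div, ← inv_pow, ENNReal.ofReal_pow (by norm_num), ENNReal.ofReal_inv_of_pos (by norm_num)]
    simp
  have key : ∑' n, S n ≤ ENNReal.ofReal (8 * D) * (j + 4) := by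
    have hw : ∀ n, S n ≤ ENNReal.ofReal (8 * D) *
        ENNReal.ofReal (min 1 (min (2 ^ i / 2 ^ n) (2 ^ (j + n) / 2 ^ i))) := fun n => by
      rw [← ENNReal.ofReal_mul (by positivity), mul_min_of_nonneg _ _ (by positivity),
        mul_min_of_nonneg _ _ (by positivity), mul_one]
      refine le_trans (le_min (hS1 n) (le_min (hS2 n) (hS3 n))) ?_
      rw [← ENNReal.ofReal_min, ← ENNReal.ofReal_min]
      refine ENNReal.ofReal_le_ofReal (min_le_min le_rfl (min_le_min ?_ (le_of_eq (by ring))))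
      have : 0 ≤ D * (2 ^ i / 2 ^ n) := by positivity
      calc 2 * 2 ^ i / 2 ^ n * D = 2 * (D * (2 ^ i / 2 ^ n)) := by ring
        _ ≤ 8 * D * (2 ^ i / 2 ^ n) := by linarith
    refine (ENNReal.tsum_le_tsum hw).trans ?_
    rw [ENNReal.tsum_mul_left]
    gcongr
    refine tsum_dyadic_min_le (i := i) (fun n => ?_) (fun n => ?_) fun m n hmn => ?_
    · rw [← ENNReal.ofReal_one]; exact ENNReal.ofReal_le_ofReal (min_le_left _ _)
    · rw [ofReal_inv_two_pow]
      refine ENNReal.ofReal_le_ofReal ((min_le_right _ _).trans ((min_le_left _ _).trans_eq ?_))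
      rw [pow_add]; field_simp
    · rw [ofReal_inv_two_pow, show (2 : ℝ≥0∞) ^ j = ENNReal.ofReal (2 ^ j) by
        rw [ENNReal.ofReal_pow (by norm_num)]; simp, ← ENNReal.ofReal_mul (by positivity)]
      refine ENNReal.ofReal_le_ofReal ((min_le_right _ _).trans ((min_le_right _ _).trans ?_))
      rw [← hmn, mul_one_div, div_le_div_iff₀ (by positivity) (by positivity), ← pow_add, ← pow_add]
      exact pow_le_pow_right₀ (by norm_num) (by omega)
  calc _ ≤ ∑' x, ∑' n, (if ∀ j, |x j| < 2 * 2 ^ i then 0 else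
        ‖latK g (2 ^ n) (μ n) (x - h) - latK g (2 ^ n) (μ n) x‖ₑ) := by
        refine ENNReal.tsum_le_tsum fun x => ?_
        split_ifs
        · simp
        · exact iSup_le fun n => ENNReal.le_tsum n
    _ = ∑' n, S n := ENNReal.tsum_comm
    _ ≤ _ := key
    _ = ENNReal.ofReal (8 * D * (j + 4)) := by
        rw [ENNReal.ofReal_mul (p := 8 * D) (by positivity),
          ENNReal.ofReal_add (Nat.cast_nonneg j) (by norm_num), ENNReal.ofReal_natCast,
          ENNReal.ofReal_ofNat]

end

section

variable {d : ℕ}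

lemma enorm_dconv_le {g K : (Fin d → ℤ) → ℂ} {b D : ℝ} (hb : 0 ≤ b) (hg : ∀ x, ‖g x‖ ≤ b)
    (hK : ∑' x, ‖K x‖ₑ ≤ ENNReal.ofReal D) (x : Fin d → ℤ) :
    ‖dconv g K x‖ₑ ≤ ENNReal.ofReal (b * D) := by
  rw [dconv]
  refine enorm_tsum_le_tsum_enorm.trans ?_
  calc ∑' y, ‖g y * K (x - y)‖ₑ ≤ ∑' y, ENNReal.ofReal b * ‖K (x - y)‖ₑ := by
        refine ENNReal.tsum_le_tsum fun y => ?_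
        rw [enorm_mul]
        gcongr
        rw [← ofReal_norm]
        exact ENNReal.ofReal_le_ofReal (hg y)
    _ = ENNReal.ofReal b * ∑' y, ‖K y‖ₑ := by
        rw [ENNReal.tsum_mul_left]
        congr 1
        exact (Equiv.subLeft x).tsum_eq fun y => ‖K y‖ₑ
    _ ≤ _ := by
        rw [ENNReal.ofReal_mul hb]
        gcongr

lemma maximal_of_sq {p : ℝ} (hd : 0 < d) (hp1 : 1 < p) (hp2 : p ≤ 2) {C₀ C₁ : ℝ} (h0 : 0 ≤ C₀)
    (h1 : 0 ≤ C₁) :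
    ∃ C, 0 ≤ C ∧ ∀ (j : ℕ) (K : ℕ → (Fin d → ℤ) → ℂ), Hormander K (C₁ * (j + 1)) →
      (∀ f : (Fin d → ℤ) → ℂ, f.support.Finite → ∑' x, maxConv K f x ^ 2 ≤
        ENNReal.ofReal (C₀ * (1 / 2) ^ j) * ∑' x, ‖f x‖ₑ ^ 2) →
      ∀ f : (Fin d → ℤ) → ℂ, f.support.Finite → ∑' x, maxConv K f x ^ p ≤
        ENNReal.ofReal (C * (j + 1) * ((2 : ℝ) ^ (1 - p)) ^ j) * ∑' x, ‖f x‖ₑ ^ p := by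
  rcases hp2.eq_or_lt with rfl | hp
  · refine ⟨C₀, h0, fun j K _ hL f hf => ?_⟩
    have hh := hL f hf
    have e2 : ∀ v : ℝ≥0∞, v ^ (2 : ℝ) = v ^ 2 := fun v => by
      rw [← ENNReal.rpow_natCast]; norm_num
    simp only [e2]
    refine hh.trans (mul_le_mul_left (ENNReal.ofReal_le_ofReal ?_) _)
    rw [show (2 : ℝ) ^ (1 - 2 : ℝ) = 1 / 2 by
      rw [show (1 - 2 : ℝ) = -1 by norm_num, Real.rpow_neg_one]; norm_num]
    have : (0 : ℝ) ≤ j := Nat.cast_nonneg j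
    gcongr
    exact le_mul_of_one_le_right h0 (by linarith)
  · have hpp : 0 < p - 1 := by linarith
    have hpq : 0 < 2 - p := by linarith
    set c₁ := 6 * C₀ + 2 ^ (3 * d + 1) + 4 * C₁ with hc₁
    have hc₁0 : 0 ≤ c₁ := by positivity
    refine ⟨p * (2 * c₁ / (p - 1) + 4 * C₀ / (2 - p)), by positivity, fun j K hH hL f hf => ?_⟩
    have hj : (0 : ℝ) ≤ j := Nat.cast_nonneg j
    set a := C₀ * (1 / 2) ^ j with ha
    have ha0 : 0 ≤ a := by positivity
    have ha1 : a ≤ C₀ := mul_le_of_le_one_right h0 (pow_le_one₀ (by norm_num) (by norm_num))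
    have hsmall : ∀ g : (Fin d → ℤ) → ℂ, g.support.Finite → ∀ t : ℝ, 0 < t →
        levelCount (maxConv K g) t ≤ ENNReal.ofReal (a / t ^ 2) * ∑' x, ‖g x‖ₑ ^ 2 := by
      intro g hg t ht
      refine (levelCount_le_sq _ ht).trans ((mul_le_mul_right (hL g hg) _).trans_eq ?_)
      rw [← mul_assoc, ← ENNReal.ofReal_mul (by positivity)]
      congr 2; ring
    have hweak := calderon_zygmund hd ha0 one_pos (by positivity)
      (fun g hg t ht _ => hsmall g hg t ht) hH
    have := interpolate_weak (M := maxConv K) (fun f g hf hg x => maxConv_add K hf hg x)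
      (p := p) (γ := 2 * 2 ^ j) hp1 (Or.inl hp) (by positivity) (by positivity) ha0 hweak
      (fun g hg t ht _ => hsmall g hg t ht) f hf
    refine this.trans (mul_le_mul_left (ENNReal.ofReal_le_ofReal ?_) _)
    set θ := (2 : ℝ) ^ (1 - p) with hθ
    have hθ0 : 0 < θ := by positivity
    have e1 : ((2 : ℝ) * 2 ^ j / 2) ^ (1 - p) = θ ^ j := by
      rw [mul_div_cancel_left₀ _ two_ne_zero, hθ, ← Real.rpow_natCast, ← Real.rpow_natCast,
        ← Real.rpow_mul zero_le_two, ← Real.rpow_mul zero_le_two, mul_comm]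
    have e2 : a * ((2 : ℝ) * 2 ^ j / 2) ^ (2 - p) = C₀ * θ ^ j := by
      rw [show 2 - p = 1 + (1 - p) by ring, Real.rpow_add (by positivity), Real.rpow_one, e1,
        mul_div_cancel_left₀ _ two_ne_zero, ha]
      have : ((1 : ℝ) / 2) ^ j * 2 ^ j = 1 := by rw [← mul_pow]; norm_num
      linear_combination (C₀ * θ ^ j) * this
    rw [mul_assoc 4, e1, e2]
    have hc : 6 * a * 1 + 2 ^ (3 * d + 1) / 1 + 4 * (C₁ * (j + 1)) ≤ c₁ * (j + 1) := by
      have : (0 : ℝ) < 2 ^ (3 * d + 1) := by positivity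
      nlinarith [mul_nonneg h0 hj, mul_nonneg this.le hj]
    calc p * (2 * (6 * a * 1 + 2 ^ (3 * d + 1) / 1 + 4 * (C₁ * (j + 1))) * θ ^ j / (p - 1)
          + 4 * (C₀ * θ ^ j) / (2 - p))
        ≤ p * (2 * (c₁ * (j + 1)) * θ ^ j / (p - 1) + 4 * (C₀ * θ ^ j * (j + 1)) / (2 - p)) := by
          have : C₀ * θ ^ j ≤ C₀ * θ ^ j * (j + 1) :=
            le_mul_of_one_le_right (by positivity) (by linarith)
          gcongr
      _ = _ := by ring

lemma maximal_of_l1 {p : ℝ} (hd : 0 < d) (hp1 : 1 < p) {D B : ℝ} (hD : 0 ≤ D) (hB : 0 ≤ B) :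
    ∃ C, 0 ≤ C ∧ ∀ K : ℕ → (Fin d → ℤ) → ℂ, Hormander K B →
      (∀ k, ∑' x, ‖K k x‖ₑ ≤ ENNReal.ofReal D) →
      ∀ f : (Fin d → ℤ) → ℂ, f.support.Finite → ∑' x, maxConv K f x ^ p ≤
        ENNReal.ofReal C * ∑' x, ‖f x‖ₑ ^ p := by
  set γ := 1 / (D + 1) with hγ
  have hγ0 : 0 < γ := by positivity
  have hpp : 0 < p - 1 := by linarith
  refine ⟨p * (2 * (6 * 0 * γ + 2 ^ (3 * d + 1) / γ + 4 * B) * (γ / 2) ^ (1 - p) / (p - 1) +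
      4 * 0 * (γ / 2) ^ (2 - p) / (2 - p)), ?_, fun K hH hK f hf => ?_⟩
  · simp only [mul_zero, zero_mul, zero_div, zero_add, add_zero]
    positivity
  have hsmall : ∀ g : (Fin d → ℤ) → ℂ, g.support.Finite → ∀ t : ℝ, 0 < t →
      (∀ x, ‖g x‖ ≤ γ * t) → levelCount (maxConv K g) t ≤
        ENNReal.ofReal (0 / t ^ 2) * ∑' x, ‖g x‖ₑ ^ 2 := by
    intro g hg t ht hgt
    rw [zero_div, ENNReal.ofReal_zero, zero_mul, nonpos_iff_eq_zero, levelCount,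
      ENNReal.tsum_eq_zero]
    intro x
    rw [if_neg]
    rw [not_lt]
    refine iSup_le fun k => (enorm_dconv_le (by positivity) hgt (hK k) x).trans
      (ENNReal.ofReal_le_ofReal ?_)
    rw [hγ]
    have : 1 / (D + 1) * t * D = t * (D / (D + 1)) := by ring
    rw [this]
    exact mul_le_of_le_one_right ht.le ((div_le_one (by positivity)).2 (by linarith))
  exact interpolate_weak (M := maxConv K) (fun f g hf hg x => maxConv_add K hf hg x)
      hp1 (Or.inr rfl) hγ0 (by positivity) le_rfl
      (calderon_zygmund hd le_rfl hγ0 hB hsmall hH) hsmall f hf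

end

section

variable {d : ℕ}

lemma setIntegral_ubox_of_support {g : (Fin d → ℝ) → ℂ}
    (hg : ∀ ξ, ξ ∉ Set.Icc (fun _ => -(1 / 2 : ℝ)) (fun _ => (1 / 2 : ℝ)) → g ξ = 0) :
    ∫ ξ in ubox (fun _ => -(1 / 2)), g ξ = ∫ ξ, g ξ := by
  refine Eq.trans ?_ (setIntegral_eq_integral_of_forall_compl_eq_zero hg)
  have hbox : ubox (d := d) (fun _ => -(1 / 2))
      = Set.univ.pi fun _ => Set.Ioc (-(1 / 2 : ℝ)) (1 / 2) := by
    ext x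
    rw [Set.mem_univ_pi, ubox, Set.mem_ofPred_eq, show -(1 / 2 : ℝ) + 1 = 1 / 2 by norm_num]
  rw [hbox]
  have := Measure.univ_pi_Ioc_ae_eq_Icc (μ := fun _ : Fin d => (volume : Measure ℝ))
    (f := fun _ => -(1 / 2 : ℝ)) (g := fun _ => (1 / 2 : ℝ))
  rw [← volume_pi] at this
  exact setIntegral_congr_set this

lemma latK_eq_boxCoeff {μ : Measure (EuclideanSpace ℝ (Fin d))} [IsFiniteMeasure μ]
    {Ψ : (Fin d → ℝ) → ℝ} (hΨ : Continuous Ψ) {c : ℝ}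
    (hsupp : ∀ x, x ∉ Set.Icc (fun _ => -c) (fun _ => c) → Ψ x = 0) {s : ℝ} (hs : 0 < s)
    (hcs : 2 * c ≤ s) :
    latK (invFT Ψ) s μ
      = boxCoeff (fun _ => -(1 / 2)) (fun ξ => (Ψ (s • ξ) : ℂ) * measFT μ ξ) := by
  funext x
  rw [latK, ← scaleK_eq_avgK hΨ (HasCompactSupport.intro isCompact_Icc hsupp) hs, scaleK, boxCoeff,
    setIntegral_ubox_of_support]
  intro ξ hξ
  have : Ψ (s • ξ) = 0 := hsupp _ fun h => hξ ⟨fun i => ?_, fun i => ?_⟩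
  · rw [this]; simp
  · have := h.1 i
    simp only [Pi.smul_apply, smul_eq_mul] at this
    by_contra hlt
    push Not at hlt
    nlinarith
  · have := h.2 i
    simp only [Pi.smul_apply, smul_eq_mul] at this
    by_contra hlt
    push Not at hlt
    nlinarith

lemma exists_bound_of_support {Ψ : (Fin d → ℝ) → ℝ} (hΨ : Continuous Ψ) {c : ℝ}
    (hsupp : ∀ x, x ∉ Set.Icc (fun _ => -c) (fun _ => c) → Ψ x = 0) :
    ∃ P, 0 ≤ P ∧ ∀ x, |Ψ x| ≤ P := by
  obtain ⟨P, hP⟩ := (HasCompactSupport.intro isCompact_Icc hsupp).exists_bound_of_continuous hΨ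
  exact ⟨P, (norm_nonneg _).trans (hP 0), hP⟩

lemma tsum_le_of_pair {w : ℕ → ℝ≥0∞} {b : ℝ≥0∞} (hb : ∀ n, w n ≤ b)
    (h : ∀ m n, w m ≠ 0 → w n ≠ 0 → n < m + 2) : ∑' n, w n ≤ 2 * b := by
  classical
  by_cases hw : ∃ n, w n ≠ 0
  · set m := Nat.find hw
    have hm : w m ≠ 0 := Nat.find_spec hw
    rw [tsum_eq_sum (s := {m, m + 1}) fun n hn => ?_]
    · rw [Finset.sum_pair (by omega), two_mul]
      exact add_le_add (hb _) (hb _)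
    · by_contra hn0
      have h1 : m ≤ n := Nat.find_min' hw hn0
      have h2 := h m n hm hn0
      simp only [Finset.mem_insert, Finset.mem_singleton] at hn
      omega
  · push Not at hw
    simp [hw]

lemma mem_Icc_of_abs_le {c : ℝ} {v : Fin d → ℝ} (h : ∀ i, |v i| ≤ c) :
    v ∈ Set.Icc (fun _ => -c) (fun _ => c) :=
  ⟨fun i => (abs_le.1 (h i)).1, fun i => (abs_le.1 (h i)).2⟩

/-- The dyadic differences of the dilates of `Ψ` have a square function controlled by the decay of
the Fourier transform. -/
lemma tsum_diff_sq_le {ν : Measure (EuclideanSpace ℝ (Fin d))} {Ψ : (Fin d → ℝ) → ℝ}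
    (hΨ : IsBump d Ψ) {P C : ℝ} (hP : ∀ x, |Ψ x| ≤ P) 
    (hdec : ∀ (ξ : Fin d → ℝ) (j : Fin d), |ξ j| * ‖measFT ν ξ‖ ^ 2 ≤ C)
    (j : ℕ) {t : ℕ → ℝ} (ht : ∀ n, 2 ^ (j + n) ≤ t n) (ξ : Fin d → ℝ) :
    ∑' n : ℕ, ‖((Ψ ((2 : ℝ) ^ n • ξ) : ℂ) - (Ψ ((2 : ℝ) ^ (n + 1) • ξ) : ℂ)) *
      measFT ν (t n • ξ)‖ₑ ^ 2 ≤ ENNReal.ofReal (128 * P ^ 2 * C * (1 / 2) ^ j) := by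
  obtain ⟨_, hsupp, hone⟩ := hΨ
  have key : ∀ n : ℕ, Ψ ((2 : ℝ) ^ n • ξ) - Ψ ((2 : ℝ) ^ (n + 1) • ξ) ≠ 0 →
      (∃ i, 1 / 16 < 2 ^ n * |ξ i|) ∧ ∀ i, 2 ^ n * |ξ i| ≤ 1 / 4 := by
    intro n hn
    have hp : (0 : ℝ) < 2 ^ n := by positivity
    have habs : ∀ (m : ℕ) i, |((2 : ℝ) ^ m • ξ) i| = 2 ^ m * |ξ i| := fun m i => by
      rw [Pi.smul_apply, smul_eq_mul, abs_mul, abs_of_pos (by positivity)]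
    constructor
    · by_contra! hcon
      refine hn ?_
      rw [hone _ (mem_Icc_of_abs_le (fun i => ?_)), hone _ (mem_Icc_of_abs_le (fun i => ?_)), sub_self]
      · rw [habs, pow_succ]; linarith [hcon i]
      · rw [habs]; linarith [hcon i, abs_nonneg (ξ i)]
    · by_contra! hcon
      obtain ⟨i, hi⟩ := hcon
      refine hn ?_
      rw [hsupp _ fun h => ?_, hsupp _ fun h => ?_, sub_self]
      · have : |((2 : ℝ) ^ (n + 1) • ξ) i| ≤ 1 / 4 := abs_le.2 ⟨h.1 i, h.2 i⟩
        rw [habs, pow_succ] at this; linarith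
      · have : |((2 : ℝ) ^ n • ξ) i| ≤ 1 / 4 := abs_le.2 ⟨h.1 i, h.2 i⟩
        rw [habs] at this; linarith
  refine (tsum_le_of_pair (b := ENNReal.ofReal (64 * P ^ 2 * C * (1 / 2) ^ j)) (fun n => ?_)
    fun m n hm hn => ?_).trans_eq ?_
  · by_cases hn : Ψ ((2 : ℝ) ^ n • ξ) - Ψ ((2 : ℝ) ^ (n + 1) • ξ) = 0
    · rw [← Complex.ofReal_sub, hn]; simp
    · obtain ⟨⟨i, hi⟩, -⟩ := key n hn
      rw [← ofReal_norm, ← ENNReal.ofReal_pow (norm_nonneg _), norm_mul, mul_pow,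
        ← Complex.ofReal_sub, Complex.norm_real, Real.norm_eq_abs]
      refine ENNReal.ofReal_le_ofReal ?_
      have hd1 := hdec (t n • ξ) i
      have htn : 0 < t n := lt_of_lt_of_le (by positivity) (ht n)
      rw [Pi.smul_apply, smul_eq_mul, abs_mul, abs_of_pos htn] at hd1
      have hlow : 2 ^ j / 16 ≤ t n * |ξ i| := by
        calc (2 : ℝ) ^ j / 16 = 2 ^ j * (1 / 16) := by ring
          _ ≤ 2 ^ j * (2 ^ n * |ξ i|) := by gcongr
          _ = 2 ^ (j + n) * |ξ i| := by rw [pow_add]; ring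
          _ ≤ _ := by gcongr; exact ht n
      have hm : ‖measFT ν (t n • ξ)‖ ^ 2 ≤ 16 * C * (1 / 2) ^ j := by
        have h1 : 2 ^ j / 16 * ‖measFT ν (t n • ξ)‖ ^ 2 ≤ C :=
          (mul_le_mul_of_nonneg_right hlow (by positivity)).trans hd1
        have h2 : ((1 : ℝ) / 2) ^ j * 2 ^ j = 1 := by rw [← mul_pow]; norm_num
        calc ‖measFT ν (t n • ξ)‖ ^ 2
            = 16 * (1 / 2) ^ j * (2 ^ j / 16 * ‖measFT ν (t n • ξ)‖ ^ 2) := by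
              linear_combination (-‖measFT ν (t n • ξ)‖ ^ 2) * h2
          _ ≤ 16 * (1 / 2) ^ j * C := by gcongr
          _ = _ := by ring
      have hP2 : |Ψ ((2 : ℝ) ^ n • ξ) - Ψ ((2 : ℝ) ^ (n + 1) • ξ)| ^ 2 ≤ (2 * P) ^ 2 := by
        refine pow_le_pow_left₀ (abs_nonneg _) ?_ 2
        refine (abs_sub _ _).trans ?_
        linarith [hP ((2 : ℝ) ^ n • ξ), hP ((2 : ℝ) ^ (n + 1) • ξ)]
      calc _ ≤ (2 * P) ^ 2 * (16 * C * (1 / 2) ^ j) := by gcongr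
        _ = _ := by ring
  · have nz : ∀ n, ‖((Ψ ((2 : ℝ) ^ n • ξ) : ℂ) - (Ψ ((2 : ℝ) ^ (n + 1) • ξ) : ℂ)) *
        measFT ν (t n • ξ)‖ₑ ^ 2 ≠ 0 →
        Ψ ((2 : ℝ) ^ n • ξ) - Ψ ((2 : ℝ) ^ (n + 1) • ξ) ≠ 0 := fun n h0 h1 => by
      rw [← Complex.ofReal_sub, h1] at h0; simp at h0
    obtain ⟨⟨i, hi⟩, -⟩ := key m (nz m hm)
    obtain ⟨-, hle⟩ := key n (nz n hn)
    by_contra hlt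
    push Not at hlt
    have h1 : (2 : ℝ) ^ (m + 2) ≤ 2 ^ n := pow_le_pow_right₀ (by norm_num) hlt
    have h2 := mul_le_mul_of_nonneg_right h1 (abs_nonneg (ξ i))
    rw [pow_add] at h2
    linarith [hle i]
  · rw [show (2 : ℝ≥0∞) = ENNReal.ofReal 2 by simp, ← ENNReal.ofReal_mul (by norm_num)]
    congr 1; ring

lemma rpow_tsum_le {p : ℝ} (hp1 : 1 ≤ p) (hp2 : p ≤ 2) (a : ℕ → ℝ≥0∞) :
    (∑' j, a j) ^ p ≤ ∑' j : ℕ, ((j + 1) * (j + 2) : ℝ≥0∞) * a j ^ p := by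
  have hp0 : 0 < p := by linarith
  rw [← ENNReal.le_rpow_inv_iff hp0, ENNReal.tsum_eq_iSup_nat]
  refine iSup_le fun n => ?_
  rw [ENNReal.le_rpow_inv_iff hp0]
  refine le_trans ?_ (ENNReal.sum_le_tsum (Finset.range n))
  set v : ℕ → ℝ≥0∞ := fun j => (j + 1) * (j + 2) with hv
  have hv0 : ∀ j, v j ≠ 0 := fun j => by simp [hv]
  have hvt : ∀ j, v j ≠ ⊤ := fun j => by
    rw [hv]; exact ENNReal.mul_ne_top (by simp) (by simp)
  have hv1 : ∀ j, 1 ≤ v j := fun j => by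
    have : (1 : ℝ≥0∞) ≤ (((j + 1) * (j + 2) : ℕ) : ℝ≥0∞) := by
      exact_mod_cast Nat.one_le_iff_ne_zero.2 (by positivity)
    show (1 : ℝ≥0∞) ≤ (j + 1) * (j + 2)
    exact_mod_cast this
  have hsum : ∑ j ∈ Finset.range n, (v j)⁻¹ ≤ 1 := by
    have h1 : ∀ n : ℕ, ∑ j ∈ Finset.range n, (1 : ℝ) / ((j + 1) * (j + 2)) = 1 - 1 / (n + 1) := by
      intro n
      induction n with
      | zero => simp
      | succ k ih => rw [Finset.sum_range_succ, ih]; push_cast; field_simp; ring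
    have h2 : ∀ j : ℕ, (v j)⁻¹ = ENNReal.ofReal (1 / ((j + 1) * (j + 2))) := fun j => by
      rw [one_div, ENNReal.ofReal_inv_of_pos (by positivity), hv,
        ENNReal.ofReal_mul (by positivity), ENNReal.ofReal_add (by positivity) (by norm_num),
        ENNReal.ofReal_add (by positivity) (by norm_num)]
      simp
    simp only [h2]
    rw [← ENNReal.ofReal_sum_of_nonneg fun j _ => by positivity, h1, ← ENNReal.ofReal_one]
    refine ENNReal.ofReal_le_ofReal ?_
    have : (0 : ℝ) ≤ 1 / (n + 1) := by positivity
    linarith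
  have := ENNReal.inner_le_weight_mul_Lp_of_nonneg (Finset.range n) hp1 (fun j => (v j)⁻¹)
    (fun j => v j * a j)
  have e1 : ∀ j, (v j)⁻¹ * (v j * a j) = a j := fun j => by
    rw [← mul_assoc, ENNReal.inv_mul_cancel (hv0 j) (hvt j), one_mul]
  simp only [e1] at this
  have h3 : ∑ j ∈ Finset.range n, a j
      ≤ (∑ j ∈ Finset.range n, (v j)⁻¹ * (v j * a j) ^ p) ^ p⁻¹ := by
    refine this.trans (mul_le_of_le_one_left' ?_)
    refine ENNReal.rpow_le_one hsum ?_
    rw [sub_nonneg]; exact inv_le_one_of_one_le₀ hp1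
  rw [ENNReal.le_rpow_inv_iff hp0] at h3
  refine h3.trans (Finset.sum_le_sum fun j _ => ?_)
  rw [ENNReal.mul_rpow_of_nonneg _ _ hp0.le, ← mul_assoc]
  refine mul_le_mul_left ?_ _
  calc (v j)⁻¹ * v j ^ p ≤ (v j)⁻¹ * v j ^ (2 : ℝ) := by
        gcongr; exact hv1 j
    _ = v j := by
        rw [show (2 : ℝ) = ((2 : ℕ) : ℝ) by norm_num, ENNReal.rpow_natCast, pow_two, ← mul_assoc,
          ENNReal.inv_mul_cancel (hv0 j) (hvt j), one_mul]

end

section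

variable {d : ℕ} {ν : Measure (EuclideanSpace ℝ (Fin d))} {Ψ : (Fin d → ℝ) → ℝ}

lemma dconv_sub_right {f : (Fin d → ℤ) → ℂ} (hf : f.support.Finite) (K K' : (Fin d → ℤ) → ℂ)
    (x : Fin d → ℤ) : dconv f (fun y => K y - K' y) x = dconv f K x - dconv f K' x := by
  unfold dconv
  rw [← (summable_mul_of_support_finite hf _).tsum_sub (summable_mul_of_support_finite hf _)]
  simp [mul_sub]

theorem maximal_sequence (hd : 3 ≤ d) (hν : IsSpherical ν) (hΨ : IsBump d Ψ) {p : ℝ} (hp1 : 1 < p)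
    (hp2 : p ≤ 2) : ∃ C, 0 ≤ C ∧ ∀ t : ℕ → ℝ, (∀ n, 2 ^ n ≤ t n ∧ t n ≤ 2 ^ (n + 1)) →
      ∀ f : (Fin d → ℤ) → ℂ, f.support.Finite →
        ∑' x, maxConv (fun n => latK (invFT Ψ) 1 (ν.map fun y => t n • y)) f x ^ p
          ≤ ENNReal.ofReal C * ∑' x, ‖f x‖ₑ ^ p := by
  have hd0 : 0 < d := by omega
  have hfin := hν.finite
  obtain ⟨A, hA, hg⟩ := exists_niceKernel_invFT hΨ.1 hΨ.2.1
  obtain ⟨P, hP0, hP⟩ := exists_bound_of_support hΨ.1.continuous hΨ.2.1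
  obtain ⟨Cd, hCd, hdec⟩ := hν.exists_decay hd
  set w := ν.real Set.univ with hw
  have hw0 : 0 ≤ w := measureReal_nonneg
  have hwν : ν Set.univ ≤ ENNReal.ofReal w := by
    rw [hw, Measure.real, ENNReal.ofReal_toReal (measure_ne_top _ _)]
  have hpi := Real.pi_pos
  set D := A * (3 * Real.pi) ^ d * w with hD
  have hD0 : 0 ≤ D := by positivity
  obtain ⟨C₁, hC₁, hbase⟩ := maximal_of_l1 hd0 hp1 hD0 (B := 8 * D * ((0 : ℕ) + 4)) (by positivity)
  obtain ⟨C₂, hC₂, hpiece⟩ := maximal_of_sq (C₀ := 128 * P ^ 2 * Cd) (C₁ := 80 * D) hd0 hp1 hp2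
    (by positivity) (by positivity)
  set θ := (2 : ℝ) ^ (1 - p) with hθ
  have hθ0 : 0 < θ := by positivity
  have hθ1 : θ < 1 := Real.rpow_lt_one_of_one_lt_of_neg (by norm_num) (by linarith)
  have hsumm : Summable fun j : ℕ => ((j + 2) * (j + 3) * (C₂ * (j + 1) * θ ^ j) : ℝ) := by
    have h := fun k => summable_pow_mul_geometric_of_norm_lt_one (R := ℝ) k (r := θ)
      (by rwa [Real.norm_of_nonneg hθ0.le])
    have := ((((h 3).add ((h 2).mul_left 6)).add ((h 1).mul_left 11)).add ((h 0).mul_left 6)).mul_left C₂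
    refine this.congr fun j => ?_
    ring
  set Q := ∑' j : ℕ, ((j + 2) * (j + 3) * (C₂ * (j + 1) * θ ^ j) : ℝ) with hQ
  have hQ0 : 0 ≤ Q := tsum_nonneg fun j => by positivity
  refine ⟨2 * C₁ + Q, by positivity, fun t ht f hf => ?_⟩
  have ht0 : ∀ n, 0 ≤ t n := fun n => (by positivity : (0 : ℝ) ≤ 2 ^ n).trans (ht n).1
  have one_le : ∀ n : ℕ, (1 : ℝ) ≤ 2 ^ n := fun n => one_le_pow₀ (by norm_num)
  set μ : ℕ → Measure (EuclideanSpace ℝ (Fin d)) := fun n => ν.map fun y => t n • y with hμ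
  have hμf : ∀ n, IsFiniteMeasure (μ n) := fun n => by rw [hμ]; infer_instance
  have hμw : ∀ n, μ n Set.univ ≤ ENNReal.ofReal w := fun n => (map_smul_univ (t n)).trans_le hwν
  have hμs : ∀ n, ∀ᵐ y ∂(μ n), ∀ i, |y i| ≤ 2 ^ (n + 1) := fun n => by
    filter_upwards [hν.ae_map_smul (ht0 n)] with y hy i
    exact (hy i).trans (ht n).2
  set M : ℕ → (Fin d → ℤ) → ℝ≥0∞ := fun j => maxConv (fun m x =>
    latK (invFT Ψ) (2 ^ m) (μ (j + 1 + m)) x - latK (invFT Ψ) (2 ^ (m + 1)) (μ (j + 1 + m)) x) f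
    with hM
  set M₀ : (Fin d → ℤ) → ℝ≥0∞ := maxConv (fun n => latK (invFT Ψ) (2 ^ n) (μ n)) f with hM₀
  have hM₀b : ∑' x, M₀ x ^ p ≤ ENNReal.ofReal C₁ * ∑' x, ‖f x‖ₑ ^ p := by
    refine hbase _ (hg.hormander_latK hA hμf hw0 hμw fun n => by simpa using hμs n) (fun n => ?_) f hf
    refine (hg.tsum_avgK_le hA (one_le n)).trans ((mul_le_mul_right (hμw n) _).trans_eq ?_)
    rw [← ENNReal.ofReal_mul (by positivity)]
  have hMb : ∀ j, ∑' x, M j x ^ p ≤ ENNReal.ofReal (C₂ * (j + 1) * θ ^ j) * ∑' x, ‖f x‖ₑ ^ p := by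
    intro j
    have hj : (0 : ℝ) ≤ j := Nat.cast_nonneg j
    refine hpiece j _ ?_ (fun f hf => ?_) f hf
    · have h1 := hg.hormander_latK hA (j := j + 1) (μ := fun m => μ (j + 1 + m)) (fun n => hμf _)
        hw0 (fun n => hμw _) fun n => hμs _
      have h2 := (hg.hormander_latK hA (j := j)
        (μ := fun m => Nat.casesOn m 0 fun m => μ (j + 1 + m))
        (fun n => by
          cases n with
          | zero => exact inferInstanceAs (IsFiniteMeasure (0 : Measure _))
          | succ m => exact hμf _) hw0
        (fun n => by
          cases n with
          | zero => simp
          | succ m => exact hμw _)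
        (fun n => by
          cases n with
          | zero => simp
          | succ m =>
            have := hμs (j + 1 + m)
            rwa [show j + 1 + m + 1 = j + (m + 1) + 1 by ring] at this)).comp Nat.succ
      have h3 := h1.sub h2 (by positivity) (by positivity)
      intro i h hh
      refine (h3 i h hh).trans (ENNReal.ofReal_le_ofReal ?_)
      push_cast
      nlinarith [mul_nonneg hD0 hj]
    · have hrep : (fun (m : ℕ) x => latK (invFT Ψ) (2 ^ m) (μ (j + 1 + m)) x
          - latK (invFT Ψ) (2 ^ (m + 1)) (μ (j + 1 + m)) x)
          = fun m : ℕ => boxCoeff (fun _ => -(1 / 2))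
            (fun ξ => ((Ψ ((2 : ℝ) ^ m • ξ) : ℂ) - (Ψ ((2 : ℝ) ^ (m + 1) • ξ) : ℂ)) *
              measFT ν (t (j + 1 + m) • ξ)) := by
        funext m x
        have hbd : ∀ (s : ℝ) ξ, ‖(Ψ (s • ξ) : ℂ) * measFT (μ (j + 1 + m)) ξ‖
            ≤ P * (μ (j + 1 + m)).real Set.univ := fun s ξ => by
          rw [norm_mul, Complex.norm_real]
          exact mul_le_mul (hP _) (norm_measFT_le _ _) (norm_nonneg _) hP0
        have hms : ∀ s : ℝ, Measurable fun ξ => (Ψ (s • ξ) : ℂ) * measFT (μ (j + 1 + m)) ξ :=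
          fun s => by
            have := hΨ.1.continuous
            have h2 : Continuous (measFT (μ (j + 1 + m))) := continuous_measFT
            exact Continuous.measurable (by fun_prop)
        rw [latK_eq_boxCoeff hΨ.1.continuous hΨ.2.1 (by positivity) (by linarith [one_le m]),
          latK_eq_boxCoeff hΨ.1.continuous hΨ.2.1 (by positivity) (by linarith [one_le (m + 1)]),
          boxCoeff, boxCoeff, ← integral_sub (integrable_boxCoeff _ (hms _) (hbd _) x)
            (integrable_boxCoeff _ (hms _) (hbd _) x), boxCoeff]
        refine integral_congr_ae (Filter.Eventually.of_forall fun ξ => ?_)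
        simp only [hμ, measFT_map_smul]
        ring
      rw [hrep]
      refine tsum_maxConv_boxCoeff_sq_le _ (fun m => ?_) (M := 2 * P * w) (fun m ξ => ?_)
        (fun ξ => tsum_diff_sq_le hΨ hP hdec j (t := fun m => t (j + 1 + m)) (fun n => ?_) ξ) hf
      · have := hΨ.1.continuous
        have h2 : Continuous (measFT ν) := continuous_measFT
        exact Continuous.measurable (by fun_prop)
      · rw [norm_mul]
        refine mul_le_mul ((norm_sub_le _ _).trans ?_) (norm_measFT_le _ _) (norm_nonneg _)
          (by positivity)
        rw [Complex.norm_real, Complex.norm_real, two_mul]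
        exact add_le_add (hP _) (hP _)
      · exact (pow_le_pow_right₀ (by norm_num) (by omega)).trans (ht _).1
  set N : ℕ → (Fin d → ℤ) → ℝ≥0∞ := fun j => Nat.casesOn j M₀ M with hN
  have hpt : ∀ x, maxConv (fun n => latK (invFT Ψ) 1 (μ n)) f x ≤ ∑' j, N j x := by
    intro x
    refine iSup_le fun n => ?_
    have hdc : dconv f (latK (invFT Ψ) 1 (μ n)) x = dconv f (latK (invFT Ψ) (2 ^ n) (μ n)) x
        + ∑ m ∈ Finset.range n, dconv f (fun x => latK (invFT Ψ) (2 ^ m) (μ n) x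
        - latK (invFT Ψ) (2 ^ (m + 1)) (μ n) x) x := by
      simp only [dconv_sub_right hf]
      rw [Finset.sum_range_sub' fun m => dconv f (latK (invFT Ψ) (2 ^ m) (μ n)) x, pow_zero]
      ring
    rw [hdc]
    refine (enorm_add_le _ _).trans ?_
    have hsplit : ∑' j, N j x = M₀ x + ∑' j, M j x := by
      exact tsum_eq_zero_add' ENNReal.summable
    rw [hsplit]
    refine add_le_add (le_iSup (fun n => ‖dconv f (latK (invFT Ψ) (2 ^ n) (μ n)) x‖ₑ) n) ?_
    refine (enorm_sum_le _ _).trans ?_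
    rw [← Finset.sum_range_reflect]
    refine le_trans (Finset.sum_le_sum fun j hj => ?_) (ENNReal.sum_le_tsum (Finset.range n))
    have hj' := Finset.mem_range.1 hj
    have e : n = j + 1 + (n - 1 - j) := by omega
    have := le_iSup (fun m => ‖dconv f (fun x => latK (invFT Ψ) (2 ^ m) (μ (j + 1 + m)) x
        - latK (invFT Ψ) (2 ^ (m + 1)) (μ (j + 1 + m)) x) x‖ₑ) (n - 1 - j)
    beta_reduce at this
    rw [← e] at this
    exact this
  calc ∑' x, maxConv (fun n => latK (invFT Ψ) 1 (μ n)) f x ^ p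
      ≤ ∑' x, ∑' j : ℕ, ((j + 1) * (j + 2) : ℝ≥0∞) * N j x ^ p :=
        ENNReal.tsum_le_tsum fun x => (ENNReal.rpow_le_rpow (hpt x) (by linarith)).trans
          (rpow_tsum_le hp1.le hp2 _)
    _ = ∑' j : ℕ, ((j + 1) * (j + 2) : ℝ≥0∞) * ∑' x, N j x ^ p := by
        rw [ENNReal.tsum_comm]
        exact tsum_congr fun j => ENNReal.tsum_mul_left
    _ = 2 * ∑' x, M₀ x ^ p + ∑' j : ℕ, ((j + 2) * (j + 3) : ℝ≥0∞) * ∑' x, M j x ^ p := by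
        rw [tsum_eq_zero_add' ENNReal.summable]
        congr 1
        · simp [hN]
        · refine tsum_congr fun j => ?_
          simp only [hN]
          push_cast
          rw [add_assoc, add_assoc]
          norm_num
    _ ≤ 2 * (ENNReal.ofReal C₁ * ∑' x, ‖f x‖ₑ ^ p) + ∑' j : ℕ, ((j + 2) * (j + 3) : ℝ≥0∞) *
          (ENNReal.ofReal (C₂ * (j + 1) * θ ^ j) * ∑' x, ‖f x‖ₑ ^ p) := by
        gcongr with j
        exact hMb j
    _ = ENNReal.ofReal (2 * C₁ + Q) * ∑' x, ‖f x‖ₑ ^ p := by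
        rw [ENNReal.ofReal_add (by positivity) hQ0, ENNReal.ofReal_mul zero_le_two, hQ,
          ENNReal.ofReal_tsum_of_nonneg (fun j => by positivity) hsumm, add_mul,
          ← ENNReal.tsum_mul_right, ENNReal.ofReal_ofNat, mul_assoc]
        congr 1
        refine tsum_congr fun j => ?_
        rw [ENNReal.ofReal_mul (p := (j + 2) * (j + 3)) (by positivity),
          ENNReal.ofReal_mul (p := j + 2) (by positivity),
          ENNReal.ofReal_add (Nat.cast_nonneg j) (by norm_num),
          ENNReal.ofReal_add (Nat.cast_nonneg j) (by norm_num), ENNReal.ofReal_natCast,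
          ENNReal.ofReal_ofNat, ENNReal.ofReal_ofNat]
        ring

end

section

variable {d : ℕ} {ν : Measure (EuclideanSpace ℝ (Fin d))} {Ψ : (Fin d → ℝ) → ℝ}

lemma iSup_rpow_le {ι : Sort*} {a : ι → ℝ≥0∞} {p : ℝ} (hp : 0 < p) {B : ℝ≥0∞}
    (h : ∀ i, a i ^ p ≤ B) : (⨆ i, a i) ^ p ≤ B := by
  rw [← ENNReal.le_rpow_inv_iff hp]
  exact iSup_le fun i => (ENNReal.le_rpow_inv_iff hp).2 (h i)

lemma tsum_mul_rpow_le {ι : Type*} {p : ℝ} (hp : 1 ≤ p) (F w : ι → ℝ≥0∞) :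
    (∑' i, w i * F i) ^ p ≤ (∑' i, w i) ^ (p - 1) * ∑' i, w i * F i ^ p := by
  have hp0 : 0 < p := by linarith
  rw [ENNReal.tsum_eq_iSup_sum]
  refine iSup_rpow_le hp0 fun s => ?_
  refine (ENNReal.rpow_le_rpow (ENNReal.inner_le_weight_mul_Lp_of_nonneg s hp w F) hp0.le).trans ?_
  rw [ENNReal.mul_rpow_of_nonneg _ _ hp0.le, ← ENNReal.rpow_mul, ← ENNReal.rpow_mul,
    inv_mul_cancel₀ hp0.ne', ENNReal.rpow_one, sub_mul, inv_mul_cancel₀ hp0.ne', one_mul]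
  exact mul_le_mul' (ENNReal.rpow_le_rpow (ENNReal.sum_le_tsum s) (by linarith))
    (ENNReal.sum_le_tsum s)

/-- Young's convolution inequality `ℓ^p * ℓ^1 ⊆ ℓ^p`. -/
lemma tsum_conv_rpow_le {p : ℝ} (hp : 1 ≤ p) (F w : (Fin d → ℤ) → ℝ≥0∞) :
    ∑' x, (∑' y, F y * w (x - y)) ^ p ≤ (∑' x, w x) ^ p * ∑' x, F x ^ p := by
  have hrefl : ∀ x, ∑' y, w (x - y) = ∑' y, w y := fun x => (Equiv.subLeft x).tsum_eq w
  calc ∑' x, (∑' y, F y * w (x - y)) ^ p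
      ≤ ∑' x, (∑' y, w y) ^ (p - 1) * ∑' y, w (x - y) * F y ^ p := by
        refine ENNReal.tsum_le_tsum fun x => ?_
        simp_rw [mul_comm (F _)]
        rw [← hrefl x]
        exact tsum_mul_rpow_le hp F fun y => w (x - y)
    _ = (∑' y, w y) ^ (p - 1) * ((∑' y, w y) * ∑' y, F y ^ p) := by
        rw [ENNReal.tsum_mul_left, ENNReal.tsum_comm]
        simp_rw [ENNReal.tsum_mul_right, tsum_comp_sub_right]
        rw [ENNReal.tsum_mul_left]
    _ = _ := by
        rw [← mul_assoc]
        congr 1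
        rcases eq_or_ne (∑' y, w y) 0 with h | h
        · rw [h, mul_zero, ENNReal.zero_rpow_of_pos (by linarith)]
        rcases eq_or_ne (∑' y, w y) ⊤ with h' | h'
        · rcases hp.eq_or_lt with rfl | hp
          · simp
          · rw [h', ENNReal.top_rpow_of_pos (by linarith), ENNReal.top_rpow_of_pos (by linarith),
              ENNReal.top_mul_top]
        · nth_rw 2 [← ENNReal.rpow_one (∑' y, w y)]
          rw [← ENNReal.rpow_add _ _ h h', sub_add_cancel]

lemma exists_dyadic_family {c : ℝ} (hc : 1 < c) {T : Set ℝ} (hT : ∀ s ∈ T, ∀ t ∈ T, s < t → c * s ≤ t)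
    {L : ℕ} (hL : 2 ≤ c ^ L) :
    ∃ t : Fin (L + 1) → ℕ → ℝ, (∀ l n, 2 ^ n ≤ t l n ∧ t l n ≤ 2 ^ (n + 1)) ∧
      ∀ s ∈ T, 1 ≤ s → ∃ l n, t l n = s := by
  have h2 : ∀ s : ℝ, ∃ n : ℕ, 1 ≤ s → 2 ^ n ≤ s ∧ s < 2 ^ (n + 1) := fun s => by
    by_cases h : 1 ≤ s
    · obtain ⟨n, hn⟩ := exists_nat_pow_near h one_lt_two
      exact ⟨n, fun _ => hn⟩
    · exact ⟨0, fun h' => absurd h' h⟩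
  have hcc : ∀ s : ℝ, ∃ n : ℕ, 1 ≤ s → c ^ n ≤ s ∧ s < c ^ (n + 1) := fun s => by
    by_cases h : 1 ≤ s
    · obtain ⟨n, hn⟩ := exists_nat_pow_near h hc
      exact ⟨n, fun _ => hn⟩
    · exact ⟨0, fun h' => absurd h' h⟩
  choose a ha using h2
  choose b hb using hcc
  have hinj : ∀ s ∈ T, ∀ t ∈ T, 1 ≤ s → s < t → a s = a t → b s % (L + 1) = b t % (L + 1) → False := by
    intro s hs t ht h1 hst haa hbb
    have h1t : 1 ≤ t := h1.trans hst.le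
    have hlt : b s < b t := by
      have h3 : c ^ (b s + 1) ≤ t := by
        rw [pow_succ']
        exact (mul_le_mul_of_nonneg_left (hb s h1).1 (by linarith)).trans (hT s hs t ht hst)
      have h4 := (pow_lt_pow_iff_right₀ hc).1 (h3.trans_lt (hb t h1t).2)
      omega
    have hge : b s + (L + 1) ≤ b t := by
      have h5 : (L + 1) ∣ b t - b s := (Nat.modEq_iff_dvd' hlt.le).1 hbb
      have := Nat.le_of_dvd (by omega) h5
      omega
    have h6 : c ^ (b s + 1 + L) ≤ t :=
      (pow_le_pow_right₀ hc.le (by omega)).trans (hb t h1t).1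
    have h7 := (ha s h1).1
    have h8 := (ha t h1t).2
    have h9 := (hb s h1).2
    rw [← haa, pow_succ] at h8
    rw [pow_add] at h6
    nlinarith
  classical
  refine ⟨fun l n => if h : ∃ s ∈ T, 1 ≤ s ∧ a s = n ∧ b s % (L + 1) = l then h.choose else 2 ^ n,
    fun l n => ?_, fun s hs h1 => ⟨⟨b s % (L + 1), Nat.mod_lt _ (by omega)⟩, a s, ?_⟩⟩
  · beta_reduce
    split_ifs with h
    · obtain ⟨-, h1, han, -⟩ := h.choose_spec
      have := ha _ h1
      rw [han] at this
      exact ⟨this.1, this.2.le⟩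
    · exact ⟨le_rfl, pow_le_pow_right₀ one_le_two (by omega)⟩
  · have h : ∃ s' ∈ T, 1 ≤ s' ∧ a s' = a s ∧ b s' % (L + 1) = b s % (L + 1) := ⟨s, hs, h1, rfl, rfl⟩
    beta_reduce
    rw [dif_pos h]
    obtain ⟨hm, h1', han, hbn⟩ := h.choose_spec
    rcases lt_trichotomy h.choose s with hlt | heq | hlt
    · exact (hinj _ hm _ hs h1' hlt han hbn).elim
    · exact heq
    · exact (hinj _ hs _ hm h1 hlt han.symm hbn.symm).elim

lemma norm_latK_le_weight (hν : IsSpherical ν) {g : (Fin d → ℝ) → ℂ} {A : ℝ} (hg : NiceKernel g A)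
    (hA : 0 ≤ A) {t : ℝ} (ht0 : 0 ≤ t) (ht1 : t ≤ 1) (x : Fin d → ℤ) :
    ‖latK g 1 (ν.map fun y => t • y) x‖ ≤ A * 3 ^ d * ν.real Set.univ * weight fun i => (x i : ℝ) := by
  have hfin := hν.finite
  have := norm_integral_le_of_norm_le_const (μ := ν.map fun y => t • y)
    (f := fun y : EuclideanSpace ℝ (Fin d) =>
      (((1 : ℝ)⁻¹ ^ d : ℝ) : ℂ) * g (fun i => ((x i : ℝ) - y i) / 1))
    (C := A * (3 ^ d * weight fun i => (x i : ℝ))) (by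
      filter_upwards [hν.ae_map_smul ht0] with y hy
      refine (hg.norm_dilate_le one_pos _).trans ?_
      rw [inv_one, one_pow, mul_one]
      refine mul_le_mul_of_nonneg_left (weight_le_of_near fun i => ?_) hA
      rw [div_one, sub_sub_cancel_left, abs_neg]
      exact (hy i).trans ht1)
  refine this.trans_eq ?_
  rw [Measure.real, map_smul_univ, Measure.real]
  ring

lemma norm_latK_le (hν : IsSpherical ν) {g : (Fin d → ℝ) → ℂ} {A : ℝ} (hg : NiceKernel g A)
    (hA : 0 ≤ A) (t : ℝ) (x : Fin d → ℤ) :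
    ‖latK g 1 (ν.map fun y => t • y) x‖ ≤ A * ν.real Set.univ := by
  have hfin := hν.finite
  have := norm_integral_le_of_norm_le_const (μ := ν.map fun y => t • y)
    (f := fun y : EuclideanSpace ℝ (Fin d) =>
      (((1 : ℝ)⁻¹ ^ d : ℝ) : ℂ) * g (fun i => ((x i : ℝ) - y i) / 1))
    (C := A) (Filter.Eventually.of_forall fun y => by
      refine (hg.norm_dilate_le one_pos _).trans ?_
      rw [inv_one, one_pow, mul_one]
      exact mul_le_of_le_one_right hA (weight_le_one _))
  refine this.trans_eq ?_
  rw [Measure.real, map_smul_univ, Measure.real]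

/-- The lattice spherical maximal function along a lacunary set of radii, on finitely supported
functions. -/
theorem maximal_lacunary_of_finite (hd : 3 ≤ d) (hν : IsSpherical ν) (hΨ : IsBump d Ψ) {p : ℝ}
    (hp1 : 1 < p) (hp2 : p ≤ 2) {c : ℝ} (hc : 1 < c) : ∃ C, 0 ≤ C ∧ ∀ T : Set ℝ, (∀ t ∈ T, 0 < t) →
      (∀ s ∈ T, ∀ t ∈ T, s < t → c * s ≤ t) → ∀ f : (Fin d → ℤ) → ℂ, f.support.Finite →
        ∑' x, maxConv (fun t : T => latK (invFT Ψ) 1 (ν.map fun y => (t : ℝ) • y)) f x ^ p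
          ≤ ENNReal.ofReal C * ∑' x, ‖f x‖ₑ ^ p := by
  have hp0 : 0 < p := by linarith
  obtain ⟨A, hA, hg⟩ := exists_niceKernel_invFT hΨ.1 hΨ.2.1
  obtain ⟨C, hC, hmax⟩ := maximal_sequence hd hν hΨ hp1 hp2
  obtain ⟨L, hL⟩ := pow_unbounded_of_one_lt 2 hc
  have hpi := Real.pi_pos
  set W := A * 3 ^ d * ν.real Set.univ with hW
  have hW0 : 0 ≤ W := by positivity
  set D := W * (3 * Real.pi) ^ d with hD
  have hD0 : 0 ≤ D := by positivity
  refine ⟨(L + 1) * C + D ^ p, by positivity, fun T hT0 hT f hf => ?_⟩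
  obtain ⟨t, ht, hts⟩ := exists_dyadic_family hc hT hL.le
  set w : (Fin d → ℤ) → ℝ≥0∞ := fun x => ENNReal.ofReal (W * weight fun i => (x i : ℝ)) with hw
  have hwD : ∑' x, w x ≤ ENNReal.ofReal D := by
    rw [hw]
    simp_rw [ENNReal.ofReal_mul hW0]
    rw [ENNReal.tsum_mul_left, hD, ENNReal.ofReal_mul hW0]
    have := tsum_weight_le (d := d) le_rfl 0
    simp only [Pi.zero_apply, sub_zero, div_one, mul_one] at this
    exact mul_le_mul_right this _
  have hpt : ∀ x, maxConv (fun t : T => latK (invFT Ψ) 1 (ν.map fun y => (t : ℝ) • y)) f x ^ p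
      ≤ ∑ l, maxConv (fun n => latK (invFT Ψ) 1 (ν.map fun y => t l n • y)) f x ^ p
        + (∑' y, ‖f y‖ₑ * w (x - y)) ^ p := by
    refine fun x => iSup_rpow_le hp0 fun s => ?_
    rcases le_or_gt 1 (s : ℝ) with h1 | h1
    · obtain ⟨l, n, hln⟩ := hts s s.2 h1
      refine le_add_right (le_trans ?_ (Finset.single_le_sum (fun _ _ => by positivity) (Finset.mem_univ l)))
      refine ENNReal.rpow_le_rpow ?_ hp0.le
      beta_reduce
      rw [← hln]
      exact le_iSup (fun n => ‖dconv f (latK (invFT Ψ) 1 (ν.map fun y => t l n • y)) x‖ₑ) n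
    · refine le_add_left (ENNReal.rpow_le_rpow ?_ hp0.le)
      refine enorm_tsum_le_tsum_enorm.trans (ENNReal.tsum_le_tsum fun y => ?_)
      rw [enorm_mul]
      refine mul_le_mul_right ?_ _
      rw [← ofReal_norm]
      exact ENNReal.ofReal_le_ofReal (norm_latK_le_weight hν hg hA (hT0 s s.2).le h1.le _)
  calc _ ≤ ∑' x, (∑ l, maxConv (fun n => latK (invFT Ψ) 1 (ν.map fun y => t l n • y)) f x ^ p
        + (∑' y, ‖f y‖ₑ * w (x - y)) ^ p) := ENNReal.tsum_le_tsum hpt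
    _ ≤ ∑ _l : Fin (L + 1), ENNReal.ofReal C * ∑' x, ‖f x‖ₑ ^ p
        + ENNReal.ofReal D ^ p * ∑' x, ‖f x‖ₑ ^ p := by
      rw [ENNReal.tsum_add, Summable.tsum_finsetSum fun _ _ => ENNReal.summable]
      refine add_le_add (Finset.sum_le_sum fun l _ => hmax (t l) (ht l) f hf) ?_
      refine (tsum_conv_rpow_le hp1.le _ _).trans ?_
      gcongr
    _ = _ := by
      have e : ENNReal.ofReal ((L + 1) * C) = (L + 1 : ℕ) * ENNReal.ofReal C := by
        rw [← ENNReal.ofReal_natCast, ← ENNReal.ofReal_mul (by positivity), Nat.cast_succ]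
      rw [ENNReal.ofReal_add (by positivity) (by positivity), e,
        ← ENNReal.ofReal_rpow_of_nonneg hD0 hp0.le, Finset.sum_const, Finset.card_univ,
        Fintype.card_fin, nsmul_eq_mul, add_mul, mul_assoc]

/-- A maximal inequality on finitely supported functions extends to summable functions when the
kernels are bounded. -/
lemma maxConv_le_of_summable {κ : Type*} {K : κ → (Fin d → ℤ) → ℂ} {p : ℝ} (hp : 0 < p) {W : ℝ}
    (hW : ∀ k x, ‖K k x‖ ≤ W) {C : ℝ≥0∞}
    (h : ∀ f : (Fin d → ℤ) → ℂ, f.support.Finite → ∑' x, maxConv K f x ^ p ≤ C * ∑' x, ‖f x‖ₑ ^ p)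
    {F : (Fin d → ℤ) → ℂ} (hF : Summable fun x => ‖F x‖) :
    ∑' x, maxConv K F x ^ p ≤ C * ∑' x, ‖F x‖ₑ ^ p := by
  classical
  obtain ⟨S, hS⟩ := Filter.exists_seq_tendsto (Filter.atTop : Filter (Finset (Fin d → ℤ)))
  set G : ℕ → (Fin d → ℤ) → ℂ := fun n x => if x ∈ S n then F x else 0 with hG
  have hGf : ∀ n, (G n).support.Finite := fun n => (S n).finite_toSet.subset fun x hx => by
    by_contra h
    exact hx (if_neg h)
  have hlim : ∀ k x, Filter.Tendsto (fun n => ‖dconv (G n) (K k) x‖ₑ) Filter.atTop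
      (nhds ‖dconv F (K k) x‖ₑ) := by
    intro k x
    have hs : Summable fun y => F y * K k (x - y) := by
      refine Summable.of_norm_bounded (hF.mul_right W) fun y => ?_
      rw [norm_mul]
      exact mul_le_mul_of_nonneg_left (hW _ _) (norm_nonneg _)
    have h1 := (hs.hasSum.comp hS).enorm
    refine h1.congr fun n => ?_
    simp only [Function.comp, dconv, hG]
    rw [tsum_eq_sum (s := S n) fun y hy => by rw [if_neg hy, zero_mul]]
    congr 1
    exact Finset.sum_congr rfl fun y hy => by rw [if_pos hy]
  have hpt : ∀ x, maxConv K F x ^ p ≤ Filter.liminf (fun n => maxConv K (G n) x ^ p) Filter.atTop := by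
    refine fun x => iSup_rpow_le hp fun k => ?_
    rw [← ((ENNReal.continuous_rpow_const.tendsto _).comp (hlim k x)).liminf_eq]
    refine Filter.liminf_le_liminf (Filter.Eventually.of_forall fun n => ?_)
    exact ENNReal.rpow_le_rpow (le_iSup (fun k => ‖dconv (G n) (K k) x‖ₑ) k) hp.le
  calc ∑' x, maxConv K F x ^ p
      ≤ ∑' x, Filter.liminf (fun n => maxConv K (G n) x ^ p) Filter.atTop := ENNReal.tsum_le_tsum hpt
    _ = ∫⁻ x, Filter.liminf (fun n => maxConv K (G n) x ^ p) Filter.atTop ∂Measure.count := by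
      rw [lintegral_count]
    _ ≤ Filter.liminf (fun n => ∫⁻ x, maxConv K (G n) x ^ p ∂Measure.count) Filter.atTop :=
      lintegral_liminf_le fun n => measurable_of_countable _
    _ ≤ Filter.liminf (fun _ : ℕ => C * ∑' x, ‖F x‖ₑ ^ p) Filter.atTop := by
      refine Filter.liminf_le_liminf (Filter.Eventually.of_forall fun n => ?_)
      rw [lintegral_count]
      refine (h _ (hGf n)).trans (mul_le_mul_right (ENNReal.tsum_le_tsum fun x => ?_) _)
      refine ENNReal.rpow_le_rpow ?_ hp.le
      simp only [hG]
      split_ifs <;> simp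
    _ = _ := Filter.liminf_const _

theorem maximal_lacunary (hd : 3 ≤ d) (hν : IsSpherical ν) (hΨ : IsBump d Ψ) {p : ℝ}
    (hp1 : 1 < p) (hp2 : p ≤ 2) {c : ℝ} (hc : 1 < c) : ∃ C, 0 ≤ C ∧ ∀ T : Set ℝ, (∀ t ∈ T, 0 < t) →
      (∀ s ∈ T, ∀ t ∈ T, s < t → c * s ≤ t) → ∀ F : (Fin d → ℤ) → ℂ, (Summable fun x => ‖F x‖) →
        ∑' x, maxConv (fun t : T => latK (invFT Ψ) 1 (ν.map fun y => (t : ℝ) • y)) F x ^ p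
          ≤ ENNReal.ofReal C * ∑' x, ‖F x‖ₑ ^ p := by
  obtain ⟨A, hA, hg⟩ := exists_niceKernel_invFT hΨ.1 hΨ.2.1
  obtain ⟨C, hC, h⟩ := maximal_lacunary_of_finite hd hν hΨ hp1 hp2 hc
  exact ⟨C, hC, fun T hT0 hT F hF => maxConv_le_of_summable
    (K := fun t : T => latK (invFT Ψ) 1 (ν.map fun y => (t : ℝ) • y)) (zero_lt_one.trans hp1)
    (fun t x => norm_latK_le hν hg hA t x) (h T hT0 hT) hF⟩

end

section

variable {d : ℕ} {μ : Measure (EuclideanSpace ℝ (Fin d))} {Ψ Φ : (Fin d → ℝ) → ℝ}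

/-- A band-limited kernel is recovered from its values on the lattice. -/
lemma hasSum_sampling [IsFiniteMeasure μ] (hΨ : Continuous Ψ) {c : ℝ} (hc : 2 * c ≤ 1)
    (hsupp : ∀ x, x ∉ Set.Icc (fun _ => -c) (fun _ => c) → Ψ x = 0) (hΦ : Continuous Φ)
    (hΦs : ∀ x, x ∉ Set.Icc (fun _ => -(1 / 2 : ℝ)) (fun _ => (1 / 2 : ℝ)) → Φ x = 0)
    (hΦ1 : ∀ x, Ψ x ≠ 0 → Φ x = 1) (v : Fin d → ℝ) :
    HasSum (fun z : Fin d → ℤ => invFT Φ (fun i => v i - z i) * latK (invFT Ψ) 1 μ z)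
      (scaleK Ψ μ 1 v) := by
  obtain ⟨P, hP0, hP⟩ := exists_bound_of_support hΨ hsupp
  obtain ⟨P', hP'0, hP'⟩ := exists_bound_of_support hΦ hΦs
  have hmc : Continuous (measFT μ) := continuous_measFT
  have key := hasSum_boxCoeff (fun _ => -(1 / 2)) (g := fun ξ => (Φ ξ : ℂ) * eC (∑ i, v i * ξ i))
    (h := fun ξ => (Ψ ((1 : ℝ) • ξ) : ℂ) * measFT μ ξ) (M := P' + P * μ.real Set.univ)
    (Continuous.measurable (by fun_prop)) (Continuous.measurable (by fun_prop))
    (fun ξ => by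
      rw [norm_mul, norm_eC, mul_one, Complex.norm_real]
      exact (hP' ξ).trans (le_add_of_nonneg_right (by positivity)))
    (fun ξ => by
      rw [norm_mul, Complex.norm_real]
      exact (mul_le_mul (hP _) (norm_measFT_le _ _) (norm_nonneg _) hP0).trans
        (le_add_of_nonneg_left hP'0))
  rw [← latK_eq_boxCoeff hΨ hsupp one_pos hc] at key
  have h1 : ∫ ξ in ubox (fun _ : Fin d => -(1 / 2)), (starRingEnd ℂ) ((Φ ξ : ℂ) * eC (∑ i, v i * ξ i)) *
      ((Ψ ((1 : ℝ) • ξ) : ℂ) * measFT μ ξ) = scaleK Ψ μ 1 v := by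
    rw [setIntegral_ubox_of_support fun ξ hξ => by rw [hΦs ξ hξ]; simp, scaleK]
    refine integral_congr_ae (Filter.Eventually.of_forall fun ξ => ?_)
    simp only [one_smul, map_mul, Complex.conj_ofReal, ← eC_neg]
    rcases eq_or_ne (Ψ ξ) 0 with h | h
    · rw [h]; simp
    · rw [hΦ1 ξ h]; push_cast; ring
  rw [h1] at key
  convert! key using 1
  funext z
  congr 1
  rw [boxCoeff, ← integral_conj, invFT,
    ← setIntegral_ubox_of_support fun ξ hξ => by rw [hΦs ξ hξ]; simp]
  refine integral_congr_ae (Filter.Eventually.of_forall fun ξ => ?_)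
  simp only [map_mul, Complex.conj_ofReal, ← eC_neg, neg_neg]
  rw [mul_assoc, ← eC_add]
  congr 2
  simp only [sub_mul, Finset.sum_sub_distrib]
  ring

end

section

variable {d q : ℕ}

/-- The normalized quadratic exponential sum in one variable. -/
def quadSum (q u : ℕ) (n : ℤ) : ℂ :=
  (q : ℂ)⁻¹ * ∑ b : Fin q, eC (((u : ℝ) * ((b : ℕ) : ℝ) ^ 2 + ((b : ℕ) : ℝ) * n) / q)

lemma eC_intCast_div [NeZero q] (a : ℤ) : eC ((a : ℝ) / q) = ZMod.stdAddChar (a : ZMod q) := by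
  rw [ZMod.stdAddChar_coe, eC]
  congr 1
  push_cast
  ring

lemma sum_fin_eq_sum_zmod [NeZero q] {α : Type*} [AddCommMonoid α] (F : ZMod q → α) :
    ∑ b : Fin q, F ((b : ℕ) : ZMod q) = ∑ b : ZMod q, F b := by
  refine Fintype.sum_bijective (fun b : Fin q => ((b : ℕ) : ZMod q)) ⟨fun a b h => ?_, fun z => ?_⟩
    _ _ fun _ => rfl
  · have := congrArg ZMod.val h
    simp only [ZMod.val_natCast, Nat.mod_eq_of_lt a.2, Nat.mod_eq_of_lt b.2] at this
    exact Fin.ext this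
  · exact ⟨⟨z.val, ZMod.val_lt z⟩, by simp⟩

lemma quadSum_eq [NeZero q] (u : ℕ) (n : ℤ) :
    quadSum q u n = (q : ℂ)⁻¹ * ∑ b : ZMod q, ZMod.stdAddChar ((u : ZMod q) * b ^ 2 + b * (n : ZMod q)) := by
  rw [quadSum, ← sum_fin_eq_sum_zmod]
  congr 1
  refine Finset.sum_congr rfl fun b _ => ?_
  have := eC_intCast_div (q := q) ((u : ℤ) * (b : ℕ) ^ 2 + (b : ℕ) * n)
  push_cast at this
  rw [this]

lemma sum_quadSum_mul [NeZero q] (u : ℕ) (x : ℤ) :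
    ∑ n : Fin q, quadSum q u (n : ℕ) * eC (-((x : ℝ) * (n : ℕ)) / q) = eC ((u : ℝ) * (x : ℝ) ^ 2 / q) := by
  have hq : (q : ℂ) ≠ 0 := by exact_mod_cast NeZero.ne q
  set F : ZMod q → ℂ := fun m => (q : ℂ)⁻¹ * ∑ b : ZMod q, ZMod.stdAddChar ((u : ZMod q) * b ^ 2) *
    ZMod.stdAddChar (m * (b - (x : ZMod q))) with hF
  have h1 : ∀ n : Fin q, quadSum q u (n : ℕ) * eC (-((x : ℝ) * (n : ℕ)) / q) =
      F ((n : ℕ) : ZMod q) := by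
    intro n
    have := eC_intCast_div (q := q) (-(x * (n : ℕ)))
    push_cast at this
    rw [quadSum_eq, this, mul_assoc, Finset.sum_mul]
    congr 1
    refine Finset.sum_congr rfl fun b _ => ?_
    rw [← AddChar.map_add_eq_mul, ← AddChar.map_add_eq_mul]
    congr 1
    push_cast
    ring
  have h2 := eC_intCast_div (q := q) ((u : ℤ) * x ^ 2)
  push_cast at h2
  rw [Finset.sum_congr rfl fun n _ => h1 n]
  refine (sum_fin_eq_sum_zmod F).trans ?_
  simp only [hF]
  rw [← Finset.mul_sum, Finset.sum_comm, h2]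
  simp_rw [← Finset.mul_sum, AddChar.sum_mulShift _ (ZMod.isPrimitive_stdAddChar q), sub_eq_zero]
  simp only [Nat.cast_ite, ZMod.card, Nat.cast_zero, mul_ite, mul_zero, Finset.sum_ite_eq',
    Finset.mem_univ, if_true]
  field_simp

lemma card_two_torsion_le [NeZero q] : (Finset.univ.filter fun h : ZMod q => 2 * h = 0).card ≤ 2 := by
  have : (Finset.univ.filter fun h : ZMod q => 2 * h = 0).card ≤ ({0, q / 2} : Finset ℕ).card := by
    refine Finset.card_le_card_of_injOn ZMod.val (fun h hh => ?_) ((ZMod.val_injective q).injOn)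
    have hh := (Finset.mem_filter.1 hh).2
    have h1 : ((2 * h.val : ℕ) : ZMod q) = 0 := by push_cast; rwa [ZMod.natCast_zmod_val]
    rw [ZMod.natCast_eq_zero_iff] at h1
    obtain ⟨k, hk⟩ := h1
    have hlt := ZMod.val_lt h
    have hk2 : k < 2 := by
      by_contra hk2
      push Not at hk2
      nlinarith
    simp only [Finset.coe_insert, Finset.coe_singleton, Set.mem_insert_iff, Set.mem_singleton_iff]
    interval_cases k <;> omega
  exact this.trans Finset.card_le_two

lemma norm_quadSum_sq_le [NeZero q] {u : ℕ} (hu : u.Coprime q) (n : ℤ) :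
    ‖quadSum q u n‖ ^ 2 ≤ 2 / q := by
  have hq : (0 : ℝ) < q := by exact_mod_cast NeZero.pos q
  set ψ : AddChar (ZMod q) ℂ := ZMod.stdAddChar with hψ
  have hψn : ∀ a, ‖ψ a‖ = 1 := fun a => AddChar.norm_apply _ _
  set S := ∑ b : ZMod q, ψ ((u : ZMod q) * b ^ 2 + b * (n : ZMod q)) with hS
  have hun : IsUnit (u : ZMod q) := (ZMod.isUnit_iff_coprime u q).2 hu
  have h1 : S * (starRingEnd ℂ) S
      = ∑ h : ZMod q, ψ ((u : ZMod q) * h ^ 2 + h * (n : ZMod q)) * (if 2 * h = 0 then (q : ℂ) else 0) := by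
    calc S * (starRingEnd ℂ) S
        = ∑ b' : ZMod q, ∑ b : ZMod q, ψ ((u : ZMod q) * b ^ 2 + b * (n : ZMod q)) *
            ψ (-((u : ZMod q) * b' ^ 2 + b' * (n : ZMod q))) := by
          rw [hS, map_sum, Finset.sum_mul_sum, Finset.sum_comm]
          simp_rw [AddChar.map_neg_eq_conj]
      _ = ∑ b' : ZMod q, ∑ h : ZMod q, ψ ((u : ZMod q) * h ^ 2 + h * (n : ZMod q)) *
            ψ (b' * ((u : ZMod q) * (2 * h))) := by
          refine Finset.sum_congr rfl fun b' _ => ?_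
          rw [← Equiv.sum_comp (Equiv.addLeft b')]
          refine Finset.sum_congr rfl fun h _ => ?_
          rw [← AddChar.map_add_eq_mul, ← AddChar.map_add_eq_mul, Equiv.coe_addLeft]
          congr 1
          ring
      _ = _ := by
          rw [Finset.sum_comm]
          refine Finset.sum_congr rfl fun h _ => ?_
          rw [← Finset.mul_sum, AddChar.sum_mulShift _ (ZMod.isPrimitive_stdAddChar q)]
          simp only [hun.mul_right_eq_zero, ZMod.card]
          push_cast
          rfl
  have h2 : ‖S‖ ^ 2 ≤ 2 * q := by
    have h3 : ‖S‖ ^ 2 = ‖S * (starRingEnd ℂ) S‖ := by rw [norm_mul, RCLike.norm_conj, sq]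
    rw [h3, h1]
    refine (norm_sum_le _ _).trans ?_
    calc ∑ h : ZMod q, ‖ψ ((u : ZMod q) * h ^ 2 + h * (n : ZMod q)) * (if 2 * h = 0 then (q : ℂ) else 0)‖
        = ∑ h : ZMod q, if 2 * h = 0 then (q : ℝ) else 0 := by
          refine Finset.sum_congr rfl fun h _ => ?_
          rw [norm_mul, hψn, one_mul]
          split_ifs <;> simp
      _ = (Finset.univ.filter fun h : ZMod q => 2 * h = 0).card * q := by
          rw [← Finset.sum_filter, Finset.sum_const, nsmul_eq_mul]
      _ ≤ 2 * q := by
          have : ((Finset.univ.filter fun h : ZMod q => 2 * h = 0).card : ℝ) ≤ 2 := by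
            exact_mod_cast card_two_torsion_le
          gcongr
  rw [quadSum_eq, norm_mul, norm_inv, Complex.norm_natCast, mul_pow, inv_pow,
    inv_mul_le_iff₀ (by positivity)]
  refine h2.trans_eq ?_
  field_simp

/-- The normalized quadratic exponential sum in several variables. -/
def quadSumPi (q u : ℕ) (n : Fin d → ℤ) : ℂ :=
  ((q : ℂ)⁻¹) ^ d * ∑ b : Fin d → Fin q,
    eC ((((u : ℕ) : ℝ) * ∑ i, (((b i : ℕ) : ℝ)) ^ 2 + ∑ i, ((b i : ℕ) : ℝ) * ((n i : ℝ))) / q)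

lemma eC_sum {ι : Type*} (s : Finset ι) (f : ι → ℝ) : eC (∑ i ∈ s, f i) = ∏ i ∈ s, eC (f i) := by
  classical
  induction s using Finset.induction_on with
  | empty => simp [eC_zero]
  | insert a s ha ih => rw [Finset.sum_insert ha, Finset.prod_insert ha, eC_add, ih]

lemma quadSumPi_eq_prod (q u : ℕ) (n : Fin d → ℤ) : quadSumPi q u n = ∏ i, quadSum q u (n i) := by
  simp only [quadSum]
  rw [Finset.prod_mul_distrib, Finset.prod_const, Finset.card_univ, Fintype.card_fin, quadSumPi,
    Finset.prod_univ_sum, Fintype.piFinset_univ]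
  congr 1
  refine Finset.sum_congr rfl fun b _ => ?_
  rw [← eC_sum, Finset.mul_sum, ← Finset.sum_add_distrib, Finset.sum_div]

lemma norm_quadSumPi_sq_le [NeZero q] {u : ℕ} (hu : u.Coprime q) (n : Fin d → ℤ) :
    ‖quadSumPi q u n‖ ^ 2 ≤ (2 / q) ^ d := by
  rw [quadSumPi_eq_prod, norm_prod, ← Finset.prod_pow]
  refine (Finset.prod_le_prod (fun i _ => by positivity)
    fun i _ => norm_quadSum_sq_le hu (n i)).trans_eq ?_
  rw [Finset.prod_const, Finset.card_univ, Fintype.card_fin]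

lemma sum_quadSumPi_mul [NeZero q] (u : ℕ) (x : Fin d → ℤ) :
    ∑ n : Fin d → Fin q, quadSumPi q u (fun i => ((n i : ℕ) : ℤ)) *
      eC (-(∑ i, (x i : ℝ) * ((n i : ℕ) : ℝ)) / q) = eC ((u : ℝ) * (∑ i, (x i : ℝ) ^ 2) / q) := by
  rw [Finset.mul_sum, Finset.sum_div, eC_sum]
  simp_rw [← sum_quadSum_mul]
  rw [Finset.prod_univ_sum, Fintype.piFinset_univ]
  refine Finset.sum_congr rfl fun n _ => ?_
  rw [Finset.prod_mul_distrib, quadSumPi_eq_prod, ← eC_sum, ← Finset.sum_neg_distrib, Finset.sum_div]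

lemma kloosterman_eq (q : ℕ) (N : ℤ) (n : Fin d → ℤ) :
    kloosterman d q N n = ∑ u : Fin q, if Nat.Coprime (u : ℕ) q then
      eC (-(((u : ℕ) : ℝ) * (N : ℝ)) / q) * quadSumPi q u n else 0 := by
  rw [kloosterman, Finset.mul_sum]
  refine Finset.sum_congr rfl fun u _ => ?_
  split_ifs
  · rw [quadSumPi]; ring
  · rw [mul_zero]

lemma eC_congr_intCast_div [NeZero q] {a b : ℤ} (h : (a : ZMod q) = b) :
    eC ((a : ℝ) / q) = eC ((b : ℝ) / q) := by
  rw [eC_intCast_div, eC_intCast_div, h]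

end

section

variable {d q : ℕ}

section

attribute [local instance] unitAddCircleMeasureSpace unitAddCircleIsProbabilityMeasure

open UnitAddTorus

lemma setIntegral_ubox_eq_of_periodic {f : (Fin d → ℝ) → ℂ}
    (hf : ∀ (ξ : Fin d → ℝ) (n : Fin d → ℤ), f (fun i => ξ i + n i) = f ξ) (a b : Fin d → ℝ) :
    ∫ ξ in ubox a, f ξ = ∫ ξ in ubox b, f ξ := by
  set F : UnitAddTorus (Fin d) → ℂ := fun x => f (measurableEquivPiIoc a x).1 with hF
  have h1 : ∀ ξ : Fin d → ℝ, F (fun i => (ξ i : UnitAddCircle)) = f ξ := fun ξ => by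
    set η := (measurableEquivPiIoc a (fun i => (ξ i : UnitAddCircle))).1 with hη
    have h2 : (fun i => (η i : UnitAddCircle)) = fun i => (ξ i : UnitAddCircle) :=
      funext fun i => (AddCircle.equivIoc (1 : ℝ) (a i)).symm_apply_apply (ξ i : UnitAddCircle)
    have h3 : ∀ i, ∃ n : ℤ, η i = ξ i + n := fun i => by
      have h4 := congrFun h2 i
      simp only [QuotientAddGroup.eq, AddSubgroup.mem_zmultiples_iff, zsmul_eq_mul, mul_one] at h4
      obtain ⟨k, hk⟩ := h4
      exact ⟨-k, by push_cast; linarith⟩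
    choose n hn using h3
    simp only [hF, ← hη]
    rw [← hf ξ n]
    congr 1
    exact funext hn
  have h2 := integral_preimage F a
  have h3 := integral_preimage F b
  simp only [h1] at h2 h3
  exact h2.symm.trans h3

end

lemma setIntegral_ubox_eq_integral (a : Fin d → ℝ) {g : (Fin d → ℝ) → ℂ}
    (hg : ∀ ξ, ξ ∉ Set.Icc a (fun i => a i + 1) → g ξ = 0) :
    ∫ ξ in ubox a, g ξ = ∫ ξ, g ξ := by
  refine Eq.trans ?_ (setIntegral_eq_integral_of_forall_compl_eq_zero hg)
  have hbox : ubox a = Set.univ.pi fun i => Set.Ioc (a i) (a i + 1) := by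
    ext x; simp [ubox, Set.mem_pi]
  rw [hbox]
  have := Measure.univ_pi_Ioc_ae_eq_Icc (μ := fun _ : Fin d => (volume : Measure ℝ))
    (f := a) (g := fun i => a i + 1)
  rw [← volume_pi] at this
  exact setIntegral_congr_set this

lemma integral_comp_mul_sub (hq : 0 < q) (Θ : (Fin d → ℝ) → ℂ) (b x : Fin d → ℝ) :
    ∫ ξ : Fin d → ℝ, Θ (fun i => (q : ℝ) * ξ i - b i) * eC (-∑ i, x i * ξ i)
      = eC (-(∑ i, x i * b i) / q) *
        (((q : ℝ)⁻¹ ^ d : ℝ) * ∫ η, Θ η * eC (-∑ i, x i / q * η i)) := by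
  have hq' : (0 : ℝ) < q := by exact_mod_cast hq
  have h1 := Measure.integral_comp_smul_of_nonneg (volume : Measure (Fin d → ℝ))
    (fun ξ => Θ (fun i => ξ i - b i) * eC (-∑ i, x i / q * ξ i)) (q : ℝ) (hR := hq'.le)
  simp only [Module.finrank_fin_fun, Pi.smul_apply, smul_eq_mul] at h1
  have h2 := integral_add_right_eq_self (μ := (volume : Measure (Fin d → ℝ)))
    (fun ξ => Θ (fun i => ξ i - b i) * eC (-∑ i, x i / q * ξ i)) b
  have h3 : ∀ ξ : Fin d → ℝ, ∑ i, x i / q * (q * ξ i) = ∑ i, x i * ξ i := fun ξ =>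
    Finset.sum_congr rfl fun i _ => by field_simp
  simp only [h3] at h1
  rw [h1, ← h2, Complex.real_smul, inv_pow, mul_left_comm]
  congr 1
  rw [← integral_const_mul]
  congr 1
  funext ξ
  have h4 : -∑ i, x i / (q : ℝ) * (ξ + b) i
      = -(∑ i, x i * b i) / q + -∑ i, x i / q * ξ i := by
    simp only [Pi.add_apply, mul_add, Finset.sum_add_distrib, Finset.sum_div, neg_add, neg_div]
    rw [add_comm]
    congr 2
    exact Finset.sum_congr rfl fun i _ => by ring
  rw [h4, eC_add]
  simp only [Pi.add_apply, add_sub_cancel_right]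
  ring

/-- The superposition of the translates of a bump by the points of `{0, …, q - 1}^d / q`. -/
def combMult (q : ℕ) (S : (Fin d → Fin q) → ℂ) (Θ : (Fin d → ℝ) → ℂ) (ξ : Fin d → ℝ) : ℂ :=
  ∑ n : Fin d → Fin q, S n * Θ (fun i => (q : ℝ) * ξ i - (n i : ℕ))

lemma continuous_combMult (S : (Fin d → Fin q) → ℂ) {Θ : (Fin d → ℝ) → ℂ} (hΘ : Continuous Θ) :
    Continuous (combMult q S Θ) := by
  unfold combMult
  fun_prop

lemma sum_fin_indicator_le (y : ℝ) :
    ∑ k : Fin q, (if |y - (k : ℕ)| ≤ 1 / 2 then (1 : ℝ) else 0) ≤ 2 := by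
  rw [← Finset.sum_filter, Finset.sum_const, nsmul_eq_mul, mul_one]
  have h1 : (Finset.univ.filter fun k : Fin q => |y - (k : ℕ)| ≤ 1 / 2).card
      ≤ (Finset.Icc ⌈y - 1 / 2⌉ ⌊y + 1 / 2⌋).card := by
    refine Finset.card_le_card_of_injOn (fun k => ((k : ℕ) : ℤ)) (fun k hk => ?_) ?_
    · have hk := abs_le.1 (Finset.mem_filter.1 hk).2
      refine Finset.mem_coe.2 (Finset.mem_Icc.2 ⟨Int.ceil_le.2 ?_, Int.le_floor.2 ?_⟩)
      · push_cast; linarith [hk.2]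
      · push_cast; linarith [hk.1]
    · intro k _ l _ h
      exact Fin.ext (Int.ofNat_inj.1 h)
  have h2 : (Finset.Icc ⌈y - 1 / 2⌉ ⌊y + 1 / 2⌋).card ≤ 2 := by
    rw [Int.card_Icc]
    have h3 : ⌊y + 1 / 2⌋ ≤ ⌈y - 1 / 2⌉ + 1 := by
      have : ((⌊y + 1 / 2⌋ : ℤ) : ℝ) ≤ ((⌈y - 1 / 2⌉ + 1 : ℤ) : ℝ) := by
        push_cast
        linarith [Int.floor_le (y + 1 / 2), Int.le_ceil (y - 1 / 2)]
      exact_mod_cast this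
    omega
  exact_mod_cast h1.trans h2

lemma norm_combMult_le {S : (Fin d → Fin q) → ℂ} {s : ℝ} (hS : ∀ n, ‖S n‖ ≤ s) (hs : 0 ≤ s)
    {Θ : (Fin d → ℝ) → ℂ} {B : ℝ} (hB : ∀ ξ, ‖Θ ξ‖ ≤ B)
    (hΘ : ∀ ξ, ξ ∉ Set.Icc (fun _ => -(1 / 2 : ℝ)) (fun _ => (1 / 2 : ℝ)) → Θ ξ = 0)
    (ξ : Fin d → ℝ) : ‖combMult q S Θ ξ‖ ≤ s * B * 2 ^ d := by
  have hB0 : 0 ≤ B := (norm_nonneg _).trans (hB 0)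
  have h1 : ∀ n : Fin d → Fin q, ‖S n * Θ (fun i => (q : ℝ) * ξ i - (n i : ℕ))‖
      ≤ s * B * ∏ i, (if |(q : ℝ) * ξ i - (n i : ℕ)| ≤ 1 / 2 then (1 : ℝ) else 0) := by
    intro n
    by_cases hn : ∀ i, |(q : ℝ) * ξ i - (n i : ℕ)| ≤ 1 / 2
    · rw [Finset.prod_congr rfl fun i _ => if_pos (hn i), Finset.prod_const_one, mul_one, norm_mul]
      exact mul_le_mul (hS n) (hB _) (norm_nonneg _) hs
    · rw [hΘ _ fun h => hn fun i => abs_le.2 ⟨h.1 i, h.2 i⟩, mul_zero, norm_zero]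
      refine mul_nonneg (mul_nonneg hs hB0) (Finset.prod_nonneg fun i _ => ?_)
      split_ifs <;> norm_num
  refine (norm_sum_le _ _).trans ((Finset.sum_le_sum fun n _ => h1 n).trans ?_)
  rw [← Finset.mul_sum]
  refine mul_le_mul_of_nonneg_left ?_ (mul_nonneg hs hB0)
  have h2 := Finset.prod_univ_sum (fun _ : Fin d => (Finset.univ : Finset (Fin q)))
    (fun i k => if |(q : ℝ) * ξ i - (k : ℕ)| ≤ 1 / 2 then (1 : ℝ) else 0)
  rw [Fintype.piFinset_univ] at h2
  rw [← h2]
  refine (Finset.prod_le_prod (fun i _ => Finset.sum_nonneg fun k _ => ?_)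
    fun i _ => sum_fin_indicator_le _).trans_eq ?_
  · split_ifs <;> norm_num
  · rw [Finset.prod_const, Finset.card_univ, Fintype.card_fin]

lemma boxCoeff_combMult (hq : 0 < q) (S : (Fin d → Fin q) → ℂ) {Θ : (Fin d → ℝ) → ℂ}
    (hΘc : Continuous Θ)
    (hΘ : ∀ ξ, ξ ∉ Set.Icc (fun _ => -(1 / 2 : ℝ)) (fun _ => (1 / 2 : ℝ)) → Θ ξ = 0)
    (x : Fin d → ℤ) :
    boxCoeff (fun _ => -(1 / (2 * q : ℝ))) (combMult q S Θ) x
      = (∑ n : Fin d → Fin q, S n * eC (-(∑ i, (x i : ℝ) * ((n i : ℕ) : ℝ)) / q)) *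
        (((q : ℝ)⁻¹ ^ d : ℝ) * ∫ η, Θ η * eC (-∑ i, (x i : ℝ) / q * η i)) := by
  have hq' : (0 : ℝ) < q := by exact_mod_cast hq
  obtain ⟨B, hB⟩ := (HasCompactSupport.intro isCompact_Icc hΘ).exists_bound_of_continuous hΘc
  have hbddint : ∀ n : Fin d → Fin q, Integrable (fun ξ : Fin d → ℝ =>
      Θ (fun i => (q : ℝ) * ξ i - (n i : ℕ)) * eC (-∑ i, (x i : ℝ) * ξ i))
      (volume.restrict (ubox fun _ => -(1 / (2 * q : ℝ)))) := fun n =>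
    integrable_boxCoeff _ (Continuous.measurable (by fun_prop)) (fun ξ => hB _) x
  simp only [boxCoeff, combMult, Finset.sum_mul, mul_assoc]
  rw [integral_finsetSum _ fun n _ => (hbddint n).const_mul (S n)]
  refine Finset.sum_congr rfl fun n _ => ?_
  rw [integral_const_mul]
  congr 1
  rw [← integral_comp_mul_sub hq Θ (fun i => ((n i : ℕ) : ℝ)) (fun i => (x i : ℝ))]
  refine setIntegral_ubox_eq_integral _ fun ξ hξ => ?_
  rw [hΘ, zero_mul]
  intro h
  refine hξ ⟨fun i => ?_, fun i => ?_⟩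
  · have h1 := h.1 i
    have h2 : (0 : ℝ) ≤ (n i : ℕ) := by positivity
    simp only at h1
    have h3 : -(1 / (2 * q : ℝ)) = (-(1 / 2)) / q := by field_simp
    show -(1 / (2 * q : ℝ)) ≤ ξ i
    rw [h3, div_le_iff₀ hq']
    linarith
  · have h1 := h.2 i
    have h2 : ((n i : ℕ) : ℝ) + 1 ≤ q := by exact_mod_cast (n i).2
    simp only at h1
    have h3 : -(1 / (2 * q : ℝ)) + 1 = (q - 1 / 2) / q := by field_simp; ring
    show ξ i ≤ -(1 / (2 * q : ℝ)) + 1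
    rw [h3, le_div_iff₀ hq']
    linarith

end

section

variable {d q : ℕ}

/-- The rescaled kernel `g` multiplied by the quadratic phase `e(u|x|²/q)`. -/
def twistK (q u : ℕ) (g : (Fin d → ℝ) → ℂ) (x : Fin d → ℤ) : ℂ :=
  eC ((u : ℝ) * (∑ i, (x i : ℝ) ^ 2) / q) * (((q : ℝ)⁻¹ ^ d : ℝ) * g (fun i => (x i : ℝ) / q))

lemma tsum_enorm_twistK_le {g : (Fin d → ℝ) → ℂ} {A : ℝ} (hg : NiceKernel g A) (hA : 0 ≤ A)
    (hq : 1 ≤ q) (u : ℕ) :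
    ∑' x, ‖twistK q u g x‖ₑ ≤ ENNReal.ofReal (A * (3 * Real.pi) ^ d) := by
  have hq' : (1 : ℝ) ≤ q := by exact_mod_cast hq
  have hq0 : (0 : ℝ) < q := by linarith
  calc ∑' x, ‖twistK q u g x‖ₑ
      ≤ ∑' x : Fin d → ℤ, ENNReal.ofReal (A * (q : ℝ)⁻¹ ^ d) *
          ENNReal.ofReal (weight fun i => ((x i : ℝ) - (0 : Fin d → ℝ) i) / q) := by
        refine ENNReal.tsum_le_tsum fun x => ?_
        rw [← ofReal_norm, ← ENNReal.ofReal_mul (by positivity), twistK, norm_mul, norm_eC, one_mul]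
        refine ENNReal.ofReal_le_ofReal ?_
        simpa using hg.norm_dilate_le hq0 (fun i => (x i : ℝ) / q)
    _ ≤ ENNReal.ofReal (A * (q : ℝ)⁻¹ ^ d) * ENNReal.ofReal ((3 * Real.pi * q) ^ d) := by
        rw [ENNReal.tsum_mul_left]
        gcongr
        exact tsum_weight_le hq' 0
    _ = ENNReal.ofReal (A * (3 * Real.pi) ^ d) := by
        rw [← ENNReal.ofReal_mul (by positivity)]
        congr 1
        rw [mul_pow, inv_pow]
        field_simp

lemma twistK_eq_boxCoeff [NeZero q] (u : ℕ) {Φ : (Fin d → ℝ) → ℝ} (hΦ : Continuous Φ)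
    (hΦs : ∀ x, x ∉ Set.Icc (fun _ => -(1 / 2 : ℝ)) (fun _ => (1 / 2 : ℝ)) → Φ x = 0) :
    twistK q u (invFT Φ) = boxCoeff (fun _ => -(1 / (2 * q : ℝ)))
      (combMult q (fun n => quadSumPi q u fun i => ((n i : ℕ) : ℤ)) fun ξ => (Φ ξ : ℂ)) := by
  funext x
  rw [boxCoeff_combMult (NeZero.pos q) _ (by fun_prop) (fun ξ hξ => by rw [hΦs ξ hξ]; simp),
    sum_quadSumPi_mul]
  rfl

lemma tsum_dconv_twistK_sq_le [NeZero q] {u : ℕ} (hu : u.Coprime q) {Φ : (Fin d → ℝ) → ℝ}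
    (hΦ : Continuous Φ)
    (hΦs : ∀ x, x ∉ Set.Icc (fun _ => -(1 / 2 : ℝ)) (fun _ => (1 / 2 : ℝ)) → Φ x = 0)
    {B : ℝ} (hB : ∀ x, |Φ x| ≤ B) {f : (Fin d → ℤ) → ℂ} (hf : f.support.Finite) :
    ∑' x, ‖dconv f (twistK q u (invFT Φ)) x‖ₑ ^ 2
      ≤ ENNReal.ofReal (B ^ 2 * 8 ^ d / q ^ d) * ∑' x, ‖f x‖ₑ ^ 2 := by
  have hq : (0 : ℝ) < q := by exact_mod_cast NeZero.pos q
  have hB0 : 0 ≤ B := (abs_nonneg _).trans (hB 0)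
  set m := combMult q (fun n : Fin d → Fin q => quadSumPi q u fun i => ((n i : ℕ) : ℤ))
    fun ξ => (Φ ξ : ℂ) with hm
  have hbound : ∀ ξ, ‖m ξ‖ ≤ Real.sqrt ((2 / q) ^ d) * B * 2 ^ d := fun ξ =>
    norm_combMult_le (fun n => Real.le_sqrt_of_sq_le (norm_quadSumPi_sq_le hu _)) (Real.sqrt_nonneg _)
      (fun ξ => by rw [Complex.norm_real]; exact hB ξ) (fun ξ hξ => by rw [hΦs ξ hξ]; simp) ξ
  have hmeas : Measurable m := (continuous_combMult _ (by fun_prop)).measurable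
  have h1 := tsum_maxConv_boxCoeff_sq_le (κ := Unit) (fun _ => -(1 / (2 * q : ℝ))) (m := fun _ => m)
    (fun _ => hmeas) (b := (B ^ 2 * 8 ^ d / q ^ d).toNNReal) (fun _ => hbound) (fun ξ => ?_) hf
  · simp only [maxConv, ciSup_unique] at h1
    rw [twistK_eq_boxCoeff u hΦ hΦs]
    exact h1
  · rw [tsum_eq_single () (by simp)]
    rw [← ofReal_norm, ← ENNReal.ofReal_pow (norm_nonneg _)]
    refine ENNReal.ofReal_le_ofReal ?_
    calc ‖m ξ‖ ^ 2 ≤ (Real.sqrt ((2 / q) ^ d) * B * 2 ^ d) ^ 2 := by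
          gcongr; exact hbound ξ
      _ = B ^ 2 * 8 ^ d / q ^ d := by
          rw [mul_pow, mul_pow, Real.sq_sqrt (by positivity), div_pow,
            show (8 : ℝ) = 2 * 2 ^ 2 by norm_num, mul_pow, ← pow_mul, ← pow_mul, mul_comm d 2]
          ring

lemma tsum_dconv_le {K : (Fin d → ℤ) → ℂ} {D : ℝ} (hK : ∑' x, ‖K x‖ₑ ≤ ENNReal.ofReal D)
    (f : (Fin d → ℤ) → ℂ) :
    ∑' x, ‖dconv f K x‖ₑ ≤ ENNReal.ofReal D * ∑' x, ‖f x‖ₑ := by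
  have h := tsum_conv_rpow_le le_rfl (fun x => ‖f x‖ₑ) (fun x => ‖K x‖ₑ)
  simp only [ENNReal.rpow_one] at h
  refine le_trans (ENNReal.tsum_le_tsum fun x => ?_) (h.trans (by gcongr))
  refine enorm_tsum_le_tsum_enorm.trans_eq (tsum_congr fun y => ?_)
  rw [enorm_mul]

theorem exists_twist_bound {Φ : (Fin d → ℝ) → ℝ} (hΦ : ContDiff ℝ (⊤ : ℕ∞) Φ)
    (hΦs : ∀ x, x ∉ Set.Icc (fun _ => -(1 / 2 : ℝ)) (fun _ => (1 / 2 : ℝ)) → Φ x = 0)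
    {p : ℝ} (hp1 : 1 < p) (hp2 : p ≤ 2) :
    ∃ C, 0 ≤ C ∧ ∀ q : ℕ, 1 ≤ q → ∀ u : ℕ, u.Coprime q → ∀ f : (Fin d → ℤ) → ℂ,
      f.support.Finite → ∑' x, ‖dconv f (twistK q u (invFT Φ)) x‖ₑ ^ p
        ≤ ENNReal.ofReal (C * (q : ℝ) ^ ((d : ℝ) * (1 - p))) * ∑' x, ‖f x‖ₑ ^ p := by
  obtain ⟨A, hA, hnice⟩ := exists_niceKernel_invFT hΦ hΦs
  obtain ⟨B, hB0, hB⟩ := exists_bound_of_support hΦ.continuous hΦs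
  have hpi := Real.pi_pos
  rcases hp2.lt_or_eq with hp2 | rfl
  · set D := A * (3 * Real.pi) ^ d with hD
    set E := B ^ 2 * 8 ^ d with hE
    refine ⟨p * (2 * D * (1 / 2) ^ (1 - p) / (p - 1) + 4 * E * (1 / 2) ^ (2 - p) / (2 - p)), ?_, ?_⟩
    · have h1 : 0 < p - 1 := by linarith
      have h2 : 0 < 2 - p := by linarith
      positivity
    intro q hq u hu f hf
    have : NeZero q := ⟨by omega⟩
    have hq0 : (0 : ℝ) < q := by exact_mod_cast hq
    have hγ : (0 : ℝ) < (q : ℝ) ^ d := by positivity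
    have h := interpolate_weak (M := fun f x => ‖dconv f (twistK q u (invFT Φ)) x‖ₑ)
      (fun f g hf hg x => by rw [dconv_add hf hg]; exact enorm_add_le _ _) hp1 (Or.inl hp2) hγ
      (c := D) (a := E / q ^ d) (by positivity) (by positivity) (fun f hf t ht => ?_)
      (fun f hf t ht _ => ?_) f hf
    · refine h.trans_eq ?_
      congr 2
      have e1 : ((q : ℝ) ^ d / 2) ^ (1 - p) = (1 / 2) ^ (1 - p) * (q : ℝ) ^ ((d : ℝ) * (1 - p)) := by
        rw [div_eq_mul_one_div, mul_comm, Real.mul_rpow (by norm_num) hγ.le, ← Real.rpow_natCast,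
          ← Real.rpow_mul hq0.le]
      have e2 : ((q : ℝ) ^ d / 2) ^ (2 - p)
          = (1 / 2) ^ (2 - p) * (q : ℝ) ^ ((d : ℝ) * (1 - p)) * (q : ℝ) ^ d := by
        rw [div_eq_mul_one_div, mul_comm, Real.mul_rpow (by norm_num) hγ.le, ← Real.rpow_natCast,
          ← Real.rpow_mul hq0.le, mul_assoc, ← Real.rpow_add hq0]
        congr 2
        ring
      rw [e1, e2]
      field_simp
    · refine (levelCount_le _ ht).trans ?_
      calc ENNReal.ofReal (1 / t) * ∑' x, ‖dconv f (twistK q u (invFT Φ)) x‖ₑ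
          ≤ ENNReal.ofReal (1 / t) * (ENNReal.ofReal D * ∑' x, ‖f x‖ₑ) := by
            gcongr
            exact tsum_dconv_le (tsum_enorm_twistK_le hnice hA hq u) f
        _ = _ := by
            rw [← mul_assoc, ← ENNReal.ofReal_mul (by positivity)]
            congr 2
            ring
    · refine (levelCount_le_sq _ ht).trans ?_
      calc ENNReal.ofReal (1 / t ^ 2) * ∑' x, ‖dconv f (twistK q u (invFT Φ)) x‖ₑ ^ 2
          ≤ ENNReal.ofReal (1 / t ^ 2) * (ENNReal.ofReal (E / q ^ d) * ∑' x, ‖f x‖ₑ ^ 2) := by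
            gcongr
            exact tsum_dconv_twistK_sq_le hu hΦ.continuous hΦs hB hf
        _ = _ := by
            rw [← mul_assoc, ← ENNReal.ofReal_mul (by positivity)]
            congr 2
            ring
  · refine ⟨B ^ 2 * 8 ^ d, by positivity, fun q hq u hu f hf => ?_⟩
    have : NeZero q := ⟨by omega⟩
    have hq0 : (0 : ℝ) < q := by exact_mod_cast hq
    have h := tsum_dconv_twistK_sq_le hu hΦ.continuous hΦs hB hf
    have e : (q : ℝ) ^ ((d : ℝ) * (1 - 2)) = ((q : ℝ) ^ d)⁻¹ := by
      rw [show (d : ℝ) * (1 - 2) = -(d : ℝ) by ring, Real.rpow_neg hq0.le, Real.rpow_natCast]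
    rw [e, ← div_eq_mul_inv]
    simpa only [ENNReal.rpow_two] using h

end

section

variable {d q : ℕ}

lemma quadSumPi_add_mul [NeZero q] (u : ℕ) (n k : Fin d → ℤ) :
    quadSumPi q u (fun i => n i + q * k i) = quadSumPi q u n := by
  simp only [quadSumPi_eq_prod, quadSum_eq]
  refine Finset.prod_congr rfl fun i _ => ?_
  push_cast
  simp

lemma kloosterman_add_mul [NeZero q] (N : ℤ) (n k : Fin d → ℤ) :
    kloosterman d q N (fun i => n i + q * k i) = kloosterman d q N n := by
  simp only [kloosterman_eq, quadSumPi_add_mul]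

lemma mHqr_add_int [NeZero q] (r : ℝ) (Ψ : (Fin d → ℝ) → ℝ) (ξ : Fin d → ℝ) (k : Fin d → ℤ) :
    mHqr d q r Ψ (fun i => ξ i + k i) = mHqr d q r Ψ ξ := by
  have hq : (q : ℝ) ≠ 0 := by exact_mod_cast NeZero.ne q
  rw [mHqr, mHqr, ← (Equiv.addRight (fun i => (q : ℤ) * k i)).tsum_eq]
  refine tsum_congr fun n => ?_
  have h1 : (Equiv.addRight (fun i => (q : ℤ) * k i)) n = fun i => n i + q * k i := rfl
  have h2 : (fun i => (q : ℝ) * (ξ i + k i) - ((n i + q * k i : ℤ) : ℝ))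
      = fun i => (q : ℝ) * ξ i - n i := by
    funext i; push_cast; ring
  have h3 : (fun i => ξ i + k i - ((n i + q * k i : ℤ) : ℝ) / q) = fun i => ξ i - n i / q := by
    funext i; push_cast; field_simp; ring
  simp only [h1, kloosterman_add_mul, h2, h3]

/-- The bump attached to each rational point in the multiplier `mHqr`. -/
def localMult (Ψ : (Fin d → ℝ) → ℝ) (t : ℝ) (ξ : Fin d → ℝ) : ℂ :=
  (Ψ ξ : ℂ) * measFT ((sphMeasure d 1).map fun y => t • y) ξ

lemma mHqr_eq_combMult [NeZero q] (hd : 1 ≤ d) {r : ℝ} (hr : 0 < r) {Ψ : (Fin d → ℝ) → ℝ}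
    (hΨ : ∀ x, x ∉ Set.Icc (fun _ => -(1 / 4 : ℝ)) (fun _ => (1 / 4 : ℝ)) → Ψ x = 0)
    {ξ : Fin d → ℝ} (hξ : ξ ∈ ubox fun _ => -(1 / (2 * q : ℝ))) :
    mHqr d q r Ψ ξ = combMult q (fun n => kloosterman d q (radSq r : ℤ) fun i => ((n i : ℕ) : ℤ))
      (localMult Ψ (r / q)) ξ := by
  have hq : (0 : ℝ) < q := by exact_mod_cast NeZero.pos q
  have hinj : Function.Injective fun (n : Fin d → Fin q) (i : Fin d) => ((n i : ℕ) : ℤ) :=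
    fun a b h => funext fun i => Fin.ext (Int.ofNat_inj.1 (congrFun h i))
  rw [mHqr, ← hinj.tsum_eq, tsum_fintype, combMult]
  · refine Finset.sum_congr rfl fun n _ => ?_
    rw [fourierSphMeasure_eq hd hr, localMult, measFT_map_smul, mul_assoc]
    congr 3
    funext i
    simp only [Pi.smul_apply, smul_eq_mul, Int.cast_natCast]
    field_simp
  · intro n hn
    have h1 : Ψ (fun i => (q : ℝ) * ξ i - n i) ≠ 0 := fun h => hn (by simp [h])
    have h2 := not_imp_comm.1 (hΨ _) h1
    have h3 : ∀ i, 0 ≤ n i ∧ n i < q := fun i => by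
      have ha := h2.1 i
      have hb := h2.2 i
      have hc := (hξ i).1
      have hd := (hξ i).2
      simp only at ha hb
      have e1 : -(1 / (2 * q : ℝ)) = (-(1 / 2)) / q := by field_simp
      have e2 : -(1 / (2 * q : ℝ)) + 1 = (q - 1 / 2) / q := by field_simp; ring
      rw [e1, div_lt_iff₀ hq] at hc
      rw [e2, le_div_iff₀ hq] at hd
      constructor
      · have : ((-1 : ℤ) : ℝ) < n i := by push_cast; linarith
        have := Int.cast_lt.1 this
        omega
      · have : (n i : ℝ) < ((q : ℤ) : ℝ) := by push_cast; linarith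
        exact Int.cast_lt.1 this
    refine ⟨fun i => ⟨(n i).toNat, by have := h3 i; omega⟩, funext fun i => ?_⟩
    simp [(h3 i).1]

lemma continuous_localMult [IsFiniteMeasure (sphMeasure d 1)] {Ψ : (Fin d → ℝ) → ℝ}
    (hΨ : Continuous Ψ) (t : ℝ) : Continuous (localMult Ψ t) := by
  have := continuous_measFT (μ := (sphMeasure d 1).map fun y => t • y)
  unfold localMult
  fun_prop

lemma boxCoeff_localMult [IsFiniteMeasure (sphMeasure d 1)] [NeZero q] (N : ℤ)
    {Ψ : (Fin d → ℝ) → ℝ} (hΨ : Continuous Ψ)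
    (hΨs : ∀ x, x ∉ Set.Icc (fun _ => -(1 / 2 : ℝ)) (fun _ => (1 / 2 : ℝ)) → Ψ x = 0) (t : ℝ)
    (x : Fin d → ℤ) :
    boxCoeff (fun _ => -(1 / (2 * q : ℝ)))
        (combMult q (fun n => kloosterman d q N fun i => ((n i : ℕ) : ℤ)) (localMult Ψ t)) x
      = ∑ u : Fin q, if Nat.Coprime (u : ℕ) q then eC (-(((u : ℕ) : ℝ) * (N : ℝ)) / q) *
          twistK q u (scaleK Ψ ((sphMeasure d 1).map fun y => t • y) 1) x else 0 := by
  rw [boxCoeff_combMult (NeZero.pos q) _ (continuous_localMult hΨ t)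
    (fun ξ hξ => by rw [localMult, hΨs ξ hξ]; simp)]
  simp only [kloosterman_eq, Finset.sum_mul]
  rw [Finset.sum_comm]
  refine Finset.sum_congr rfl fun u _ => ?_
  split_ifs
  · rw [← Finset.sum_mul]
    simp_rw [mul_assoc]
    rw [← Finset.mul_sum, sum_quadSumPi_mul, twistK, mul_assoc]
    simp only [scaleK, localMult, one_smul]
  · simp

lemma dconv_eq_sum {f : (Fin d → ℤ) → ℂ} (hf : f.support.Finite) (K : (Fin d → ℤ) → ℂ)
    (x : Fin d → ℤ) : dconv f K x = ∑ y ∈ hf.toFinset, f y * K (x - y) := by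
  refine tsum_eq_sum fun n hn => ?_
  rw [Set.Finite.mem_toFinset, Function.notMem_support] at hn
  rw [hn, zero_mul]

lemma ftZ_add_int (f : (Fin d → ℤ) → ℂ) (ξ : Fin d → ℝ) (k : Fin d → ℤ) :
    ftZ f (fun i => ξ i + k i) = ftZ f ξ := by
  refine tsum_congr fun n => ?_
  have : ∑ i, (n i : ℝ) * (ξ i + k i) = ∑ i, (n i : ℝ) * ξ i + ((∑ i, n i * k i : ℤ) : ℝ) := by
    push_cast
    simp only [mul_add, Finset.sum_add_distrib]
  rw [this, eC_add_int]

lemma mulOp_mHqr_eq [IsFiniteMeasure (sphMeasure d 1)] [NeZero q] (hd : 1 ≤ d) {r : ℝ} (hr : 0 < r)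
    {Ψ : (Fin d → ℝ) → ℝ} (hΨ : IsBump d Ψ) {f : (Fin d → ℤ) → ℂ} (hf : f.support.Finite)
    (x : Fin d → ℤ) :
    mulOp d (mHqr d q r Ψ) f x = ∑ u : Fin q, if Nat.Coprime (u : ℕ) q then
      eC (-(((u : ℕ) : ℝ) * ((radSq r : ℤ) : ℝ)) / q) *
        dconv f (twistK q u (scaleK Ψ ((sphMeasure d 1).map fun y => (r / q) • y) 1)) x else 0 := by
  have hΨs : ∀ x, x ∉ Set.Icc (fun _ => -(1 / 2 : ℝ)) (fun _ => (1 / 2 : ℝ)) → Ψ x = 0 :=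
    fun x hx => hΨ.2.1 x fun h => hx ⟨fun i => (by norm_num : -(1 / 2 : ℝ) ≤ -(1 / 4)).trans (h.1 i),
      fun i => (h.2 i).trans (by norm_num)⟩
  have hcont := continuous_localMult hΨ.1.continuous (r / q)
  have hloc : ∀ ξ, ξ ∉ Set.Icc (fun _ => -(1 / 2 : ℝ)) (fun _ => (1 / 2 : ℝ)) →
      localMult Ψ (r / q) ξ = 0 := fun ξ hξ => by rw [localMult, hΨs ξ hξ]; simp
  set S : (Fin d → Fin q) → ℂ := fun n => kloosterman d q (radSq r : ℤ) fun i => ((n i : ℕ) : ℤ)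
    with hS
  obtain ⟨B, hB⟩ := (HasCompactSupport.intro isCompact_Icc hloc).exists_bound_of_continuous hcont
  have hSb : ∀ n, ‖S n‖ ≤ ∑ n, ‖S n‖ := fun n =>
    Finset.single_le_sum (f := fun n => ‖S n‖) (fun _ _ => norm_nonneg _) (Finset.mem_univ n)
  have hM := norm_combMult_le hSb (Finset.sum_nonneg fun _ _ => norm_nonneg _) hB hloc
  have h1 : mulOp d (mHqr d q r Ψ) f x
      = ∫ ξ in ubox (fun _ => 0), mHqr d q r Ψ ξ * ftZ f ξ * eC (-∑ i, (x i : ℝ) * ξ i) := by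
    rw [mulOp]
    have hbox : ubox (d := d) (fun _ => 0) = Set.univ.pi fun _ => Set.Ioc (0 : ℝ) 1 := by
      ext x; simp [ubox, Set.mem_pi]
    rw [hbox]
    have := Measure.univ_pi_Ioc_ae_eq_Icc (μ := fun _ : Fin d => (volume : Measure ℝ))
      (f := fun _ => 0) (g := fun _ => 1)
    rw [← volume_pi] at this
    exact (setIntegral_congr_set this).symm
  have h2 : mulOp d (mHqr d q r Ψ) f x
      = dconv f (boxCoeff (fun _ => -(1 / (2 * q : ℝ))) (combMult q S (localMult Ψ (r / q)))) x := by
    rw [dconv_boxCoeff _ (continuous_combMult _ hcont).measurable hM hf, h1,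
      setIntegral_ubox_eq_of_periodic (fun ξ n => ?_) _ (fun _ => -(1 / (2 * q : ℝ)))]
    · refine setIntegral_congr_fun (measurableSet_ubox _) fun ξ hξ => ?_
      simp only [mHqr_eq_combMult hd hr hΨ.2.1 hξ, hS]
    · rw [mHqr_add_int, ftZ_add_int]
      congr 1
      have : -∑ i, (x i : ℝ) * (ξ i + n i)
          = -∑ i, (x i : ℝ) * ξ i + ((-∑ i, x i * n i : ℤ) : ℝ) := by
        push_cast
        simp only [mul_add, Finset.sum_add_distrib, neg_add]
      rw [this, eC_add_int]
  rw [h2, dconv_eq_sum hf]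
  simp only [hS, boxCoeff_localMult _ hΨ.1.continuous hΨs, Finset.mul_sum]
  rw [Finset.sum_comm]
  refine Finset.sum_congr rfl fun u _ => ?_
  split_ifs
  · rw [dconv_eq_sum hf, Finset.mul_sum]
    exact Finset.sum_congr rfl fun y _ => by ring
  · simp

end

section

variable {d q : ℕ}

lemma twistK_sub_mul [NeZero q] (u : ℕ) (g : (Fin d → ℝ) → ℂ) (y z : Fin d → ℤ) :
    twistK q u g (fun i => y i - q * z i)
      = eC ((u : ℝ) * (∑ i, (y i : ℝ) ^ 2) / q) *
        (((q : ℝ)⁻¹ ^ d : ℝ) * g (fun i => (y i : ℝ) / q - z i)) := by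
  have hq : (q : ℝ) ≠ 0 := by exact_mod_cast NeZero.ne q
  have h1 : (fun i => ((y i - q * z i : ℤ) : ℝ) / q) = fun i => (y i : ℝ) / q - z i := by
    funext i; push_cast; field_simp
  have h2 := eC_congr_intCast_div (q := q) (a := u * ∑ i, (y i - q * z i) ^ 2)
    (b := u * ∑ i, (y i) ^ 2) (by push_cast; simp)
  push_cast at h2
  simp only [twistK, h1]
  push_cast
  rw [h2]

lemma hasSum_twistK [NeZero q] {μ : Measure (EuclideanSpace ℝ (Fin d))} [IsFiniteMeasure μ]
    {Ψ Φ : (Fin d → ℝ) → ℝ} (hΨ : Continuous Ψ) {c : ℝ} (hc : 2 * c ≤ 1)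
    (hsupp : ∀ x, x ∉ Set.Icc (fun _ => -c) (fun _ => c) → Ψ x = 0) (hΦ : Continuous Φ)
    (hΦs : ∀ x, x ∉ Set.Icc (fun _ => -(1 / 2 : ℝ)) (fun _ => (1 / 2 : ℝ)) → Φ x = 0)
    (hΦ1 : ∀ x, Ψ x ≠ 0 → Φ x = 1) (u : ℕ) (y : Fin d → ℤ) :
    HasSum (fun z : Fin d → ℤ => twistK q u (invFT Φ) (fun i => y i - q * z i) *
      latK (invFT Ψ) 1 μ z) (twistK q u (scaleK Ψ μ 1) y) := by
  have h := (hasSum_sampling (μ := μ) hΨ hc hsupp hΦ hΦs hΦ1 (fun i => (y i : ℝ) / q)).mul_left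
    (eC ((u : ℝ) * (∑ i, (y i : ℝ) ^ 2) / q) * (((q : ℝ)⁻¹ ^ d : ℝ) : ℂ))
  rw [mul_assoc] at h
  refine h.congr_fun fun z => ?_
  rw [twistK_sub_mul]
  ring

/-- The restriction of a function on the lattice to a coset of `qℤ^d`. -/
def cosetRestrict (q : ℕ) (F : (Fin d → ℤ) → ℂ) (j : Fin d → Fin q) (z : Fin d → ℤ) : ℂ :=
  F fun i => z i * q + (j i : ℕ)

lemma tsum_coset [NeZero q] (G : (Fin d → ℤ) → ℝ≥0∞) :
    ∑' x, G x = ∑ j : Fin d → Fin q, ∑' z : Fin d → ℤ, G fun i => z i * q + (j i : ℕ) := by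
  set e : (Fin d → ℤ) ≃ (Fin d → ℤ) × (Fin d → Fin q) :=
    (Equiv.piCongrRight fun _ => Int.divModEquiv q).trans (Equiv.arrowProdEquivProdArrow _ _ _)
    with he
  rw [← e.symm.tsum_eq G, ENNReal.tsum_prod', ENNReal.tsum_comm, tsum_fintype]
  rfl

lemma dconv_twistK_scaleK [NeZero q] {μ : Measure (EuclideanSpace ℝ (Fin d))} [IsFiniteMeasure μ]
    {Ψ Φ : (Fin d → ℝ) → ℝ} (hΨ : Continuous Ψ) {c : ℝ} (hc : 2 * c ≤ 1)
    (hsupp : ∀ x, x ∉ Set.Icc (fun _ => -c) (fun _ => c) → Ψ x = 0) (hΦ : Continuous Φ)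
    (hΦs : ∀ x, x ∉ Set.Icc (fun _ => -(1 / 2 : ℝ)) (fun _ => (1 / 2 : ℝ)) → Φ x = 0)
    (hΦ1 : ∀ x, Ψ x ≠ 0 → Φ x = 1) (u : ℕ) {f : (Fin d → ℤ) → ℂ} (hf : f.support.Finite)
    (j : Fin d → Fin q) (w : Fin d → ℤ) :
    dconv f (twistK q u (scaleK Ψ μ 1)) (fun i => w i * q + (j i : ℕ))
      = dconv (cosetRestrict q (dconv f (twistK q u (invFT Φ))) j) (latK (invFT Ψ) 1 μ) w := by
  set x : Fin d → ℤ := fun i => w i * q + (j i : ℕ) with hx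
  have h1 : HasSum (fun z : Fin d → ℤ => ∑ y ∈ hf.toFinset, f y *
      (twistK q u (invFT Φ) (fun i => (x - y) i - q * z i) * latK (invFT Ψ) 1 μ z))
      (∑ y ∈ hf.toFinset, f y * twistK q u (scaleK Ψ μ 1) (x - y)) :=
    hasSum_sum fun y _ => (hasSum_twistK hΨ hc hsupp hΦ hΦs hΦ1 u (x - y)).mul_left (f y)
  rw [dconv_eq_sum hf, ← h1.tsum_eq]
  conv_rhs => rw [dconv, ← (Equiv.subLeft w).tsum_eq]
  refine tsum_congr fun z => ?_
  rw [Equiv.subLeft_apply, sub_sub_cancel, cosetRestrict, dconv_eq_sum hf, Finset.sum_mul]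
  refine Finset.sum_congr rfl fun y _ => ?_
  rw [mul_assoc]
  congr 3
  funext i
  simp only [hx, Pi.sub_apply]
  ring

end

section

variable {d q : ℕ}

lemma summable_cosetRestrict [NeZero q] {F : (Fin d → ℤ) → ℂ} (hF : ∑' x, ‖F x‖ₑ ≠ ⊤)
    (j : Fin d → Fin q) : Summable fun z => ‖cosetRestrict q F j z‖ := by
  rw [tsum_coset (q := q)] at hF
  have h1 := ENNReal.sum_ne_top.1 hF j (Finset.mem_univ j)
  have h2 := ENNReal.summable_toReal h1
  simp only [toReal_enorm] at h2
  exact h2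

lemma tsum_iSup_twistK_le [NeZero q] {p : ℝ} {ν : Measure (EuclideanSpace ℝ (Fin d))}
    [IsFiniteMeasure ν] {Ψ Φ : (Fin d → ℝ) → ℝ} (hΨ : IsBump d Ψ)
    (hΦ : ContDiff ℝ (⊤ : ℕ∞) Φ)
    (hΦs : ∀ x, x ∉ Set.Icc (fun _ => -(1 / 2 : ℝ)) (fun _ => (1 / 2 : ℝ)) → Φ x = 0)
    (hΦ1 : ∀ x, Ψ x ≠ 0 → Φ x = 1) {C : ℝ} {T : Set ℝ}
    (hmax : ∀ F : (Fin d → ℤ) → ℂ, (Summable fun x => ‖F x‖) →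
      ∑' x, maxConv (fun t : T => latK (invFT Ψ) 1 (ν.map fun y => (t : ℝ) • y)) F x ^ p
        ≤ ENNReal.ofReal C * ∑' x, ‖F x‖ₑ ^ p)
    (u : ℕ) {f : (Fin d → ℤ) → ℂ} (hf : f.support.Finite) :
    ∑' x, (⨆ t : T, ‖dconv f (twistK q u (scaleK Ψ (ν.map fun y => (t : ℝ) • y) 1)) x‖ₑ) ^ p
      ≤ ENNReal.ofReal C * ∑' x, ‖dconv f (twistK q u (invFT Φ)) x‖ₑ ^ p := by
  obtain ⟨A, hA, hnice⟩ := exists_niceKernel_invFT hΦ hΦs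
  have hfin : ∑' x, ‖dconv f (twistK q u (invFT Φ)) x‖ₑ ≠ ⊤ := by
    refine ((tsum_dconv_le (tsum_enorm_twistK_le hnice hA (NeZero.one_le) u) f).trans_lt
      (ENNReal.mul_lt_top ENNReal.ofReal_lt_top ?_)).ne
    rw [tsum_eq_sum (s := hf.toFinset) fun x hx => ?_]
    · exact ENNReal.sum_lt_top.2 fun _ _ => enorm_lt_top
    · rw [Set.Finite.mem_toFinset, Function.notMem_support] at hx
      rw [hx, enorm_zero]
  rw [tsum_coset (q := q), tsum_coset (q := q), Finset.mul_sum]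
  refine Finset.sum_le_sum fun j _ => ?_
  refine le_trans (le_of_eq ?_) (hmax _ (summable_cosetRestrict hfin j))
  refine tsum_congr fun w => ?_
  simp only [maxConv]
  congr 1
  refine iSup_congr fun t => ?_
  rw [dconv_twistK_scaleK hΨ.1.continuous (c := 1 / 4) (by norm_num) hΨ.2.1 hΦ.continuous hΦs hΦ1 u hf]
  rfl

lemma mulOp_mHqr_eq_zero (hd : 1 ≤ d) (h : ¬ IsFiniteMeasure (sphMeasure d 1)) {r : ℝ} (hr : 0 < r)
    (Ψ : (Fin d → ℝ) → ℝ) (f : (Fin d → ℤ) → ℂ) (x : Fin d → ℤ) :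
    mulOp d (mHqr d q r Ψ) f x = 0 := by
  have h1 : ∀ ξ, mHqr d q r Ψ ξ = 0 := fun ξ => by
    simp [mHqr, fourierSphMeasure_eq hd hr, measFT_eq_zero_of_not_finite h]
  simp [mulOp, h1]

lemma enorm_mulOp_mHqr_le [IsFiniteMeasure (sphMeasure d 1)] [NeZero q] (hd : 1 ≤ d) {r : ℝ}
    (hr : 0 < r) {Ψ : (Fin d → ℝ) → ℝ} (hΨ : IsBump d Ψ) {f : (Fin d → ℤ) → ℂ}
    (hf : f.support.Finite) (x : Fin d → ℤ) :
    ‖mulOp d (mHqr d q r Ψ) f x‖ₑ ≤ ∑ u ∈ Finset.univ.filter (fun u : Fin q => Nat.Coprime (u : ℕ) q),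
      ‖dconv f (twistK q u (scaleK Ψ ((sphMeasure d 1).map fun y => (r / q) • y) 1)) x‖ₑ := by
  rw [mulOp_mHqr_eq hd hr hΨ hf, ← Finset.sum_filter]
  refine (enorm_sum_le _ _).trans (Finset.sum_le_sum fun u _ => ?_)
  rw [enorm_mul, ← ofReal_norm (eC _), norm_eC, ENNReal.ofReal_one, one_mul]

end

theorem statement8 (d : ℕ) (hd : 4 ≤ d) (Ψ : (Fin d → ℝ) → ℝ) (hΨ : IsBump d Ψ)
    (R : Set ℝ) (hadm : ∀ r ∈ R, IsAdmissible r) (hlac : Lacunary R)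
    (p : ℝ) (hp1 : 1 < p) (hp2 : p ≤ 2) :
    ∃ C : ℝ, 0 < C ∧ ∀ q : ℕ, 1 ≤ q → ∀ f : (Fin d → ℤ) → ℂ, (Function.support f).Finite →
      (∑' x : Fin d → ℤ,
          (⨆ r : R, ((‖mulOp d (mHqr d q (r : ℝ) Ψ) f x‖₊ : ℝ≥0∞))) ^ p) ^ (1 / p)
        ≤ ENNReal.ofReal (C * (q : ℝ) ^ (1 - (d : ℝ) / (p / (p - 1)))) * lpNorm d p f := by
  have hp0 : 0 < p := by linarith
  by_cases hfin : IsFiniteMeasure (sphMeasure d 1)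
  swap
  · refine ⟨1, one_pos, fun q _ f _ => ?_⟩
    have h0 : ∀ (x : Fin d → ℤ) (r : R), ((‖mulOp d (mHqr d q (r : ℝ) Ψ) f x‖₊ : ℝ≥0∞)) = 0 :=
      fun x r => by rw [mulOp_mHqr_eq_zero (by omega) hfin (hadm r r.2).1]; simp
    simp [h0, hp0]
  obtain ⟨c, hc, hlac⟩ := hlac
  have hsph := isSpherical_sphMeasure hfin
  set Φ : (Fin d → ℝ) → ℝ := fun ξ => Ψ ((1 / 2 : ℝ) • ξ) with hΦdef
  have hΦ : ContDiff ℝ (⊤ : ℕ∞) Φ := hΨ.1.comp (contDiff_const_smul _)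
  have hΦs : ∀ x, x ∉ Set.Icc (fun _ => -(1 / 2 : ℝ)) (fun _ => (1 / 2 : ℝ)) → Φ x = 0 := by
    refine fun x hx => hΨ.2.1 _ fun h => hx ⟨fun i => ?_, fun i => ?_⟩
    · have := h.1 i
      simp only [Pi.smul_apply, smul_eq_mul] at this
      linarith
    · have := h.2 i
      simp only [Pi.smul_apply, smul_eq_mul] at this
      linarith
  have hΦ1 : ∀ x, Ψ x ≠ 0 → Φ x = 1 := by
    intro x hx
    have h := not_imp_comm.1 (hΨ.2.1 x) hx
    refine hΨ.2.2 _ ⟨fun i => ?_, fun i => ?_⟩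
    · have := h.1 i
      simp only [Pi.smul_apply, smul_eq_mul] at this ⊢
      linarith
    · have := h.2 i
      simp only [Pi.smul_apply, smul_eq_mul] at this ⊢
      linarith
  obtain ⟨C₁, hC₁, hmax⟩ := maximal_lacunary (by omega) hsph hΨ hp1 hp2 hc
  obtain ⟨C₂, hC₂, htw⟩ := exists_twist_bound hΦ hΦs hp1 hp2
  refine ⟨(C₁ * C₂) ^ (1 / p) + 1, by positivity, fun q hq f hf => ?_⟩
  have : NeZero q := ⟨by omega⟩
  have hq0 : (0 : ℝ) < q := by exact_mod_cast hq
  set T : Set ℝ := (fun r => r / q) '' R with hT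
  have hT0 : ∀ t ∈ T, 0 < t := by
    rintro _ ⟨r, hr, rfl⟩
    exact div_pos (hadm r hr).1 hq0
  have hTc : ∀ s ∈ T, ∀ t ∈ T, s < t → c * s ≤ t := by
    rintro _ ⟨r, hr, rfl⟩ _ ⟨r', hr', rfl⟩ h
    have := hlac r hr r' hr' ((div_lt_div_iff_of_pos_right hq0).1 h)
    simp only
    rw [← mul_div_assoc]
    gcongr
  set G : ℕ → (Fin d → ℤ) → ℝ≥0∞ := fun u x => ⨆ t : T,
    ‖dconv f (twistK q u (scaleK Ψ ((sphMeasure d 1).map fun y => (t : ℝ) • y) 1)) x‖ₑ with hG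
  set U : Finset (Fin q) := Finset.univ.filter fun u => Nat.Coprime (u : ℕ) q with hU
  have hUc : (U.card : ℝ≥0∞) ≤ q := by
    have := U.card_le_univ
    rw [Fintype.card_fin] at this
    exact_mod_cast this
  have hGu : ∀ u ∈ U, ∑' x, G u x ^ p
      ≤ ENNReal.ofReal (C₁ * C₂ * (q : ℝ) ^ ((d : ℝ) * (1 - p))) * ∑' x, ‖f x‖ₑ ^ p := by
    intro u hu
    refine (tsum_iSup_twistK_le hΨ hΦ hΦs hΦ1 (hmax T hT0 hTc) u hf).trans ?_
    rw [mul_assoc C₁, ENNReal.ofReal_mul hC₁, mul_assoc]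
    gcongr
    exact htw q hq u (Finset.mem_filter.1 hu).2 f hf
  have hsup : ∀ x, (⨆ r : R, ((‖mulOp d (mHqr d q (r : ℝ) Ψ) f x‖₊ : ℝ≥0∞))) ≤ ∑ u ∈ U, G u x := by
    refine fun x => iSup_le fun r => ?_
    refine (enorm_mulOp_mHqr_le (by omega) (hadm r r.2).1 hΨ hf x).trans
      (Finset.sum_le_sum fun u _ => ?_)
    exact le_iSup (fun t : T =>
      ‖dconv f (twistK q u (scaleK Ψ ((sphMeasure d 1).map fun y => (t : ℝ) • y) 1)) x‖ₑ)
      ⟨r / q, r, r.2, rfl⟩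
  have hqE : (q : ℝ≥0∞) = ENNReal.ofReal q := by simp
  have key : ∑' x, (⨆ r : R, ((‖mulOp d (mHqr d q (r : ℝ) Ψ) f x‖₊ : ℝ≥0∞))) ^ p
      ≤ ENNReal.ofReal (C₁ * C₂ * (q : ℝ) ^ (p + (d : ℝ) * (1 - p))) * ∑' x, ‖f x‖ₑ ^ p := by
    calc ∑' x, (⨆ r : R, ((‖mulOp d (mHqr d q (r : ℝ) Ψ) f x‖₊ : ℝ≥0∞))) ^ p
        ≤ ∑' x, (q : ℝ≥0∞) ^ (p - 1) * ∑ u ∈ U, G u x ^ p := by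
          refine ENNReal.tsum_le_tsum fun x => (ENNReal.rpow_le_rpow (hsup x) hp0.le).trans ?_
          refine (ENNReal.rpow_sum_le_const_mul_sum_rpow _ _ hp1.le).trans ?_
          have : 0 ≤ p - 1 := by linarith
          gcongr
      _ = (q : ℝ≥0∞) ^ (p - 1) * ∑ u ∈ U, ∑' x, G u x ^ p := by
          rw [ENNReal.tsum_mul_left, Summable.tsum_finsetSum fun _ _ => ENNReal.summable]
      _ ≤ (q : ℝ≥0∞) ^ (p - 1) * ((q : ℝ≥0∞) *
          (ENNReal.ofReal (C₁ * C₂ * (q : ℝ) ^ ((d : ℝ) * (1 - p))) * ∑' x, ‖f x‖ₑ ^ p)) := by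
          gcongr
          refine (Finset.sum_le_card_nsmul U _ _ hGu).trans ?_
          rw [nsmul_eq_mul]
          gcongr
      _ = _ := by
          rw [hqE, ENNReal.ofReal_rpow_of_pos hq0, ← mul_assoc, ← mul_assoc,
            ← ENNReal.ofReal_mul (by positivity), ← ENNReal.ofReal_mul (by positivity)]
          congr 2
          have e : (q : ℝ) ^ (p + (d : ℝ) * (1 - p))
              = (q : ℝ) ^ (p - 1) * q * (q : ℝ) ^ ((d : ℝ) * (1 - p)) := by
            rw [← Real.rpow_add_one hq0.ne', ← Real.rpow_add hq0]
            congr 1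
            ring
          rw [e]
          ring
  refine (ENNReal.rpow_le_rpow key (by positivity)).trans ?_
  rw [ENNReal.mul_rpow_of_nonneg _ _ (by positivity), ENNReal.ofReal_rpow_of_nonneg (by positivity)
    (by positivity)]
  refine mul_le_mul' (ENNReal.ofReal_le_ofReal ?_) le_rfl
  rw [Real.mul_rpow (by positivity) (by positivity), ← Real.rpow_mul hq0.le]
  have e : (p + (d : ℝ) * (1 - p)) * (1 / p) = 1 - (d : ℝ) / (p / (p - 1)) := by
    have : p - 1 ≠ 0 := by linarith
    field_simp
    ring
  rw [e]
  gcongr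
  linarith

end
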